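/- arXiv:1301.4819 — 2 statements merged into one kernel-verified Lean document; each statement's English description precedes it below -/
import Mathlib

section
/- Let (g_j) be a fractional s-Hajłasz gradient of u with p ≥ Q/(Q+ε) and 0 < ε < ε' < s. Then ⨍_{B(x,2^{-k})} |u - u_{B(x,2^{-k})}| dμ ≤ C 2^{-kε'} Σ_{j ≥ k-2} 2^{-j(s-ε')} ( ⨍_{B(x,2^{-k+1})} g_j^p dμ )^{1/p} for all x ∈ X and k ∈ ℤ. -/
open MeasureTheory Metric ENNReal

namespace FracMaximal

variable {X : Type*}

/-- The measure `μ` is doubling with constant `c`. -/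
def IsDoubling [PseudoMetricSpace X] [MeasurableSpace X] (μ : Measure X) (c : ℝ≥0∞) : Prop :=
  ∀ (x : X) (r : ℝ), 0 < r → μ (ball x (2 * r)) ≤ c * μ (ball x r)

/-- Lower dimension bound: `μ(B(y,r))/μ(B(x,R)) ≥ c (r/R)^Q`. -/
def DimLowerBound [PseudoMetricSpace X] [MeasurableSpace X] (μ : Measure X) (c Q : ℝ) : Prop :=
  ∀ (x y : X) (r R : ℝ), 0 < r → r ≤ R → y ∈ ball x R →
    ENNReal.ofReal (c * (r / R) ^ Q) * μ (ball x R) ≤ μ (ball y r)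

/-- The fractional maximal function `M_α u(x) = sup_{r>0} r^α ⨍_{B(x,r)} |u| dμ`. -/
noncomputable def fracMax [PseudoMetricSpace X] [MeasurableSpace X] (μ : Measure X) (α : ℝ)
    (u : X → ℝ) (x : X) : ℝ≥0∞ :=
  ⨆ (r : ℝ) (_ : 0 < r), ENNReal.ofReal (r ^ α) * ⨍⁻ y in ball x r, ‖u y‖₊ ∂μ

/-- `g` is an `s`-Hajłasz gradient of `u`. -/
def IsHajlaszGradient [PseudoMetricSpace X] [MeasurableSpace X] (μ : Measure X) (s : ℝ)
    (u g : X → ℝ) : Prop :=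
  Measurable g ∧ (∀ x, 0 ≤ g x) ∧ ∃ E : Set X, μ E = 0 ∧
    ∀ x ∉ E, ∀ y ∉ E, |u x - u y| ≤ dist x y ^ s * (g x + g y)

/-- The homogeneous Hajłasz space (quasi)norm `‖u‖_{Ṁ^{s,p}}`. -/
noncomputable def hajlaszNorm [PseudoMetricSpace X] [MeasurableSpace X] (μ : Measure X)
    (s p : ℝ) (u : X → ℝ) : ℝ≥0∞ :=
  ⨅ (g : X → ℝ) (_ : IsHajlaszGradient μ s u g), eLpNorm g (ENNReal.ofReal p) μ

/-- `(g k)` is a fractional `s`-Hajłasz gradient of `u`. -/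
def IsFracHajlaszGradient [PseudoMetricSpace X] [MeasurableSpace X] (μ : Measure X) (s : ℝ)
    (u : X → ℝ) (g : ℤ → X → ℝ) : Prop :=
  (∀ k, Measurable (g k)) ∧ (∀ k x, 0 ≤ g k x) ∧ ∃ E : Set X, μ E = 0 ∧
    ∀ (k : ℤ), ∀ x ∉ E, ∀ y ∉ E,
      (2 : ℝ) ^ (-k - 1) ≤ dist x y → dist x y < (2 : ℝ) ^ (-k) →
        |u x - u y| ≤ dist x y ^ s * (g k x + g k y)

/-- Homogeneous Hajłasz--Triebel--Lizorkin (quasi)norm `‖u‖_{Ṁ^s_{p,q}}`. -/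
noncomputable def tlNorm [PseudoMetricSpace X] [MeasurableSpace X] (μ : Measure X)
    (s p q : ℝ) (u : X → ℝ) : ℝ≥0∞ :=
  ⨅ (g : ℤ → X → ℝ) (_ : IsFracHajlaszGradient μ s u g),
    (∫⁻ x, (∑' k : ℤ, ENNReal.ofReal (g k x ^ q)) ^ (p / q) ∂μ) ^ (1 / p)

/-- Homogeneous Hajłasz--Besov (quasi)norm `‖u‖_{Ṅ^s_{p,q}}`. -/
noncomputable def besovNorm [PseudoMetricSpace X] [MeasurableSpace X] (μ : Measure X)
    (s p q : ℝ) (u : X → ℝ) : ℝ≥0∞ :=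
  ⨅ (g : ℤ → X → ℝ) (_ : IsFracHajlaszGradient μ s u g),
    (∑' k : ℤ, (eLpNorm (g k) (ENNReal.ofReal p) μ) ^ q) ^ (1 / q)

/-- Data for the discrete (fractional) maximal operator: for each positive rational scale `r`,
a covering of `X` by balls `B(x_i, r)` whose dilations `B(x_i, 6r)` have bounded overlap,
together with a Lipschitz partition of unity subordinate to the covering. -/
structure DiscreteMaxData (X : Type*) [PseudoMetricSpace X] where
  center : ℚ → ℕ → X
  φ : ℚ → ℕ → X → ℝ
  N : ℕ
  ν : ℝ
  L : ℝ
  ν_pos : 0 < ν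
  L_pos : 0 < L
  cover : ∀ r : ℚ, 0 < r → ∀ x : X, ∃ i, x ∈ ball (center r i) (r : ℝ)
  overlap : ∀ r : ℚ, 0 < r → ∀ x : X,
    ∑' i : ℕ, (ball (center r i) (6 * (r : ℝ))).indicator (fun _ => (1 : ℝ≥0∞)) x ≤ N
  φ_nonneg : ∀ r i x, 0 ≤ φ r i x
  φ_le_one : ∀ r i x, φ r i x ≤ 1
  φ_supp : ∀ r : ℚ, 0 < r → ∀ i x, x ∉ ball (center r i) (6 * (r : ℝ)) → φ r i x = 0
  φ_lower : ∀ r : ℚ, 0 < r → ∀ i x, x ∈ ball (center r i) (3 * (r : ℝ)) → ν ≤ φ r i x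
  φ_lip : ∀ r : ℚ, 0 < r → ∀ i, LipschitzWith (Real.toNNReal (L / (r : ℝ))) (φ r i)
  φ_sum : ∀ r : ℚ, 0 < r → ∀ x, ∑' i, φ r i x = 1

/-- The discrete fractional maximal function `M*_α u = sup_j r_j^α |u|_{r_j}`, where
`|u|_r(x) = Σ_i φ_i(x) ⨍_{B(x_i,3r)} |u| dμ` is the discrete convolution at scale `3r`. -/
noncomputable def DiscreteMaxData.dMax [PseudoMetricSpace X] [MeasurableSpace X]
    (D : DiscreteMaxData X) (μ : Measure X) (α : ℝ) (u : X → ℝ) (x : X) : ℝ≥0∞ :=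
  ⨆ (r : ℚ) (_ : 0 < r), ENNReal.ofReal ((r : ℝ) ^ α) *
    ∑' i : ℕ, ENNReal.ofReal (D.φ r i x) *
      ⨍⁻ y in ball (D.center r i) (3 * (r : ℝ)), ‖u y‖₊ ∂μ

/-- A ball that is large compared with the superlevel set `{h > N}` meets `{h ≤ N}` off a given
null set. -/
lemma exists_mem_ball_le [MetricSpace X] [MeasurableSpace X] [BorelSpace X] {μ : Measure X}
    {c_Q Q : ℝ} (hdim : DimLowerBound μ c_Q Q) {p : ℝ} (hp : 0 < p)
    {x : X} {R : ℝ} (hB0 : μ (ball x R) ≠ 0) (hBtop : μ (ball x R) ≠ ∞)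
    {h : X → ℝ≥0∞} (hh : Measurable h) {E : Set X} (hE : μ E = 0) {A : ℝ}
    (hA : ∫⁻ y in ball x R, h y ^ p ∂μ ≤ ENNReal.ofReal (A ^ p) * μ (ball x R))
    {y : X} {ρ N : ℝ} (hρ : 0 < ρ) (hρR : ρ ≤ R) (hy : y ∈ ball x R)
    (hsub : ball y ρ ⊆ ball x R) (hN : 0 < N) (hA0 : 0 < A)
    (hlarge : A ^ p < N ^ p * (c_Q * (ρ / R) ^ Q)) :
    ∃ z ∈ ball y ρ, z ∉ E ∧ h z ≤ ENNReal.ofReal N := by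
  by_contra! hcon
  have hle : μ (ball y ρ) ≤ (μ.restrict (ball x R)) {z | ENNReal.ofReal (N ^ p) ≤ h z ^ p} := by
    rw [Measure.restrict_apply (measurableSet_le measurable_const (hh.pow_const p))]
    calc μ (ball y ρ) ≤ μ ({z | ENNReal.ofReal (N ^ p) ≤ h z ^ p} ∩ ball x R ∪ E) := by
          refine measure_mono fun z hz => ?_
          by_cases hzE : z ∈ E
          · exact Or.inr hzE
          · refine Or.inl ⟨?_, hsub hz⟩
            have := (hcon z hz hzE).le
            simp only [Set.mem_ofPred_eq]
            rw [← ENNReal.ofReal_rpow_of_pos hN]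
            exact ENNReal.rpow_le_rpow this hp.le
      _ ≤ _ := by
          refine (measure_union_le _ _).trans ?_
          rw [hE, add_zero]
  have hcheb := mul_meas_ge_le_lintegral₀ (μ := μ.restrict (ball x R))
    (hh.pow_const p).aemeasurable (ENNReal.ofReal (N ^ p))
  have hNp : 0 ≤ N ^ p := (Real.rpow_pos_of_pos hN p).le
  have hchain : ENNReal.ofReal (N ^ p * (c_Q * (ρ / R) ^ Q)) * μ (ball x R) ≤
      ENNReal.ofReal (A ^ p) * μ (ball x R) := by
    rw [ENNReal.ofReal_mul hNp, mul_assoc]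
    calc _ ≤ ENNReal.ofReal (N ^ p) * μ (ball y ρ) := by
          gcongr
          exact hdim x y ρ R hρ hρR hy
      _ ≤ _ := by gcongr
      _ ≤ _ := hcheb
      _ ≤ _ := hA
  rw [ENNReal.mul_le_mul_iff_left hB0 hBtop,
    ENNReal.ofReal_le_ofReal_iff (Real.rpow_pos_of_pos hA0 p).le] at hchain
  linarith

/-- Telescoping along a chain of points with geometrically decreasing values of the generalized
gradient `h`. -/
lemma abs_sub_le_of_chain [MetricSpace X] {x : X} {r θ ε p M L : ℝ} (hr : 0 < r)
    (hθ0 : 0 < θ) (hθ1 : θ < 1) (hε : 0 < ε) (hθε : θ ^ ε * 2 = 2 ^ p) (hM : 0 < M)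
    (hL : 3 ≤ L * (2 ^ p - 1)) (hL4 : 2 * 4 ^ ε ≤ L) {u : X → ℝ} {h : X → ℝ≥0∞} {E : Set X}
    (hu : ∀ y ∈ ball x (2 * r), ∀ z ∈ ball x (2 * r), y ∉ E → z ∉ E → ∀ a b : ℝ,
      h y ≤ ENNReal.ofReal a → h z ≤ ENNReal.ofReal b → 0 ≤ a → 0 ≤ b →
      |u y - u z| ≤ dist y z ^ ε * (a + b))
    (hex : ∀ (n : ℕ) (y : X), y ∈ ball x (2 * r) →
      ball y (r * (1 - θ) * θ ^ n) ⊆ ball x (2 * r) →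
      ∃ z ∈ ball y (r * (1 - θ) * θ ^ n), z ∉ E ∧ h z ≤ ENNReal.ofReal (2 ^ n * M))
    {z₀ : X} (hz₀ : z₀ ∈ ball x (2 * r)) (hz₀E : z₀ ∉ E) (hz₀M : h z₀ ≤ ENNReal.ofReal M)
    (n : ℕ) : ∀ y ∉ E, dist y x + r * (1 - θ ^ n) < 2 * r → h y ≤ ENNReal.ofReal (2 ^ n * M) →
      |u y - u z₀| ≤ L * r ^ ε * M * (2 ^ p) ^ n := by
  induction n with
  | zero =>
    intro y hyE hyd hyM
    simp only [pow_zero, sub_self, mul_zero, add_zero, one_mul, mul_one] at hyd hyM ⊢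
    have hyB : y ∈ ball x (2 * r) := hyd
    have hd : dist y z₀ ≤ 4 * r := by
      have := dist_triangle_right y z₀ x
      rw [mem_ball] at hz₀
      linarith
    calc |u y - u z₀| ≤ dist y z₀ ^ ε * (M + M) :=
          hu y hyB z₀ hz₀ hyE hz₀E M M hyM hz₀M hM.le hM.le
      _ ≤ (4 * r) ^ ε * (M + M) := by gcongr
      _ = 2 * 4 ^ ε * r ^ ε * M := by
          rw [Real.mul_rpow (by norm_num) hr.le]; ring
      _ ≤ L * r ^ ε * M := by gcongr
  | succ n ih =>
    intro y hyE hyd hyM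
    have hθn : 0 < θ ^ n := pow_pos hθ0 n
    have hθn1 : θ ^ (n + 1) ≤ 1 := pow_le_one₀ hθ0.le hθ1.le
    have hθn1' : θ ^ n ≤ 1 := pow_le_one₀ hθ0.le hθ1.le
    have hyB : y ∈ ball x (2 * r) := by
      rw [mem_ball]; nlinarith
    have key : ∀ z ∈ ball y (r * (1 - θ) * θ ^ n), dist z x + r * (1 - θ ^ n) < 2 * r := by
      intro z hz
      rw [mem_ball] at hz
      have := dist_triangle z y x
      have e : r * (1 - θ ^ (n + 1)) = r * (1 - θ) * θ ^ n + r * (1 - θ ^ n) := by ring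
      linarith
    have hsub : ball y (r * (1 - θ) * θ ^ n) ⊆ ball x (2 * r) := by
      intro z hz
      have := key z hz
      rw [mem_ball]; nlinarith
    obtain ⟨z, hz, hzE, hzM⟩ := hex n y hyB hsub
    have h1 := ih z hzE (key z hz) hzM
    have h2 := hu y hyB z (hsub hz) hyE hzE _ _ hyM hzM (by positivity) (by positivity)
    have hd : dist y z ≤ r * θ ^ n := by
      rw [mem_ball, dist_comm] at hz
      nlinarith [mul_pos (mul_pos hr hθ0) hθn]
    have h3 : dist y z ^ ε * (2 ^ (n + 1) * M + 2 ^ n * M) ≤ 3 * (r ^ ε * M * (2 ^ p) ^ n) := by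
      calc _ ≤ (r * θ ^ n) ^ ε * (2 ^ (n + 1) * M + 2 ^ n * M) := by gcongr
        _ = 3 * (r ^ ε * M * (θ ^ ε * 2) ^ n) := by
            rw [Real.mul_rpow hr.le hθn.le, ← Real.rpow_natCast, ← Real.rpow_mul hθ0.le,
              mul_comm (n : ℝ) ε, Real.rpow_mul hθ0.le, Real.rpow_natCast, mul_pow]
            ring
        _ = _ := by rw [hθε]
    have h4 := abs_sub_le (u y) (u z) (u z₀)
    have h5 : 3 * (r ^ ε * M * (2 ^ p) ^ n) ≤ L * (2 ^ p - 1) * (r ^ ε * M * (2 ^ p) ^ n) := by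
      gcongr
    calc |u y - u z₀| ≤ 3 * (r ^ ε * M * (2 ^ p) ^ n) + L * r ^ ε * M * (2 ^ p) ^ n := by linarith
      _ ≤ L * (2 ^ p - 1) * (r ^ ε * M * (2 ^ p) ^ n) + L * r ^ ε * M * (2 ^ p) ^ n := by gcongr
      _ = _ := by rw [pow_succ]; ring

/-- Pointwise form of the Sobolev–Poincaré inequality at the exponent `p = Q / (Q + ε)`. -/
lemma exists_const_abs_sub_le [MetricSpace X] [MeasurableSpace X] [BorelSpace X] {μ : Measure X}
    {c_Q Q ε p : ℝ} (hQ : 0 < Q) (hcQ : 0 < c_Q) (hdim : DimLowerBound μ c_Q Q) (hε : 0 < ε)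
    (hp : p = Q / (Q + ε)) :
    ∃ C : ℝ, 0 < C ∧ ∀ (x : X) (r : ℝ) (u : X → ℝ) (h : X → ℝ≥0∞) (E : Set X) (A : ℝ), 0 < r →
      μ (ball x (2 * r)) ≠ 0 → μ (ball x (2 * r)) ≠ ∞ → Measurable h → μ E = 0 → 0 < A →
      ∫⁻ y in ball x (2 * r), h y ^ p ∂μ ≤ ENNReal.ofReal (A ^ p) * μ (ball x (2 * r)) →
      (∀ y ∈ ball x (2 * r), ∀ z ∈ ball x (2 * r), y ∉ E → z ∉ E → ∀ a b : ℝ,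
        h y ≤ ENNReal.ofReal a → h z ≤ ENNReal.ofReal b → 0 ≤ a → 0 ≤ b →
        |u y - u z| ≤ dist y z ^ ε * (a + b)) →
      ∃ c : ℝ, ∀ y ∈ ball x r, y ∉ E → h y ≠ ∞ →
        |u y - c| ≤ C * r ^ ε * A * (1 + (h y).toReal ^ p / A ^ p) := by
  have hp0 : 0 < p := by rw [hp]; positivity
  have hp1 : p * ε / Q = 1 - p := by rw [hp]; field_simp; ring
  obtain ⟨θ, hθdef⟩ : ∃ θ : ℝ, θ = 2 ^ (-(p / Q)) := ⟨_, rfl⟩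
  have hθ0 : 0 < θ := by rw [hθdef]; positivity
  have hθ1 : θ < 1 := by
    rw [hθdef]
    exact Real.rpow_lt_one_of_one_lt_of_neg (by norm_num) (by have := div_pos hp0 hQ; linarith)
  have hθε : θ ^ ε * 2 = 2 ^ p := by
    rw [hθdef, ← Real.rpow_mul (by norm_num)]
    nth_rewrite 2 [← Real.rpow_one 2]
    rw [← Real.rpow_add (by norm_num)]
    congr 1
    have : -(p / Q) * ε = -(p * ε / Q) := by ring
    rw [this, hp1]; ring
  have hθQ : θ ^ Q * 2 ^ p = 1 := by
    rw [hθdef, ← Real.rpow_mul (by norm_num), ← Real.rpow_add (by norm_num)]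
    have : -(p / Q) * Q + p = 0 := by field_simp; ring
    rw [this, Real.rpow_zero]
  have h2p : 1 < (2 : ℝ) ^ p := Real.one_lt_rpow (by norm_num) hp0
  obtain ⟨κ, hκdef⟩ : ∃ κ : ℝ, κ = c_Q * ((1 - θ) / 2) ^ Q := ⟨_, rfl⟩
  have hκ : 0 < κ := by
    rw [hκdef]
    have : 0 < (1 - θ) / 2 := by linarith
    positivity
  obtain ⟨t, ht0, ht⟩ : ∃ t : ℝ, 1 ≤ t ∧ 1 < t ^ p * κ := by
    have := ((tendsto_rpow_atTop hp0).eventually_gt_atTop (1 / κ)).and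
      (Filter.eventually_ge_atTop 1)
    obtain ⟨t, h1, h2⟩ := this.exists
    exact ⟨t, h2, by rwa [div_lt_iff₀ hκ] at h1⟩
  have ht00 : 0 < t := by linarith
  obtain ⟨L, hLdef⟩ : ∃ L : ℝ, L = 3 / (2 ^ p - 1) + 2 * 4 ^ ε := ⟨_, rfl⟩
  have h2p' : 0 < (2 : ℝ) ^ p - 1 := by linarith
  have hL3 : 3 ≤ L * (2 ^ p - 1) := by
    rw [hLdef, add_mul, div_mul_cancel₀ _ h2p'.ne']
    have : 0 < 2 * (4 : ℝ) ^ ε * (2 ^ p - 1) := by positivity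
    linarith
  have hL4 : 2 * 4 ^ ε ≤ L := by
    rw [hLdef]
    have : 0 < 3 / ((2 : ℝ) ^ p - 1) := by positivity
    linarith
  have hL0 : 0 < L := lt_of_lt_of_le (by positivity) hL4
  refine ⟨L * t * 2 ^ p, by positivity, ?_⟩
  intro x r u h E A hr hB0 hBtop hh hE hA hint hu
  have hM : 0 < A * t := by positivity
  have hex : ∀ (n : ℕ) (y : X), y ∈ ball x (2 * r) →
      ball y (r * (1 - θ) * θ ^ n) ⊆ ball x (2 * r) →
      ∃ z ∈ ball y (r * (1 - θ) * θ ^ n), z ∉ E ∧ h z ≤ ENNReal.ofReal (2 ^ n * (A * t)) := by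
    intro n y hy hsub
    have hθn : 0 < θ ^ n := pow_pos hθ0 n
    have hθn1 : θ ^ n ≤ 1 := pow_le_one₀ hθ0.le hθ1.le
    have h1θ : 0 < 1 - θ := by linarith
    refine exists_mem_ball_le hdim hp0 hB0 hBtop hh hE hint (by positivity) ?_ hy hsub
      (by positivity) hA ?_
    · have : (1 - θ) * θ ^ n ≤ 1 := mul_le_one₀ (by linarith) hθn.le hθn1
      nlinarith
    · have e1 : r * (1 - θ) * θ ^ n / (2 * r) = (1 - θ) / 2 * θ ^ n := by
        field_simp
      have e2 : (θ ^ n) ^ Q = (θ ^ Q) ^ n := by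
        rw [← Real.rpow_natCast, ← Real.rpow_mul hθ0.le, mul_comm (n : ℝ), Real.rpow_mul hθ0.le,
          Real.rpow_natCast]
      have e3 : ((2 : ℝ) ^ n) ^ p = (2 ^ p) ^ n := by
        rw [← Real.rpow_natCast, ← Real.rpow_mul (by norm_num), mul_comm (n : ℝ),
          Real.rpow_mul (by norm_num), Real.rpow_natCast]
      rw [e1, Real.mul_rpow (by positivity) (by positivity), Real.mul_rpow hA.le ht00.le,
        Real.mul_rpow (by positivity) (by positivity), e2, e3]
      have e4 : (2 ^ p) ^ n * (A ^ p * t ^ p) * (c_Q * (((1 - θ) / 2) ^ Q * (θ ^ Q) ^ n)) =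
          A ^ p * (t ^ p * κ) * (θ ^ Q * 2 ^ p) ^ n := by
        rw [hκdef, mul_pow]; ring
      rw [e4, hθQ, one_pow, mul_one]
      exact lt_mul_of_one_lt_right (by positivity) ht
  obtain ⟨z₀, hz₀, hz₀E, hz₀M⟩ : ∃ z ∈ ball x (2 * r), z ∉ E ∧ h z ≤ ENNReal.ofReal (A * t) := by
    have hs : ball x (r * (1 - θ) * θ ^ 0) ⊆ ball x (2 * r) :=
      ball_subset_ball (by rw [pow_zero, mul_one]; nlinarith)
    obtain ⟨z, hz, h1, h2⟩ := hex 0 x (mem_ball_self (by positivity)) hs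
    exact ⟨z, hs hz, h1, by simpa using h2⟩
  have hchain := abs_sub_le_of_chain hr hθ0 hθ1 hε hθε hM hL3 hL4 hu hex hz₀ hz₀E hz₀M
  refine ⟨u z₀, fun y hy hyE hytop => ?_⟩
  have hd : ∀ n : ℕ, dist y x + r * (1 - θ ^ n) < 2 * r := by
    intro n
    rw [mem_ball] at hy
    nlinarith [mul_pos hr (pow_pos hθ0 n)]
  obtain ⟨H, hH⟩ : ∃ H : ℝ, H = (h y).toReal := ⟨_, rfl⟩
  have hH0 : 0 ≤ H := by rw [hH]; exact ENNReal.toReal_nonneg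
  have hHy : h y = ENNReal.ofReal H := by rw [hH, ENNReal.ofReal_toReal hytop]
  rw [← hH]
  have hHp : 0 ≤ H ^ p / A ^ p := by positivity
  by_cases hHM : H ≤ A * t
  · have := hchain 0 y hyE (hd 0) (by rw [hHy]; exact ENNReal.ofReal_le_ofReal (by simpa using hHM))
    rw [pow_zero, mul_one] at this
    calc |u y - u z₀| ≤ L * r ^ ε * (A * t) * 1 * (1 + 0) := by linarith
      _ ≤ L * r ^ ε * (A * t) * 2 ^ p * (1 + H ^ p / A ^ p) := by gcongr
      _ = _ := by ring
  · push Not at hHM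
    obtain ⟨n, hn1, hn2⟩ := exists_nat_pow_near (x := H / (A * t)) (y := 2)
      (by rw [le_div_iff₀ hM]; linarith) (by norm_num)
    rw [le_div_iff₀ hM] at hn1
    rw [div_lt_iff₀ hM] at hn2
    have h1 := hchain (n + 1) y hyE (hd _) (by rw [hHy]; exact ENNReal.ofReal_le_ofReal hn2.le)
    have h2 : ((2 : ℝ) ^ p) ^ n ≤ H ^ p / A ^ p := by
      rw [le_div_iff₀ (by positivity)]
      calc ((2 : ℝ) ^ p) ^ n * A ^ p = (2 ^ n * A) ^ p := by
            rw [Real.mul_rpow (by positivity) hA.le]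
            congr 1
            rw [← Real.rpow_natCast, ← Real.rpow_mul (by norm_num), mul_comm p,
              Real.rpow_mul (by norm_num), Real.rpow_natCast]
        _ ≤ H ^ p := by
            refine Real.rpow_le_rpow (by positivity) (le_trans ?_ hn1) hp0.le
            have : (2 : ℝ) ^ n * A * 1 ≤ 2 ^ n * A * t := by gcongr
            linarith
    calc |u y - u z₀| ≤ L * r ^ ε * (A * t) * (2 ^ p) ^ (n + 1) := h1
      _ = L * r ^ ε * (A * t) * 2 ^ p * (2 ^ p) ^ n := by rw [pow_succ]; ring
      _ ≤ L * r ^ ε * (A * t) * 2 ^ p * (1 + H ^ p / A ^ p) := by gcongr; linarith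
      _ = _ := by ring

/-- Sobolev–Poincaré inequality on balls at the exponent `p = Q / (Q + ε)`. -/
lemma exists_setAverage_abs_sub_le [MetricSpace X] [MeasurableSpace X] [BorelSpace X]
    {μ : Measure X} {c_Q Q ε p : ℝ} (hQ : 0 < Q) (hcQ : 0 < c_Q) (hdim : DimLowerBound μ c_Q Q)
    (hε : 0 < ε) (hp : p = Q / (Q + ε)) :
    ∃ C : ℝ, 0 < C ∧ ∀ (x : X) (r : ℝ) (u : X → ℝ) (h : X → ℝ≥0∞) (E : Set X) (A : ℝ), 0 < r →
      μ (ball x r) ≠ 0 → μ (ball x (2 * r)) ≠ ∞ → Measurable h → μ E = 0 → 0 < A →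
      ∫⁻ y in ball x (2 * r), h y ^ p ∂μ ≤ ENNReal.ofReal (A ^ p) * μ (ball x (2 * r)) →
      (∀ y ∈ ball x (2 * r), ∀ z ∈ ball x (2 * r), y ∉ E → z ∉ E → ∀ a b : ℝ,
        h y ≤ ENNReal.ofReal a → h z ≤ ENNReal.ofReal b → 0 ≤ a → 0 ≤ b →
        |u y - u z| ≤ dist y z ^ ε * (a + b)) →
      ⨍ y in ball x r, |u y - ⨍ z in ball x r, u z ∂μ| ∂μ ≤ C * r ^ ε * A := by
  have hp0 : 0 < p := by rw [hp]; positivity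
  obtain ⟨C, hC, hmain⟩ := exists_const_abs_sub_le hQ hcQ hdim hε hp
  refine ⟨2 * (C * (1 + 2 ^ Q / c_Q)), by positivity, ?_⟩
  intro x r u h E A hr hB0 hBtop hh hE hA hint hu
  have hsub : ball x r ⊆ ball x (2 * r) := ball_subset_ball (by linarith)
  have hBtop' : μ (ball x r) ≠ ∞ := ne_top_of_le_ne_top hBtop (measure_mono hsub)
  have hB20 : μ (ball x (2 * r)) ≠ 0 := fun h0 => hB0 (measure_mono_null hsub h0)
  obtain ⟨c, hc⟩ := hmain x r u h E A hr hB20 hBtop hh hE hA hint hu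
  have hAp : 0 < A ^ p := by positivity
  have hm : 0 < μ.real (ball x r) := ENNReal.toReal_pos hB0 hBtop'
  have hfin : IsFiniteMeasure (μ.restrict (ball x r)) := ⟨by simpa using hBtop'.lt_top⟩
  have hlint : ∫⁻ y in ball x r, h y ^ p ∂μ ≤ ENNReal.ofReal (A ^ p) * μ (ball x (2 * r)) :=
    (lintegral_mono_set hsub).trans hint
  have hlint_top : ∫⁻ y in ball x r, h y ^ p ∂μ ≠ ∞ :=
    ne_top_of_le_ne_top (ENNReal.mul_ne_top ENNReal.ofReal_ne_top hBtop) hlint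
  have hhtop : ∀ᵐ y ∂μ.restrict (ball x r), h y ≠ ∞ := by
    filter_upwards [ae_lt_top (hh.pow_const p) hlint_top] with y hy
    intro h1
    rw [h1, ENNReal.top_rpow_of_pos hp0] at hy
    exact lt_irrefl _ hy
  have hEae : ∀ᵐ y ∂μ.restrict (ball x r), y ∉ toMeasurable μ E :=
    ae_restrict_of_ae (measure_eq_zero_iff_ae_notMem.1 ((measure_toMeasurable E).trans hE))
  have humeas : AEMeasurable u (μ.restrict (ball x r)) := by
    let F : ℕ → Set X := fun n => (ball x r ∩ {y | h y ≤ ENNReal.ofReal n}) \ toMeasurable μ E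
    have hFm : ∀ n, MeasurableSet (F n) := fun n =>
      (measurableSet_ball.inter (measurableSet_le hh measurable_const)).diff
        (measurableSet_toMeasurable μ E)
    have hFc : ∀ n, ContinuousOn u (F n) := by
      intro n y hy
      have hlim : Filter.Tendsto (fun z => dist z y ^ ε * ((n : ℝ) + n)) (nhdsWithin y (F n))
          (nhds 0) := by
        have h1 : Continuous (fun z : X => dist z y ^ ε * ((n : ℝ) + n)) :=
          ((continuous_id.dist continuous_const).rpow_const fun _ => Or.inr hε.le).mul
            continuous_const
        have h2 := (h1.tendsto y).mono_left (nhdsWithin_le_nhds (s := F n))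
        simpa [Real.zero_rpow hε.ne'] using h2
      refine tendsto_iff_dist_tendsto_zero.2 (squeeze_zero' (Filter.Eventually.of_forall
        fun _ => dist_nonneg) ?_ hlim)
      filter_upwards [self_mem_nhdsWithin] with z hz
      rw [Real.dist_eq]
      exact hu z (hsub hz.1.1) y (hsub hy.1.1) (fun hzE => hz.2 (subset_toMeasurable μ E hzE))
        (fun hyE => hy.2 (subset_toMeasurable μ E hyE)) n n hz.1.2 hy.1.2 n.cast_nonneg
        n.cast_nonneg
    have hU : AEMeasurable u (μ.restrict (⋃ n, F n)) :=
      aemeasurable_iUnion_iff.2 fun n => (hFc n).aemeasurable (hFm n)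
    have hcongr : μ.restrict (⋃ n, F n) = μ.restrict (ball x r) := by
      refine Measure.restrict_congr_set (Filter.EventuallyLE.antisymm
        (Filter.Eventually.of_forall (Set.iUnion_subset fun n y hy => hy.1.1)) ?_)
      filter_upwards [(ae_restrict_iff' measurableSet_ball).1 hhtop,
        (ae_restrict_iff' measurableSet_ball).1 hEae] with y hy1 hy2 hyB
      obtain ⟨n, hn⟩ := exists_nat_ge (h y).toReal
      refine Set.mem_iUnion.2 ⟨n, ⟨hyB, ?_⟩, hy2 hyB⟩
      exact (ENNReal.le_ofReal_iff_toReal_le (hy1 hyB) n.cast_nonneg).2 hn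
    rwa [hcongr] at hU
  have hhint : Integrable (fun y => (h y).toReal ^ p) (μ.restrict (ball x r)) := by
    simp_rw [ENNReal.toReal_rpow]
    exact integrable_toReal_of_lintegral_ne_top (hh.pow_const p).aemeasurable hlint_top
  have hhle : ∫ y in ball x r, (h y).toReal ^ p ∂μ ≤
      A ^ p * (2 ^ Q / c_Q) * μ.real (ball x r) := by
    have h1 : ∫ y in ball x r, (h y).toReal ^ p ∂μ ≤ A ^ p * μ.real (ball x (2 * r)) := by
      simp_rw [ENNReal.toReal_rpow]
      rw [integral_toReal (hh.pow_const p).aemeasurable (ae_lt_top (hh.pow_const p) hlint_top)]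
      have := ENNReal.toReal_mono (ENNReal.mul_ne_top ENNReal.ofReal_ne_top hBtop) hlint
      rwa [ENNReal.toReal_mul, ENNReal.toReal_ofReal hAp.le] at this
    have h2 : c_Q / 2 ^ Q * μ.real (ball x (2 * r)) ≤ μ.real (ball x r) := by
      have h3 := hdim x x r (2 * r) hr (by linarith) (mem_ball_self (by linarith))
      have h4 := ENNReal.toReal_mono hBtop' h3
      have e : r / (2 * r) = 2⁻¹ := by field_simp
      rw [ENNReal.toReal_mul, e, Real.inv_rpow (by norm_num),
        ENNReal.toReal_ofReal (by positivity)] at h4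
      exact h4
    have h3 : μ.real (ball x (2 * r)) ≤ 2 ^ Q / c_Q * μ.real (ball x r) := by
      calc μ.real (ball x (2 * r)) = 2 ^ Q / c_Q * (c_Q / 2 ^ Q * μ.real (ball x (2 * r))) := by
            field_simp
        _ ≤ _ := by gcongr
    calc _ ≤ A ^ p * μ.real (ball x (2 * r)) := h1
      _ ≤ A ^ p * (2 ^ Q / c_Q * μ.real (ball x r)) := by gcongr
      _ = _ := by ring
  obtain ⟨D, hD⟩ : ∃ D : ℝ, D = C * (1 + 2 ^ Q / c_Q) * r ^ ε * A := ⟨_, rfl⟩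
  have hvint : Integrable (fun y => C * r ^ ε * A * (1 + (h y).toReal ^ p / A ^ p))
      (μ.restrict (ball x r)) :=
    ((integrable_const _).add (hhint.div_const _)).const_mul _
  have hbound : ∀ᵐ y ∂μ.restrict (ball x r),
      |u y - c| ≤ C * r ^ ε * A * (1 + (h y).toReal ^ p / A ^ p) := by
    filter_upwards [hhtop, hEae, ae_restrict_mem measurableSet_ball] with y hy1 hy2 hy3
    exact hc y hy3 (fun hyE => hy2 (subset_toMeasurable μ E hyE)) hy1
  have hucint : Integrable (fun y => u y - c) (μ.restrict (ball x r)) :=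
    hvint.mono' (humeas.sub_const c).aestronglyMeasurable hbound
  have huint : Integrable u (μ.restrict (ball x r)) :=
    (hucint.add (integrable_const c)).congr (ae_of_all _ fun y => by simp)
  have hDle : ∫ y in ball x r, |u y - c| ∂μ ≤ D * μ.real (ball x r) := by
    calc _ ≤ ∫ y in ball x r, C * r ^ ε * A * (1 + (h y).toReal ^ p / A ^ p) ∂μ :=
          integral_mono_ae hucint.abs hvint hbound
      _ = C * r ^ ε * A * (μ.real (ball x r) +
            (∫ y in ball x r, (h y).toReal ^ p ∂μ) / A ^ p) := by
          rw [integral_const_mul, integral_add (integrable_const _) (hhint.div_const _),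
            integral_div]
          simp
      _ ≤ C * r ^ ε * A * (μ.real (ball x r) +
            (A ^ p * (2 ^ Q / c_Q) * μ.real (ball x r)) / A ^ p) := by gcongr
      _ = D * μ.real (ball x r) := by rw [hD]; field_simp
  obtain ⟨m, hmdef⟩ : ∃ m : ℝ, m = ⨍ z in ball x r, u z ∂μ := ⟨_, rfl⟩
  have hmc : |m - c| ≤ D := by
    have e : m - c = (μ.real (ball x r))⁻¹ * ∫ y in ball x r, (u y - c) ∂μ := by
      rw [hmdef, setAverage_eq, integral_sub huint (integrable_const _), setIntegral_const,
        smul_eq_mul, smul_eq_mul]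
      field_simp
    rw [e, abs_mul, abs_of_pos (inv_pos.2 hm), inv_mul_le_iff₀ hm, mul_comm]
    exact (abs_integral_le_integral_abs).trans hDle
  rw [← hmdef, setAverage_eq, smul_eq_mul, inv_mul_le_iff₀ hm]
  calc ∫ y in ball x r, |u y - m| ∂μ ≤ ∫ y in ball x r, (|u y - c| + D) ∂μ := by
        refine integral_mono (huint.sub (integrable_const m)).abs
          (hucint.abs.add (integrable_const D)) fun y => ?_
        have := abs_sub_le (u y) c m
        rw [abs_sub_comm c m] at this
        simp only
        linarith
    _ = ∫ y in ball x r, |u y - c| ∂μ + μ.real (ball x r) * D := by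
        rw [integral_add hucint.abs (integrable_const D), setIntegral_const, smul_eq_mul]
    _ ≤ D * μ.real (ball x r) + μ.real (ball x r) * D := by gcongr
    _ = _ := by rw [hD]; ring

lemma lintegral_iSup_rpow_le_tsum {ι : Type*} [Countable ι] [MeasurableSpace X] (μ : Measure X)
    {p : ℝ} (hp : 0 < p) {W : ι → X → ℝ≥0∞} (hW : ∀ i, Measurable (W i)) :
    ∫⁻ y, (⨆ i, W i y) ^ p ∂μ ≤ ∑' i, ∫⁻ y, W i y ^ p ∂μ := by
  rw [← lintegral_tsum fun i => ((hW i).pow_const p).aemeasurable]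
  refine lintegral_mono fun y => ?_
  rw [← ENNReal.le_rpow_inv_iff hp]
  exact iSup_le fun i => (ENNReal.le_rpow_inv_iff hp).2 (ENNReal.le_tsum i)

lemma setLAverage_rpow_le [MeasurableSpace X] {μ : Measure X} {B : Set X} (h0 : μ B ≠ 0)
    (htop : μ B ≠ ∞) {f : X → ℝ} (hf : Measurable f) (hf0 : ∀ y, 0 ≤ f y) {p q : ℝ} (hp : 0 < p)
    (hpq : p ≤ q) :
    ⨍⁻ y in B, ENNReal.ofReal (f y ^ p) ∂μ ≤
      ((⨍⁻ y in B, ENNReal.ofReal (f y ^ q) ∂μ) ^ (1 / q)) ^ p := by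
  have hfin : IsFiniteMeasure (μ.restrict B) := ⟨by simpa using htop.lt_top⟩
  have hne : NeZero (μ.restrict B) := ⟨by simpa using h0⟩
  have h := eLpNorm'_le_eLpNorm'_of_exponent_le hp hpq
    (((μ.restrict B) Set.univ)⁻¹ • μ.restrict B) (f := f) hf.aestronglyMeasurable
  have e : ∀ t : ℝ, 0 < t → ∀ y, ‖f y‖ₑ ^ t = ENNReal.ofReal (f y ^ t) := by
    intro t ht y
    rw [Real.enorm_of_nonneg (hf0 y), ENNReal.ofReal_rpow_of_nonneg (hf0 y) ht.le]
  simp only [eLpNorm'_eq_lintegral_enorm, e p hp, e q (hp.trans_le hpq)] at h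
  have h2 := ENNReal.rpow_le_rpow h hp.le
  rw [← ENNReal.rpow_mul, one_div_mul_cancel hp.ne', ENNReal.rpow_one] at h2
  exact h2

/-- The supremum of the weighted gradients at scales `j ≥ k - 2` is a Hajłasz gradient of order `ε`
on a ball of radius `2 * 2 ^ (-k)`. -/
lemma abs_sub_le_of_iSup_le [MetricSpace X] {s ε : ℝ} (hεs : ε < s) {u : X → ℝ} {g : ℤ → X → ℝ}
    (hg0 : ∀ k x, 0 ≤ g k x) {E : Set X}
    (hE : ∀ (k : ℤ), ∀ x ∉ E, ∀ y ∉ E, (2 : ℝ) ^ (-k - 1) ≤ dist x y →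
      dist x y < (2 : ℝ) ^ (-k) → |u x - u y| ≤ dist x y ^ s * (g k x + g k y))
    {x : X} {k : ℤ} {y z : X} (hy : y ∈ ball x (2 * (2 : ℝ) ^ (-k)))
    (hz : z ∈ ball x (2 * (2 : ℝ) ^ (-k))) (hyE : y ∉ E) (hzE : z ∉ E) {a b : ℝ}
    (ha : ⨆ i : ℕ, ENNReal.ofReal
      ((2 : ℝ) ^ (-((k - 2 + i : ℤ) : ℝ) * (s - ε)) * g (k - 2 + i) y) ≤ ENNReal.ofReal a)
    (hb : ⨆ i : ℕ, ENNReal.ofReal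
      ((2 : ℝ) ^ (-((k - 2 + i : ℤ) : ℝ) * (s - ε)) * g (k - 2 + i) z) ≤ ENNReal.ofReal b)
    (ha0 : 0 ≤ a) (hb0 : 0 ≤ b) :
    |u y - u z| ≤ dist y z ^ ε * (a + b) := by
  rcases eq_or_ne y z with rfl | hyz
  · rw [sub_self, abs_zero]
    positivity
  have hd : 0 < dist y z := dist_pos.2 hyz
  obtain ⟨n, hn1, hn2⟩ := exists_mem_Ico_zpow hd (by norm_num : (1 : ℝ) < 2)
  have hd4 : dist y z < (2 : ℝ) ^ (-k + 2) := by
    rw [mem_ball] at hy hz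
    have := dist_triangle_right y z x
    have e : (2 : ℝ) ^ (-k + 2) = 2 * (2 * 2 ^ (-k)) := by
      rw [zpow_add₀ (by norm_num), zpow_ofNat]
      ring
    linarith
  have hnk : n < -k + 2 := (zpow_lt_zpow_iff_right₀ (by norm_num : (1 : ℝ) < 2)).1 (hn1.trans_lt hd4)
  obtain ⟨i, hi⟩ := Int.eq_ofNat_of_zero_le (show 0 ≤ -n - 1 - (k - 2) by lia)
  obtain ⟨j, hj⟩ : ∃ j : ℤ, j = k - 2 + i := ⟨_, rfl⟩
  have hjn : n = -j - 1 := by lia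
  have hdj : dist y z < (2 : ℝ) ^ (-j) := by
    rwa [show -j = n + 1 by lia]
  have hu := hE j y hyE z hzE (hjn ▸ hn1) hdj
  have ha' := (le_iSup (fun i : ℕ => ENNReal.ofReal
    ((2 : ℝ) ^ (-((k - 2 + i : ℤ) : ℝ) * (s - ε)) * g (k - 2 + i) y)) i).trans ha
  have hb' := (le_iSup (fun i : ℕ => ENNReal.ofReal
    ((2 : ℝ) ^ (-((k - 2 + i : ℤ) : ℝ) * (s - ε)) * g (k - 2 + i) z)) i).trans hb
  simp only [← hj] at ha' hb'
  rw [ENNReal.ofReal_le_ofReal_iff ha0] at ha'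
  rw [ENNReal.ofReal_le_ofReal_iff hb0] at hb'
  have hgy := hg0 j y
  have hgz := hg0 j z
  have hpow : dist y z ^ (s - ε) ≤ 2 ^ (-(j : ℝ) * (s - ε)) := by
    rw [Real.rpow_mul (by norm_num)]
    refine Real.rpow_le_rpow hd.le ?_ (by linarith)
    rw [← Int.cast_neg, Real.rpow_intCast]
    exact hdj.le
  calc |u y - u z| ≤ dist y z ^ s * (g j y + g j z) := hu
    _ = dist y z ^ ε * (dist y z ^ (s - ε) * (g j y + g j z)) := by
        rw [← mul_assoc, ← Real.rpow_add hd]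
        congr 2
        ring
    _ ≤ dist y z ^ ε * (2 ^ (-(j : ℝ) * (s - ε)) * (g j y + g j z)) := by gcongr
    _ ≤ dist y z ^ ε * (a + b) := by
        gcongr
        linarith

/-- The geometric weights gained from `ε < ε'` control the `L^p` mean of the supremum of the
weighted gradients by a single bound `S` for the weighted `L^q` means. -/
lemma exists_lintegral_iSup_rpow_le [MeasurableSpace X] {μ : Measure X} {s p q ε ε' : ℝ}
    (hp : 0 < p) (hpq : p ≤ q) (hεε' : ε < ε') :
    ∃ K : ℝ, 0 < K ∧ ∀ (g : ℤ → X → ℝ) (B : Set X) (k : ℤ) (S : ℝ), (∀ j, Measurable (g j)) →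
      (∀ j x, 0 ≤ g j x) → μ B ≠ 0 → μ B ≠ ∞ → 0 ≤ S →
      (∀ j : ℤ, k - 2 ≤ j → ENNReal.ofReal ((2 : ℝ) ^ (-(j : ℝ) * (s - ε'))) *
        (⨍⁻ y in B, ENNReal.ofReal (g j y ^ q) ∂μ) ^ (1 / q) ≤ ENNReal.ofReal S) →
      ∫⁻ y in B, (⨆ i : ℕ, ENNReal.ofReal
        ((2 : ℝ) ^ (-((k - 2 + i : ℤ) : ℝ) * (s - ε)) * g (k - 2 + i) y)) ^ p ∂μ ≤
        ENNReal.ofReal ((K * 2 ^ (-(k : ℝ) * (ε' - ε)) * S) ^ p) * μ B := by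
  obtain ⟨δ, hδ⟩ : ∃ δ : ℝ, δ = ε' - ε := ⟨_, rfl⟩
  have hδ0 : 0 < δ * p := mul_pos (by linarith) hp
  obtain ⟨w, hw⟩ : ∃ w : ℝ, w = 2 ^ (-(δ * p)) := ⟨_, rfl⟩
  have hw0 : 0 < w := by rw [hw]; positivity
  have hw1 : w < 1 := by
    rw [hw]
    exact Real.rpow_lt_one_of_one_lt_of_neg (by norm_num) (by linarith)
  have h1w : 0 < 1 - w := by linarith
  refine ⟨(2 ^ (2 * (δ * p)) * (1 - w)⁻¹) ^ (1 / p), by positivity, ?_⟩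
  intro g B k S hg hg0 hB0 hBtop hS hle
  refine (lintegral_iSup_rpow_le_tsum _ hp fun i =>
    ((hg _).const_mul _).ennreal_ofReal).trans ?_
  have hterm : ∀ i : ℕ, ∫⁻ y in B, ENNReal.ofReal
        ((2 : ℝ) ^ (-((k - 2 + i : ℤ) : ℝ) * (s - ε)) * g (k - 2 + i) y) ^ p ∂μ ≤
      ENNReal.ofReal (2 ^ (-(k : ℝ) * (δ * p)) * 2 ^ (2 * (δ * p)) * S ^ p * w ^ i) * μ B := by
    intro i
    obtain ⟨j, hj⟩ : ∃ j : ℤ, j = k - 2 + i := ⟨_, rfl⟩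
    rw [← hj]
    have hlej := hle j (by lia)
    have hav := setLAverage_rpow_le hB0 hBtop (hg j) (hg0 j) hp hpq
    have e1 : ∀ y, ENNReal.ofReal ((2 : ℝ) ^ (-(j : ℝ) * (s - ε)) * g j y) ^ p =
        ENNReal.ofReal (2 ^ (-(j : ℝ) * (s - ε))) ^ p * ENNReal.ofReal (g j y ^ p) := by
      intro y
      rw [ENNReal.ofReal_mul (by positivity), ENNReal.mul_rpow_of_nonneg _ _ hp.le,
        ENNReal.ofReal_rpow_of_nonneg (hg0 j y) hp.le]
    simp_rw [e1]
    rw [lintegral_const_mul _ ((hg j).pow_const p).ennreal_ofReal,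
      ← measure_mul_setLAverage _ hBtop]
    have e2 : (2 : ℝ) ^ (-(j : ℝ) * (s - ε)) =
        2 ^ (-(j : ℝ) * δ) * 2 ^ (-(j : ℝ) * (s - ε')) := by
      rw [← Real.rpow_add (by norm_num), hδ]
      congr 1
      ring
    have e3 : ((2 : ℝ) ^ (-(j : ℝ) * δ) * S) ^ p =
        2 ^ (-(k : ℝ) * (δ * p)) * 2 ^ (2 * (δ * p)) * S ^ p * w ^ i := by
      rw [Real.mul_rpow (by positivity) hS, ← Real.rpow_mul (by norm_num : (0 : ℝ) ≤ 2), hw,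
        ← Real.rpow_natCast, ← Real.rpow_mul (by norm_num : (0 : ℝ) ≤ 2), mul_right_comm _ (S ^ p),
        ← Real.rpow_add (by norm_num : (0 : ℝ) < 2), ← Real.rpow_add (by norm_num : (0 : ℝ) < 2),
        hj]
      congr 2
      push_cast
      ring
    calc _ ≤ ENNReal.ofReal (2 ^ (-(j : ℝ) * (s - ε))) ^ p * (μ B *
          ((⨍⁻ y in B, ENNReal.ofReal (g j y ^ q) ∂μ) ^ (1 / q)) ^ p) := by gcongr
      _ = (ENNReal.ofReal (2 ^ (-(j : ℝ) * δ)) * (ENNReal.ofReal (2 ^ (-(j : ℝ) * (s - ε'))) *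
          (⨍⁻ y in B, ENNReal.ofReal (g j y ^ q) ∂μ) ^ (1 / q))) ^ p * μ B := by
          rw [e2, ENNReal.ofReal_mul (by positivity)]
          simp only [ENNReal.mul_rpow_of_nonneg _ _ hp.le]
          ring
      _ ≤ (ENNReal.ofReal (2 ^ (-(j : ℝ) * δ)) * ENNReal.ofReal S) ^ p * μ B := by gcongr
      _ = _ := by
          rw [← ENNReal.ofReal_mul (by positivity),
            ENNReal.ofReal_rpow_of_nonneg (by positivity) hp.le, e3]
  refine (ENNReal.tsum_le_tsum hterm).trans ?_
  rw [ENNReal.tsum_mul_right, ← ENNReal.ofReal_tsum_of_nonneg (fun i => by positivity)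
    ((summable_geometric_of_lt_one hw0.le hw1).mul_left _), tsum_mul_left,
    tsum_geometric_of_lt_one hw0.le hw1]
  refine le_of_eq ?_
  congr 2
  rw [Real.mul_rpow (by positivity) hS, Real.mul_rpow (by positivity) (by positivity),
    ← Real.rpow_mul (by positivity), one_div_mul_cancel hp.ne', Real.rpow_one,
    ← Real.rpow_mul (by norm_num), ← hδ]
  ring_nf

theorem statement12 [MetricSpace X] [MeasurableSpace X] [BorelSpace X] (μ : Measure X)
    (c_d : ℝ≥0∞) (hdoub : IsDoubling μ c_d) (Q : ℝ) (hQ : 1 < Q)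
    (c_Q : ℝ) (hcQ : 0 < c_Q) (hdim : DimLowerBound μ c_Q Q)
    (s p ε ε' : ℝ) (hs : 0 < s)
    (hε : 0 < ε) (hεε' : ε < ε') (hε's : ε' < s) (hp : Q / (Q + ε) ≤ p) :
    ∃ C : ℝ, 0 < C ∧ ∀ (u : X → ℝ) (g : ℤ → X → ℝ), LocallyIntegrable u μ →
      IsFracHajlaszGradient μ s u g → ∀ (x : X) (k : ℤ),
      ENNReal.ofReal (⨍ y in ball x ((2 : ℝ) ^ (-k)),
          |u y - ⨍ z in ball x ((2 : ℝ) ^ (-k)), u z ∂μ| ∂μ) ≤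
        ENNReal.ofReal C * ENNReal.ofReal ((2 : ℝ) ^ (-(k : ℝ) * ε')) *
          ∑' j : {j : ℤ // k - 2 ≤ j},
            ENNReal.ofReal ((2 : ℝ) ^ (-(j.1 : ℝ) * (s - ε'))) *
              (⨍⁻ y in ball x ((2 : ℝ) ^ (-k + 1)),
                ENNReal.ofReal (g j.1 y ^ p) ∂μ) ^ (1 / p) := by
  obtain ⟨p₀, hp₀⟩ : ∃ p₀ : ℝ, p₀ = Q / (Q + ε) := ⟨_, rfl⟩
  have hQ0 : 0 < Q := by linarith
  have hp₀0 : 0 < p₀ := by rw [hp₀]; positivity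
  obtain ⟨C, hC, hpoincare⟩ := exists_setAverage_abs_sub_le hQ0 hcQ hdim hε hp₀
  obtain ⟨K, hK, hsum⟩ := exists_lintegral_iSup_rpow_le (μ := μ) (s := s) hp₀0
    (hp₀.trans_le hp) hεε'
  refine ⟨C * K, by positivity, ?_⟩
  rintro u g - ⟨hgm, hg0, E, hE0, hE⟩ x k
  have hr : (0 : ℝ) < 2 ^ (-k) := by positivity
  have e2r : (2 : ℝ) ^ (-k + 1) = 2 * 2 ^ (-k) := by
    rw [zpow_add₀ (by norm_num), zpow_one, mul_comm]
  rw [e2r]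
  by_cases hreal : μ.real (ball x ((2 : ℝ) ^ (-k))) = 0
  · rw [setAverage_eq, hreal, _root_.inv_zero, zero_smul, ENNReal.ofReal_zero]
    exact zero_le
  obtain ⟨hB0, hBtop⟩ : μ (ball x ((2 : ℝ) ^ (-k))) ≠ 0 ∧ μ (ball x ((2 : ℝ) ^ (-k))) ≠ ∞ := by
    rw [Measure.real, ENNReal.toReal_eq_zero_iff] at hreal
    exact not_or.1 hreal
  have hB20 : μ (ball x (2 * (2 : ℝ) ^ (-k))) ≠ 0 := fun h0 =>
    hB0 (measure_mono_null (ball_subset_ball (by linarith)) h0)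
  have hB2top : μ (ball x (2 * (2 : ℝ) ^ (-k))) ≠ ∞ := by
    intro htop
    have h1 := hdim x x _ (2 * (2 : ℝ) ^ (-k)) hr (by linarith) (mem_ball_self (by linarith))
    rw [htop, ENNReal.mul_top (ENNReal.ofReal_pos.2 (by positivity)).ne', top_le_iff] at h1
    exact hBtop h1
  set S := ∑' j : {j : ℤ // k - 2 ≤ j},
    ENNReal.ofReal ((2 : ℝ) ^ (-(j.1 : ℝ) * (s - ε'))) *
      (⨍⁻ y in ball x (2 * (2 : ℝ) ^ (-k)), ENNReal.ofReal (g j.1 y ^ p) ∂μ) ^ (1 / p) with hS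
  by_cases hStop : S = ∞
  · rw [hStop, ENNReal.mul_top]
    · exact le_top
    · exact mul_ne_zero (ENNReal.ofReal_pos.2 (by positivity)).ne'
        (ENNReal.ofReal_pos.2 (by positivity)).ne'
  have hlint := hsum g (ball x (2 * (2 : ℝ) ^ (-k))) k S.toReal hgm hg0 hB20 hB2top
    ENNReal.toReal_nonneg (by
      intro j hj
      rw [ENNReal.ofReal_toReal hStop, hS]
      exact ENNReal.le_tsum (f := fun j : {j : ℤ // k - 2 ≤ j} =>
        ENNReal.ofReal ((2 : ℝ) ^ (-(j.1 : ℝ) * (s - ε'))) *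
        (⨍⁻ y in ball x (2 * (2 : ℝ) ^ (-k)), ENNReal.ofReal (g j.1 y ^ p) ∂μ) ^ (1 / p)) ⟨j, hj⟩)
  have hε2 : (2 : ℝ) ^ (-(k : ℝ) * ε') = ((2 : ℝ) ^ (-k)) ^ ε * 2 ^ (-(k : ℝ) * (ε' - ε)) := by
    rw [← Real.rpow_intCast, ← Real.rpow_mul (by norm_num), ← Real.rpow_add (by norm_num)]
    congr 1
    push_cast
    ring
  rw [← ENNReal.ofReal_toReal hStop, ← ENNReal.ofReal_mul (by positivity),
    ← ENNReal.ofReal_mul (by positivity), hε2]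
  refine ENNReal.ofReal_le_ofReal ?_
  obtain ⟨A, hA⟩ : ∃ A : ℝ, A = K * 2 ^ (-(k : ℝ) * (ε' - ε)) * S.toReal := ⟨_, rfl⟩
  have hA0 : 0 ≤ A := by
    rw [hA]
    have := ENNReal.toReal_nonneg (a := S)
    positivity
  have hbound : ∀ η : ℝ, 0 < η → ⨍ y in ball x ((2 : ℝ) ^ (-k)),
      |u y - ⨍ z in ball x ((2 : ℝ) ^ (-k)), u z ∂μ| ∂μ ≤
        C * ((2 : ℝ) ^ (-k)) ^ ε * A + C * ((2 : ℝ) ^ (-k)) ^ ε * η := by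
    intro η hη
    rw [← mul_add]
    refine hpoincare x _ u (fun y => ⨆ i : ℕ, ENNReal.ofReal
      ((2 : ℝ) ^ (-((k - 2 + i : ℤ) : ℝ) * (s - ε)) * g (k - 2 + i) y)) E (A + η) hr hB0 hB2top
      (Measurable.iSup fun i => ((hgm _).const_mul _).ennreal_ofReal) hE0 (by linarith) ?_ ?_
    · refine hlint.trans ?_
      rw [← hA]
      gcongr
      linarith
    · intro y hy z hz hyE hzE a b ha hb ha0 hb0
      exact abs_sub_le_of_iSup_le (hεε'.trans hε's) hg0 hE hy hz hyE hzE ha hb ha0 hb0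
  have hCr : 0 < C * ((2 : ℝ) ^ (-k)) ^ ε := by positivity
  calc _ ≤ C * ((2 : ℝ) ^ (-k)) ^ ε * A := by
        refine le_of_forall_pos_le_add fun η hη => ?_
        have := hbound (η / (C * ((2 : ℝ) ^ (-k)) ^ ε)) (by positivity)
        rwa [mul_div_cancel₀ _ hCr.ne'] at this
    _ = _ := by rw [hA]; ring

end FracMaximal
end

section
/- Let 0 < s + α < 1 and Q/(Q+s) < p, q < ∞. Then there exists C > 0 such that ‖M*_α u‖_{Ṁ^{s+α}_{p,q}(X)} ≤ C ‖u‖_{Ṁ^s_{p,q}(X)} for all u in the homogeneous Hajłasz–Triebel–Lizorkin space Ṁ^s_{p,q}(X) with M*_α u not identically infinite. -/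
open MeasureTheory Metric ENNReal

namespace FracMaximal

variable {X : Type*}

section Averages

variable [MetricSpace X] [MeasurableSpace X]

/-- A measure with the lower dimension bound all of whose balls have positive finite measure. -/
structure IsRegular (μ : Measure X) (c Q : ℝ) : Prop where
  c_pos : 0 < c
  Q_pos : 0 < Q
  dim : DimLowerBound μ c Q
  ball_ne_zero : ∀ (x : X) (r : ℝ), 0 < r → μ (ball x r) ≠ 0
  ball_ne_top : ∀ (x : X) (r : ℝ), μ (ball x r) ≠ ⊤

/-- The average of `f` over the ball `B(x, r)`. -/
noncomputable def avg (μ : Measure X) (f : X → ℝ≥0∞) (x : X) (r : ℝ) : ℝ≥0∞ :=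
  ⨍⁻ y in ball x r, f y ∂μ

/-- The comparison constant `a ^ Q / c` for balls whose radii have ratio at most `a`. -/
noncomputable def ratioConst (c Q a : ℝ) : ℝ≥0∞ := ENNReal.ofReal (a ^ Q / c)

lemma ratioConst_ne_top (c Q a : ℝ) : ratioConst c Q a ≠ ⊤ := ENNReal.ofReal_ne_top

variable {μ : Measure X} {c Q : ℝ}

lemma avg_eq (f : X → ℝ≥0∞) (x : X) (r : ℝ) :
    avg μ f x r = (∫⁻ y in ball x r, f y ∂μ) / μ (ball x r) :=
  setLAverage_eq _ _ _

lemma avg_mono_ae {f g : X → ℝ≥0∞} (h : ∀ᵐ y ∂μ, f y ≤ g y) (x : X) (r : ℝ) :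
    avg μ f x r ≤ avg μ g x r :=
  setLAverage_mono_ae _ h

lemma avg_mono {f g : X → ℝ≥0∞} (h : ∀ y, f y ≤ g y) (x : X) (r : ℝ) :
    avg μ f x r ≤ avg μ g x r :=
  avg_mono_ae (Filter.Eventually.of_forall h) x r

lemma avg_add {f g : X → ℝ≥0∞} (hf : AEMeasurable f μ) (x : X) (r : ℝ) :
    avg μ (fun y => f y + g y) x r = avg μ f x r + avg μ g x r := by
  simp only [avg_eq, lintegral_add_left' hf.restrict, ENNReal.add_div]

lemma avg_const_mul {f : X → ℝ≥0∞} (hf : AEMeasurable f μ) (a : ℝ≥0∞) (x : X) (r : ℝ) :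
    avg μ (fun y => a * f y) x r = a * avg μ f x r := by
  simp only [avg_eq, lintegral_const_mul'' a hf.restrict, mul_div_assoc]

lemma avg_tsum {ι : Type*} [Countable ι] {f : ι → X → ℝ≥0∞} (hf : ∀ i, AEMeasurable (f i) μ)
    (x : X) (r : ℝ) :
    avg μ (fun y => ∑' i, f i y) x r = ∑' i, avg μ (f i) x r := by
  simp only [avg_eq, lintegral_tsum fun i => (hf i).restrict, div_eq_mul_inv, ENNReal.tsum_mul_right]

namespace IsRegular


lemma avg_const (hμ : IsRegular μ c Q)
    (a : ℝ≥0∞) (x : X) {r : ℝ} (hr : 0 < r) : avg μ (fun _ => a) x r = a :=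
  setLAverage_const (hμ.ball_ne_zero x r hr) (hμ.ball_ne_top x r) a

lemma measure_mul_avg (hμ : IsRegular μ c Q) (f : X → ℝ≥0∞) (x : X) (r : ℝ) :
    μ (ball x r) * avg μ f x r = ∫⁻ y in ball x r, f y ∂μ :=
  measure_mul_setLAverage f (hμ.ball_ne_top x r)

lemma measure_ball_le (hμ : IsRegular μ c Q)
    {x y : X} {r R a : ℝ} (hr : 0 < r) (hrR : r ≤ R) (ha : R ≤ a * r)
    (hy : dist y x < R) : μ (ball x R) ≤ ratioConst c Q a * μ (ball y r) := by
  have h := hμ.dim x y r R hr hrR hy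
  have hR : 0 < R := hr.trans_le hrR
  have hc := hμ.c_pos
  have ha0 : 0 < a := by
    by_contra hcon
    nlinarith [not_lt.1 hcon]
  have h1 : 1 ≤ ratioConst c Q a * ENNReal.ofReal (c * (r / R) ^ Q) := by
    rw [ratioConst, ← ENNReal.ofReal_mul (by positivity), ← ENNReal.ofReal_one]
    refine ENNReal.ofReal_le_ofReal ?_
    have : a ^ Q / c * (c * (r / R) ^ Q) = (a * (r / R)) ^ Q := by
      rw [Real.mul_rpow ha0.le (by positivity)]
      field_simp
    rw [this]
    refine Real.one_le_rpow ?_ hμ.Q_pos.le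
    rw [← mul_div_assoc, one_le_div hR]
    exact ha
  calc μ (ball x R) ≤ (ratioConst c Q a * ENNReal.ofReal (c * (r / R) ^ Q)) * μ (ball x R) :=
        le_mul_of_one_le_left zero_le h1
    _ = ratioConst c Q a * (ENNReal.ofReal (c * (r / R) ^ Q) * μ (ball x R)) := mul_assoc _ _ _
    _ ≤ _ := by gcongr

lemma avg_le_avg (hμ : IsRegular μ c Q)
    {x y : X} {r R a : ℝ} (hr : 0 < r) (hrR : r ≤ R) (ha : R ≤ a * r)
    (hy : dist y x + r ≤ R) (f : X → ℝ≥0∞) :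
    avg μ f y r ≤ ratioConst c Q a * avg μ f x R := by
  have h := hμ.measure_ball_le hr hrR ha (by linarith : dist y x < R)
  have hR : 0 < R := hr.trans_le hrR
  rw [avg_eq, ENNReal.div_le_iff (hμ.ball_ne_zero _ _ hr) (hμ.ball_ne_top _ _)]
  calc ∫⁻ z in ball y r, f z ∂μ ≤ ∫⁻ z in ball x R, f z ∂μ :=
        lintegral_mono_set (ball_subset_ball' (by linarith))
    _ = avg μ f x R * μ (ball x R) := by rw [mul_comm, hμ.measure_mul_avg]
    _ ≤ avg μ f x R * (ratioConst c Q a * μ (ball y r)) := by gcongr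
    _ = _ := by ring

lemma isLocallyFinite (hμ : IsRegular μ c Q) : IsLocallyFiniteMeasure μ :=
  ⟨fun x => ⟨ball x 1, ball_mem_nhds x one_pos, (hμ.ball_ne_top x 1).lt_top⟩⟩

lemma isUnifLocDoubling (hμ : IsRegular μ c Q) : IsUnifLocDoublingMeasure μ := by
  refine ⟨(ratioConst c Q 3).toNNReal, ?_⟩
  filter_upwards [self_mem_nhdsWithin] with ε hε x
  rw [ENNReal.coe_toNNReal (ratioConst_ne_top _ _ _)]
  have hε' : (0 : ℝ) < ε := hε
  calc μ (closedBall x (2 * ε)) ≤ μ (ball x (3 * ε)) :=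
        measure_mono (closedBall_subset_ball (by linarith))
    _ ≤ ratioConst c Q 3 * μ (ball x ε) :=
        hμ.measure_ball_le hε' (by linarith) le_rfl (by simpa using hε')
    _ ≤ _ := by gcongr; exact ball_subset_closedBall

variable [BorelSpace X] [SecondCountableTopology X]

lemma measurable_setLIntegral_ball (hμ : IsRegular μ c Q)
    {f : X → ℝ≥0∞} (hf : Measurable f) (r : ℝ) :
    Measurable fun x => ∫⁻ y in ball x r, f y ∂μ := by
  have := hμ.isLocallyFinite
  have h : (fun x => ∫⁻ y in ball x r, f y ∂μ) =
      fun x => ∫⁻ y, ({z : X × X | dist z.2 z.1 < r}.indicator fun z => f z.2) (x, y) ∂μ := by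
    ext x
    rw [← lintegral_indicator measurableSet_ball]
    rfl
  rw [h]
  refine Measurable.lintegral_prod_right' ((hf.comp measurable_snd).indicator ?_)
  exact measurableSet_lt (by fun_prop) measurable_const

lemma measurable_measure_ball (hμ : IsRegular μ c Q)
    (r : ℝ) : Measurable fun x => μ (ball x r) := by
  simpa using hμ.measurable_setLIntegral_ball (f := fun _ => 1) measurable_const r

lemma measurable_avg (hμ : IsRegular μ c Q) {f : X → ℝ≥0∞} (hf : Measurable f) (r : ℝ) :
    Measurable fun x => avg μ f x r := by
  simp only [avg_eq]
  exact (hμ.measurable_setLIntegral_ball hf r).div (hμ.measurable_measure_ball r)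

lemma lintegral_avg_mul_le (hμ : IsRegular μ c Q)
    {f w : X → ℝ≥0∞} (hf : Measurable f) (hw : Measurable w) {r : ℝ}
    (hr : 0 < r) :
    ∫⁻ x, avg μ f x r * w x ∂μ ≤ ratioConst c Q 1 * ∫⁻ y, f y * avg μ w y r ∂μ := by
  have := hμ.isLocallyFinite
  set k : X → X → ℝ≥0∞ := fun x y => {z : X × X | dist z.2 z.1 < r}.indicator
    (fun z => f z.2 * w z.1 / μ (ball z.1 r)) (x, y) with hk
  have hkm : Measurable (Function.uncurry k) := by
    refine Measurable.indicator ?_ (measurableSet_lt (by fun_prop) measurable_const)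
    exact ((hf.comp measurable_snd).mul (hw.comp measurable_fst)).div
      ((hμ.measurable_measure_ball r).comp measurable_fst)
  have h1 : ∀ x, avg μ f x r * w x = ∫⁻ y, k x y ∂μ := by
    intro x
    have : ∀ y, k x y = (w x / μ (ball x r)) * (ball x r).indicator f y := by
      intro y
      by_cases hy : dist y x < r
      · simp only [hk, Set.indicator, Set.mem_ofPred_eq, mem_ball, hy, if_true]
        rw [div_eq_mul_inv, div_eq_mul_inv]
        ring
      · simp only [hk, Set.indicator, Set.mem_ofPred_eq, mem_ball, hy, if_false, mul_zero]
    simp only [this]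
    rw [lintegral_const_mul _ (hf.indicator measurableSet_ball),
      lintegral_indicator measurableSet_ball, avg_eq, div_eq_mul_inv, div_eq_mul_inv]
    ring
  simp only [h1]
  rw [lintegral_lintegral_swap hkm.aemeasurable, ← lintegral_const_mul _
    (show Measurable fun y => f y * avg μ w y r from hf.mul (hμ.measurable_avg hw r))]
  refine lintegral_mono fun y => ?_
  have h2 : ∀ x, k x y ≤ (ratioConst c Q 1 * f y / μ (ball y r)) * (ball y r).indicator w x := by
    intro x
    by_cases hy : dist y x < r
    · have hx : x ∈ ball y r := by rwa [mem_ball, dist_comm]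
      have hinv : (μ (ball x r))⁻¹ ≤ ratioConst c Q 1 * (μ (ball y r))⁻¹ := by
        have := hμ.measure_ball_le hr le_rfl (one_mul r).ge hx
        rw [← one_div, ENNReal.div_le_iff (hμ.ball_ne_zero _ _ hr) (hμ.ball_ne_top _ _)]
        calc 1 = μ (ball y r) * (μ (ball y r))⁻¹ :=
              (ENNReal.mul_inv_cancel (hμ.ball_ne_zero _ _ hr) (hμ.ball_ne_top _ _)).symm
          _ ≤ (ratioConst c Q 1 * μ (ball x r)) * (μ (ball y r))⁻¹ := by gcongr
          _ = _ := by ring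
      simp only [hk, Set.indicator, Set.mem_ofPred_eq, hy, hx, if_true]
      rw [div_eq_mul_inv, div_eq_mul_inv]
      calc f y * w x * (μ (ball x r))⁻¹ ≤ f y * w x * (ratioConst c Q 1 * (μ (ball y r))⁻¹) := by
            gcongr
        _ = _ := by ring
    · simp only [hk, Set.indicator, Set.mem_ofPred_eq, hy, if_false]
      exact zero_le
  refine (lintegral_mono h2).trans_eq ?_
  rw [lintegral_const_mul _ (hw.indicator measurableSet_ball),
      lintegral_indicator measurableSet_ball, avg_eq, div_eq_mul_inv, div_eq_mul_inv]
  ring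

end IsRegular

end Averages

section Maximal

variable [MetricSpace X] [MeasurableSpace X]

/-- The maximal function over the balls of dyadic radii. -/
noncomputable def maxFn (μ : Measure X) (f : X → ℝ≥0∞) (x : X) : ℝ≥0∞ :=
  ⨆ l : ℤ, avg μ f x ((2 : ℝ) ^ (1 - l))

variable {μ : Measure X} {c Q : ℝ}

lemma avg_le_maxFn (f : X → ℝ≥0∞) (x : X) (l : ℤ) :
    avg μ f x ((2 : ℝ) ^ (1 - l)) ≤ maxFn μ f x :=
  le_iSup (fun l : ℤ => avg μ f x ((2 : ℝ) ^ (1 - l))) l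

/-- The greatest dyadic number strictly below `a` is at least `a / 2`. -/
lemma exists_two_zpow_lt {a : ℝ≥0∞} (h0 : a ≠ 0) (hT : a ≠ ⊤) :
    ∃ n : ℤ, (2 : ℝ≥0∞) ^ n < a ∧ a ≤ 2 ^ (n + 1) := by
  lift a to NNReal using hT
  have ha : 0 < a := pos_iff_ne_zero.2 (by simpa using h0)
  obtain ⟨n, h1, h2⟩ := exists_mem_Ioc_zpow ha (one_lt_two : (1 : NNReal) < 2)
  have hcoe : ∀ m : ℤ, (2 : ℝ≥0∞) ^ m = ((2 ^ m : NNReal) : ℝ≥0∞) := fun m => by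
    rw [ENNReal.coe_zpow two_ne_zero]; rfl
  exact ⟨n, by rw [hcoe]; exact_mod_cast h1, by rw [hcoe]; exact_mod_cast h2⟩

lemma two_zpow_eq_rpow (n : ℤ) : (2 : ℝ≥0∞) ^ n = 2 ^ (n : ℝ) := (ENNReal.rpow_intCast _ _).symm

lemma two_zpow_rpow (n : ℤ) (P : ℝ) : ((2 : ℝ≥0∞) ^ n) ^ P = 2 ^ (n * P) := by
  rw [two_zpow_eq_rpow, ENNReal.rpow_mul]

lemma tsum_nat_geometric_ne_top {r : ℝ≥0∞} (hr : r < 1) : ∑' m : ℕ, r ^ m ≠ ⊤ := by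
  rw [ENNReal.tsum_geometric]
  exact ENNReal.inv_ne_top.2 (tsub_pos_of_lt hr).ne'

lemma rpow_le_tsum_dyadic (a : ℝ≥0∞) {P : ℝ} (hP : 0 < P) :
    a ^ P ≤ ∑' n : ℤ, if (2 : ℝ≥0∞) ^ n < a then (2 : ℝ≥0∞) ^ ((n + 1) * P) else 0 := by
  rcases eq_or_ne a 0 with rfl | h0
  · simp [ENNReal.zero_rpow_of_pos hP]
  rcases eq_or_ne a ⊤ with rfl | hT
  · refine le_of_le_of_eq le_top (Eq.symm ?_)
    rw [← top_le_iff]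
    have h1 : ∑' _ : ℕ, (1 : ℝ≥0∞) = ⊤ := ENNReal.tsum_const_eq_top_of_ne_zero one_ne_zero
    refine le_trans h1.ge (le_trans ?_ (ENNReal.tsum_comp_le_tsum_of_injective
      (f := fun n : ℕ => (n : ℤ)) Nat.cast_injective _))
    refine ENNReal.tsum_le_tsum fun n => ?_
    have : (2 : ℝ≥0∞) ^ (n : ℤ) < ⊤ := by
      rw [zpow_natCast]; exact ENNReal.pow_lt_top (by simp)
    rw [if_pos this]
    exact ENNReal.one_le_rpow one_le_two (by push_cast; positivity)
  · obtain ⟨n, h1, h2⟩ := exists_two_zpow_lt h0 hT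
    refine le_trans ?_ (ENNReal.le_tsum n)
    rw [if_pos h1]
    calc a ^ P ≤ ((2 : ℝ≥0∞) ^ (n + 1)) ^ P := ENNReal.rpow_le_rpow h2 hP.le
      _ = _ := by rw [two_zpow_rpow]; push_cast; rfl

lemma two_rpow_neg_lt_one {P : ℝ} (hP : 0 < P) : (2 : ℝ≥0∞) ^ (-P) < 1 :=
  ENNReal.rpow_lt_one_of_one_lt_of_neg ENNReal.one_lt_two (by linarith)

lemma tsum_dyadic_le_rpow (a : ℝ≥0∞) {P : ℝ} (hP : 0 < P) :
    (∑' n : ℤ, if (2 : ℝ≥0∞) ^ n < a then (2 : ℝ≥0∞) ^ (n * P) else 0) ≤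
      (∑' m : ℕ, ((2 : ℝ≥0∞) ^ (-P)) ^ m) * a ^ P := by
  rcases eq_or_ne a 0 with rfl | h0
  · simp
  rcases eq_or_ne a ⊤ with rfl | hT
  · rw [ENNReal.top_rpow_of_pos hP, ENNReal.mul_top]
    · exact le_top
    · exact (lt_of_lt_of_le (by simp) (ENNReal.le_tsum 0)).ne'
  obtain ⟨N, h1, h2⟩ := exists_two_zpow_lt h0 hT
  rw [← ENNReal.tsum_mul_right]
  have hinj : Function.Injective fun m : ℕ => N - (m : ℤ) := fun a b h => by
    simpa using h
  rw [← hinj.tsum_eq (f := fun n : ℤ => if (2 : ℝ≥0∞) ^ n < a then (2 : ℝ≥0∞) ^ (n * P) else 0)]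
  · refine ENNReal.tsum_le_tsum fun m => ?_
    split_ifs
    · calc (2 : ℝ≥0∞) ^ (((N - (m : ℤ) : ℤ) : ℝ) * P)
          = ((2 : ℝ≥0∞) ^ (-P)) ^ m * ((2 : ℝ≥0∞) ^ N) ^ P := by
            rw [two_zpow_rpow, ← ENNReal.rpow_natCast, ← ENNReal.rpow_mul,
              ← ENNReal.rpow_add _ _ two_ne_zero ofNat_ne_top]
            congr 1
            push_cast
            ring
        _ ≤ _ := by gcongr
    · exact zero_le
  · intro n hn
    have hn' : (2 : ℝ≥0∞) ^ n < a := by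
      by_contra h
      exact hn (if_neg h)
    have : n < N + 1 := by
      by_contra hcon
      exact absurd (hn'.trans_le h2)
        (not_lt.2 (ENNReal.zpow_le_of_le one_le_two (not_lt.1 hcon)))
    exact ⟨(N - n).toNat, by simp only; omega⟩

variable [BorelSpace X] [SecondCountableTopology X]

namespace IsRegular


lemma measurable_maxFn (hμ : IsRegular μ c Q)
    {f : X → ℝ≥0∞} (hf : Measurable f) : Measurable (maxFn μ f) :=
  Measurable.iSup fun _ => hμ.measurable_avg hf _

lemma weakType_maxFn (hμ : IsRegular μ c Q) (f : X → ℝ≥0∞) (a : ℝ≥0∞) :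
    a * μ {x | a < maxFn μ f x} ≤ ratioConst c Q 4 * ∫⁻ x, f x ∂μ := by
  set S : ℕ → Set X := fun n => {x | ∃ l : ℤ, -(n : ℤ) ≤ l ∧ a < avg μ f x ((2 : ℝ) ^ (1 - l))}
    with hS
  have hmono : Monotone S := by
    intro m n hmn x hx
    obtain ⟨l, hl, h⟩ := hx
    exact ⟨l, by omega, h⟩
  have hU : {x | a < maxFn μ f x} = ⋃ n, S n := by
    ext x
    simp only [Set.mem_ofPred_eq, maxFn, lt_iSup_iff, Set.mem_iUnion, hS]
    exact ⟨fun ⟨l, hl⟩ => ⟨l.natAbs, l, by omega, hl⟩, fun ⟨_, l, _, hl⟩ => ⟨l, hl⟩⟩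
  rw [hU, hmono.measure_iUnion, ENNReal.mul_iSup]
  refine iSup_le fun n => ?_
  choose! l hl hal using fun x (hx : x ∈ S n) => hx
  obtain ⟨t, htS, hdisj, hcov⟩ := Vitali.exists_disjoint_subfamily_covering_enlargement_ball
    (S n) id (fun x => (2 : ℝ) ^ (1 - l x)) ((2 : ℝ) ^ (1 + (n : ℤ)))
    (fun x hx => zpow_le_zpow_right₀ one_le_two (by have := hl x hx; omega)) 4 (by norm_num)
  have hpos : ∀ x, (0 : ℝ) < (2 : ℝ) ^ (1 - l x) := fun x => by positivity
  have htc : t.Countable := hdisj.countable_of_isOpen (fun _ _ => isOpen_ball)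
    fun x _ => nonempty_ball.2 (hpos x)
  have hsub : S n ⊆ ⋃ b ∈ t, ball b (4 * (2 : ℝ) ^ (1 - l b)) := by
    intro x hx
    obtain ⟨b, hb, hxb⟩ := hcov x hx
    exact Set.mem_biUnion hb (hxb (mem_ball_self (hpos x)))
  have : Countable t := htc.to_subtype
  calc a * μ (S n) ≤ a * ∑' b : t, μ (ball (b : X) (4 * (2 : ℝ) ^ (1 - l b))) := by
        gcongr
        exact (measure_mono hsub).trans (measure_biUnion_le _ htc _)
    _ = ∑' b : t, a * μ (ball (b : X) (4 * (2 : ℝ) ^ (1 - l b))) := ENNReal.tsum_mul_left.symm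
    _ ≤ ∑' b : t, ratioConst c Q 4 * ∫⁻ y in ball (b : X) ((2 : ℝ) ^ (1 - l b)), f y ∂μ := by
        refine ENNReal.tsum_le_tsum fun b => ?_
        have hp := hpos b
        calc a * μ (ball (b : X) (4 * (2 : ℝ) ^ (1 - l b)))
            ≤ avg μ f b ((2 : ℝ) ^ (1 - l b)) *
                (ratioConst c Q 4 * μ (ball (b : X) ((2 : ℝ) ^ (1 - l b)))) := by
              gcongr
              · exact (hal b (htS b.2)).le
              · exact hμ.measure_ball_le hp (by linarith) le_rfl (by rw [dist_self]; linarith)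
          _ = _ := by rw [← hμ.measure_mul_avg]; ring
    _ = ratioConst c Q 4 * ∑' b : t, ∫⁻ y in ball (b : X) ((2 : ℝ) ^ (1 - l b)), f y ∂μ :=
        ENNReal.tsum_mul_left
    _ = ratioConst c Q 4 * ∫⁻ y in ⋃ b ∈ t, ball (b : X) ((2 : ℝ) ^ (1 - l b)), f y ∂μ := by
        rw [lintegral_biUnion (s := fun b => ball b ((2 : ℝ) ^ (1 - l b))) htc
          (fun _ _ => measurableSet_ball) hdisj]
    _ ≤ _ := mul_le_mul_right (setLIntegral_le_lintegral _ _) _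

lemma weakType_maxFn_of_lt (hμ : IsRegular μ c Q)
    {f : X → ℝ≥0∞} (hf : Measurable f) {a : ℝ≥0∞} (ha : a ≠ ⊤) :
    a * μ {x | 2 * a < maxFn μ f x} ≤
      ratioConst c Q 4 * ∫⁻ x, (if a < f x then f x else 0) ∂μ := by
  refine le_trans ?_ (hμ.weakType_maxFn _ a)
  gcongr a * ?_
  refine measure_mono fun x hx => ?_
  simp only [Set.mem_ofPred_eq] at hx ⊢
  have hm : Measurable fun y => if a < f y then f y else 0 :=
    Measurable.ite (measurableSet_lt measurable_const hf) hf measurable_const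
  have h : maxFn μ f x ≤ maxFn μ (fun y => if a < f y then f y else 0) x + a := by
    refine iSup_le fun l => ?_
    have hp : (0 : ℝ) < (2 : ℝ) ^ (1 - l) := by positivity
    calc avg μ f x ((2 : ℝ) ^ (1 - l))
        ≤ avg μ (fun y => (if a < f y then f y else 0) + a) x ((2 : ℝ) ^ (1 - l)) := by
          refine avg_mono (fun y => ?_) _ _
          split_ifs with h
          · exact le_self_add
          · simpa using h
      _ = avg μ (fun y => if a < f y then f y else 0) x ((2 : ℝ) ^ (1 - l)) + a := by
          rw [avg_add hm.aemeasurable, hμ.avg_const a x hp]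
      _ ≤ _ := by gcongr; exact avg_le_maxFn _ _ _
  rw [two_mul] at hx
  exact (ENNReal.add_lt_add_iff_right ha).1 (hx.trans_le h)

/-- The **Hardy–Littlewood maximal theorem**. -/
lemma lintegral_maxFn_rpow_le (hμ : IsRegular μ c Q) {P : ℝ} (hP : 1 < P) :
    ∃ C : ℝ≥0∞, C ≠ ⊤ ∧ ∀ f : X → ℝ≥0∞, Measurable f →
      ∫⁻ x, maxFn μ f x ^ P ∂μ ≤ C * ∫⁻ x, f x ^ P ∂μ := by
  have hP1 : 0 < P - 1 := by linarith
  set T : ℝ≥0∞ := ∑' m : ℕ, ((2 : ℝ≥0∞) ^ (-(P - 1))) ^ m with hT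
  refine ⟨2 ^ (2 * P) * ratioConst c Q 4 * T, ?_, fun f hf => ?_⟩
  · refine ENNReal.mul_ne_top (ENNReal.mul_ne_top ?_ (ratioConst_ne_top _ _ _))
      (tsum_nat_geometric_ne_top (two_rpow_neg_lt_one hP1))
    exact ENNReal.rpow_ne_top_of_nonneg (by linarith) ofNat_ne_top
  have hM := hμ.measurable_maxFn hf
  have hms : ∀ n : ℤ, MeasurableSet {x | (2 : ℝ≥0∞) ^ n < maxFn μ f x} := fun n =>
    measurableSet_lt measurable_const hM
  have h2 : ∀ n : ℤ, (2 : ℝ≥0∞) ^ n ≠ ⊤ := fun n => by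
    rw [two_zpow_eq_rpow]; exact ENNReal.rpow_ne_top_of_ne_zero two_ne_zero ofNat_ne_top
  calc ∫⁻ x, maxFn μ f x ^ P ∂μ
      ≤ ∫⁻ x, ∑' n : ℤ, (if (2 : ℝ≥0∞) ^ n < maxFn μ f x then
          (2 : ℝ≥0∞) ^ ((n + 1) * P) else 0) ∂μ :=
        lintegral_mono fun x => rpow_le_tsum_dyadic _ (by linarith)
    _ = ∑' n : ℤ, (2 : ℝ≥0∞) ^ ((n + 1) * P) * μ {x | (2 : ℝ≥0∞) ^ n < maxFn μ f x} := by
        rw [lintegral_tsum fun n =>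
          (Measurable.ite (hms n) measurable_const measurable_const).aemeasurable]
        refine tsum_congr fun n => ?_
        rw [← lintegral_indicator_const (hms n)]
        simp only [Set.indicator_apply, Set.mem_ofPred_eq]
    _ = ∑' n : ℤ, (2 : ℝ≥0∞) ^ ((n + 2) * P) * μ {x | 2 * (2 : ℝ≥0∞) ^ n < maxFn μ f x} := by
        rw [← (Equiv.addRight (1 : ℤ)).tsum_eq]
        refine tsum_congr fun n => ?_
        simp only [Equiv.coe_addRight]
        rw [two_zpow_eq_rpow, two_zpow_eq_rpow]
        congr 3
        · push_cast; ring
        · ext x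
          push_cast
          rw [ENNReal.rpow_add _ _ two_ne_zero ofNat_ne_top, ENNReal.rpow_one, mul_comm]
    _ = ∑' n : ℤ, (2 : ℝ≥0∞) ^ (2 * P) * (2 ^ (n * (P - 1))) *
          (2 ^ n * μ {x | 2 * (2 : ℝ≥0∞) ^ n < maxFn μ f x}) := by
        refine tsum_congr fun n => ?_
        rw [← mul_assoc]
        congr 1
        rw [two_zpow_eq_rpow, ← ENNReal.rpow_add _ _ two_ne_zero ofNat_ne_top,
          ← ENNReal.rpow_add _ _ two_ne_zero ofNat_ne_top]
        congr 1
        ring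
    _ ≤ ∑' n : ℤ, (2 : ℝ≥0∞) ^ (2 * P) * (2 ^ (n * (P - 1))) *
          (ratioConst c Q 4 * ∫⁻ x, (if 2 ^ n < f x then f x else 0) ∂μ) := by
        refine ENNReal.tsum_le_tsum fun n => ?_
        gcongr _ * ?_
        exact hμ.weakType_maxFn_of_lt hf (h2 n)
    _ = 2 ^ (2 * P) * ratioConst c Q 4 *
          ∑' n : ℤ, ∫⁻ x, f x * (if (2 : ℝ≥0∞) ^ n < f x then 2 ^ (n * (P - 1)) else 0) ∂μ := by
        rw [← ENNReal.tsum_mul_left]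
        refine tsum_congr fun n => ?_
        have : ∀ x, f x * (if (2 : ℝ≥0∞) ^ n < f x then (2 : ℝ≥0∞) ^ (n * (P - 1)) else 0) =
            2 ^ (n * (P - 1)) * (if 2 ^ n < f x then f x else 0) := fun x => by
          split_ifs <;> simp [mul_comm]
        simp only [this]
        rw [lintegral_const_mul]
        · ring
        · exact Measurable.ite (measurableSet_lt measurable_const hf) hf measurable_const
    _ = 2 ^ (2 * P) * ratioConst c Q 4 * ∫⁻ x, f x *
          ∑' n : ℤ, (if (2 : ℝ≥0∞) ^ n < f x then 2 ^ (n * (P - 1)) else 0) ∂μ := by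
        rw [← lintegral_tsum]
        · simp only [ENNReal.tsum_mul_left]
        · exact fun n => (hf.mul (Measurable.ite (measurableSet_lt measurable_const hf)
            measurable_const measurable_const)).aemeasurable
    _ ≤ 2 ^ (2 * P) * ratioConst c Q 4 * ∫⁻ x, T * f x ^ P ∂μ := by
        refine mul_le_mul_right (lintegral_mono fun x => ?_) _
        calc f x * ∑' n : ℤ, (if (2 : ℝ≥0∞) ^ n < f x then 2 ^ (n * (P - 1)) else 0)
            ≤ f x * (T * f x ^ (P - 1)) := by gcongr; exact tsum_dyadic_le_rpow _ hP1
          _ = T * (f x ^ (1 : ℝ) * f x ^ (P - 1)) := by rw [ENNReal.rpow_one]; ring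
          _ = T * f x ^ P := by
              rw [← ENNReal.rpow_add_of_nonneg _ _ zero_le_one hP1.le]; ring_nf
    _ = _ := by rw [lintegral_const_mul _ (hf.pow_const P)]; ring

end IsRegular

end Maximal

section VectorValued

lemma le_rpow_of_le_mul_rpow {I D : ℝ≥0∞} {P : ℝ} (hP : 1 < P) (hI : I ≠ ⊤)
    (h : I ≤ D * I ^ (1 - 1 / P)) : I ≤ D ^ P := by
  rcases eq_or_ne I 0 with rfl | h0
  · exact zero_le
  have hP0 : 0 < P := by linarith
  have h1 : I ^ (1 - 1 / P) ≠ 0 := (ENNReal.rpow_pos (pos_iff_ne_zero.2 h0) hI).ne'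
  have h2 : I ^ (1 - 1 / P) ≠ ⊤ := ENNReal.rpow_ne_top_of_ne_zero h0 hI
  have h3 : I ^ (1 / P) ≤ D := by
    rw [← ENNReal.mul_le_mul_iff_left h1 h2, ← ENNReal.rpow_add _ _ h0 hI]
    simpa using h
  calc I = (I ^ (1 / P)) ^ P := by
        rw [← ENNReal.rpow_mul, one_div_mul_cancel hP0.ne', ENNReal.rpow_one]
    _ ≤ D ^ P := ENNReal.rpow_le_rpow h3 hP0.le

variable [MetricSpace X] [MeasurableSpace X] [BorelSpace X] [SecondCountableTopology X]
  {μ : Measure X} {c Q : ℝ}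

namespace IsRegular


lemma lintegral_tsum_avg_rpow_le (hμ : IsRegular μ c Q) {P : ℝ} (hP : 1 < P) :
    ∃ C : ℝ≥0∞, C ≠ ⊤ ∧ ∀ a : ℤ → X → ℝ≥0∞, (∀ l, Measurable (a l)) →
      ∫⁻ x, (∑' l : ℤ, avg μ (a l) x ((2 : ℝ) ^ (1 - l))) ^ P ∂μ ≤
        C * ∫⁻ x, (∑' l, a l x) ^ P ∂μ := by
  have hP0 : 0 < P := by linarith
  have hP1 : 0 < P - 1 := by linarith
  set P' : ℝ := P / (P - 1) with hP'
  have hconj : P.HolderConjugate P' := Real.HolderConjugate.conjExponent hP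
  have hP'1 : 1 < P' := hconj.symm.lt
  have hP'0 : 0 < P' := by linarith
  have hinv : 1 / P' = 1 - 1 / P := by rw [hP']; field_simp
  obtain ⟨C₀, hC₀, hmax⟩ := hμ.lintegral_maxFn_rpow_le hP'1
  refine ⟨(ratioConst c Q 1 * C₀ ^ (1 / P')) ^ P, ?_, fun a ha => ?_⟩
  · exact ENNReal.rpow_ne_top_of_nonneg hP0.le (ENNReal.mul_ne_top (ratioConst_ne_top _ _ _)
      (ENNReal.rpow_ne_top_of_nonneg (by positivity) hC₀))
  rcases isEmpty_or_nonempty X with hX | ⟨⟨x₀⟩⟩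
  · simp [lintegral_of_isEmpty]
  set F : X → ℝ≥0∞ := fun x => ∑' l : ℤ, avg μ (a l) x ((2 : ℝ) ^ (1 - l)) with hF
  have hAm : ∀ l, Measurable fun x => avg μ (a l) x ((2 : ℝ) ^ (1 - l)) :=
    fun l => hμ.measurable_avg (ha l) _
  have hFm : Measurable F := Measurable.tsum hAm
  set S : X → ℝ≥0∞ := fun x => ∑' l, a l x with hS
  have hSm : Measurable S := Measurable.tsum ha
  set w : ℕ → X → ℝ≥0∞ := fun n => (ball x₀ n).indicator fun x => min (F x) n ^ (P - 1) with hw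
  have hwm : ∀ n, Measurable (w n) := fun n =>
    ((hFm.min measurable_const).pow_const _).indicator measurableSet_ball
  have hwP : ∀ n x, w n x ^ P' = (ball x₀ n).indicator (fun x => min (F x) n ^ P) x := by
    intro n x
    by_cases hx : x ∈ ball x₀ n
    · simp only [hw, Set.indicator_of_mem hx]
      rw [← ENNReal.rpow_mul, hP']
      congr 1
      field_simp
    · simp only [hw, Set.indicator_of_notMem hx, ENNReal.zero_rpow_of_pos hP'0]
  have hdual : ∀ n, ∫⁻ x, F x * w n x ∂μ ≤
      (ratioConst c Q 1 * C₀ ^ (1 / P') * (∫⁻ x, S x ^ P ∂μ) ^ (1 / P)) *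
        (∫⁻ x, w n x ^ P' ∂μ) ^ (1 - 1 / P) := by
    intro n
    calc ∫⁻ x, F x * w n x ∂μ
        = ∑' l, ∫⁻ x, avg μ (a l) x ((2 : ℝ) ^ (1 - l)) * w n x ∂μ := by
          rw [← lintegral_tsum]
          · simp only [hF, ENNReal.tsum_mul_right]
          · exact fun l => ((hAm l).mul (hwm n)).aemeasurable
      _ ≤ ∑' l, ratioConst c Q 1 * ∫⁻ x, a l x * maxFn μ (w n) x ∂μ := by
          refine ENNReal.tsum_le_tsum fun l => ?_
          refine (hμ.lintegral_avg_mul_le (ha l) (hwm n) (by positivity)).trans ?_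
          refine mul_le_mul_right (lintegral_mono fun x => ?_) _
          exact mul_le_mul_right (avg_le_maxFn _ _ _) _
      _ = ratioConst c Q 1 * ∫⁻ x, S x * maxFn μ (w n) x ∂μ := by
          rw [ENNReal.tsum_mul_left, ← lintegral_tsum]
          · simp only [hS, ENNReal.tsum_mul_right]
          · exact fun l => ((ha l).mul (hμ.measurable_maxFn (hwm n))).aemeasurable
      _ ≤ ratioConst c Q 1 * ((∫⁻ x, S x ^ P ∂μ) ^ (1 / P) *
            (∫⁻ x, maxFn μ (w n) x ^ P' ∂μ) ^ (1 / P')) := by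
          gcongr
          exact ENNReal.lintegral_mul_le_Lp_mul_Lq μ hconj hSm.aemeasurable
            (hμ.measurable_maxFn (hwm n)).aemeasurable
      _ ≤ ratioConst c Q 1 * ((∫⁻ x, S x ^ P ∂μ) ^ (1 / P) *
            (C₀ * ∫⁻ x, w n x ^ P' ∂μ) ^ (1 / P')) := by
          gcongr
          exact hmax _ (hwm n)
      _ = _ := by
          rw [ENNReal.mul_rpow_of_nonneg _ _ (by positivity), hinv]
          ring
  have hIle : ∀ n, ∫⁻ x, w n x ^ P' ∂μ ≤ ∫⁻ x, F x * w n x ∂μ := by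
    intro n
    refine lintegral_mono fun x => ?_
    rw [hwP]
    by_cases hx : x ∈ ball x₀ n
    · simp only [hw, Set.indicator_of_mem hx]
      calc min (F x) n ^ P = min (F x) n ^ (1 : ℝ) * min (F x) n ^ (P - 1) := by
            rw [← ENNReal.rpow_add_of_nonneg _ _ zero_le_one hP1.le]; ring_nf
        _ ≤ _ := by rw [ENNReal.rpow_one]; gcongr; exact min_le_left _ _
    · simp only [Set.indicator_of_notMem hx]
      exact zero_le
  have hIfin : ∀ n, ∫⁻ x, w n x ^ P' ∂μ ≠ ⊤ := by
    intro n
    refine ne_top_of_le_ne_top (b := (n : ℝ≥0∞) ^ P * μ (ball x₀ n)) ?_ ?_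
    · exact ENNReal.mul_ne_top (ENNReal.rpow_ne_top_of_nonneg hP0.le (by simp))
        (hμ.ball_ne_top _ _)
    · rw [← lintegral_indicator_const measurableSet_ball]
      refine lintegral_mono fun x => ?_
      rw [hwP]
      refine Set.indicator_le_indicator ?_
      exact ENNReal.rpow_le_rpow (min_le_right _ _) hP0.le
  have hbound : ∀ n, ∫⁻ x, w n x ^ P' ∂μ ≤
      (ratioConst c Q 1 * C₀ ^ (1 / P')) ^ P * ∫⁻ x, S x ^ P ∂μ := by
    intro n
    have := le_rpow_of_le_mul_rpow hP (hIfin n) ((hIle n).trans (hdual n))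
    rwa [ENNReal.mul_rpow_of_nonneg _ _ hP0.le, ← ENNReal.rpow_mul,
      one_div_mul_cancel hP0.ne', ENNReal.rpow_one] at this
  refine le_of_tendsto' (lintegral_tendsto_of_tendsto_of_monotone
    (f := fun n x => w n x ^ P') (F := fun x => F x ^ P)
    (fun n => ((hwm n).pow_const _).aemeasurable) ?_ ?_) hbound
  · refine Filter.Eventually.of_forall fun x m n hmn => ?_
    simp only [hwP]
    have hmn' : (m : ℝ) ≤ n := by exact_mod_cast hmn
    refine (Set.indicator_le_indicator_of_subset (ball_subset_ball hmn') (fun _ => zero_le) x).trans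
      (Set.indicator_le_indicator ?_)
    gcongr
  · refine Filter.Eventually.of_forall fun x => ?_
    simp only [hwP]
    have h1 : Filter.Tendsto (fun n : ℕ => min (F x) (n : ℝ≥0∞) ^ P) Filter.atTop
        (nhds (min (F x) ⊤ ^ P)) :=
      (ENNReal.continuous_rpow_const.tendsto _).comp
        (tendsto_const_nhds.min ENNReal.tendsto_nat_nhds_top)
    rw [min_eq_left le_top] at h1
    refine h1.congr' ?_
    obtain ⟨N, hN⟩ := exists_nat_gt (dist x x₀)
    filter_upwards [Filter.eventually_ge_atTop N] with n hn
    rw [Set.indicator_of_mem]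
    exact hN.trans_le (by exact_mod_cast hn)

/-- A vector-valued maximal inequality for averages at prescribed dyadic scales. -/
lemma lintegral_tsum_avg_rpow_rpow_le (hμ : IsRegular μ c Q) {P R : ℝ} (hP : 1 < P) (hR : 1 < R) :
    ∃ C : ℝ≥0∞, C ≠ ⊤ ∧ ∀ f : ℤ → X → ℝ≥0∞, (∀ l, Measurable (f l)) →
      ∫⁻ x, (∑' l : ℤ, avg μ (f l) x ((2 : ℝ) ^ (1 - l)) ^ R) ^ (P / R) ∂μ ≤
        C * ∫⁻ x, (∑' l, f l x ^ R) ^ (P / R) ∂μ := by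
  have hP0 : 0 < P := by linarith
  have hR0 : 0 < R := by linarith
  have hR1 : 0 < R - 1 := by linarith
  have hRi : 0 ≤ 1 - 1 / R := by
    rw [sub_nonneg, div_le_one hR0]; exact hR.le
  obtain ⟨C₁, hC₁, hsum⟩ := hμ.lintegral_tsum_avg_rpow_le hP
  obtain ⟨C₂, hC₂, hmax⟩ := hμ.lintegral_maxFn_rpow_le hP
  refine ⟨C₁ + C₂ + 1, by simp [hC₁, hC₂], fun f hf => ?_⟩
  set b : X → ℝ≥0∞ := fun x => (∑' l, f l x ^ R) ^ (1 / R) with hb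
  have hbm : Measurable b := (Measurable.tsum fun l => (hf l).pow_const R).pow_const _
  have hbP : ∀ x, (∑' l, f l x ^ R) ^ (P / R) = b x ^ P := fun x => by
    simp only [hb]; rw [← ENNReal.rpow_mul]; congr 1; field_simp
  have hbR : ∀ x, ∑' l, f l x ^ R = b x ^ R := fun x => by
    simp only [hb]; rw [← ENNReal.rpow_mul, one_div_mul_cancel hR0.ne', ENNReal.rpow_one]
  simp only [hbP]
  by_cases hfin : ∫⁻ x, b x ^ P ∂μ = ⊤
  · rw [hfin, ENNReal.mul_top (by simp)]
    exact le_top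
  have hbfin : ∀ᵐ x ∂μ, b x ≠ ⊤ := by
    filter_upwards [ae_lt_top (hbm.pow_const P) hfin] with x hx h
    rw [h, ENNReal.top_rpow_of_pos hP0] at hx
    exact lt_irrefl _ hx
  set a : ℤ → X → ℝ≥0∞ := fun l x => f l x ^ R * b x ^ (-(R - 1)) with ha
  have ham : ∀ l, Measurable (a l) := fun l => ((hf l).pow_const R).mul (hbm.pow_const _)
  have hsuma : ∀ᵐ x ∂μ, ∑' l, a l x ≤ b x := by
    filter_upwards [hbfin] with x hx
    simp only [ha, ENNReal.tsum_mul_right, hbR]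
    rcases eq_or_ne (b x) 0 with h0 | h0
    · rw [h0, ENNReal.zero_rpow_of_pos hR0, zero_mul]
    · rw [← ENNReal.rpow_add _ _ h0 hx]
      ring_nf
      rw [ENNReal.rpow_one]
  have hfle : ∀ l, ∀ᵐ x ∂μ, f l x ≤ a l x ^ (1 / R) * b x ^ (1 - 1 / R) := by
    intro l
    filter_upwards [hbfin] with x hx
    have hle : f l x ≤ b x := by
      rw [← ENNReal.rpow_le_rpow_iff hR0, ← hbR]
      exact ENNReal.le_tsum l
    rcases eq_or_ne (b x) 0 with h0 | h0
    · rw [h0] at hle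
      exact hle.trans zero_le
    · simp only [ha]
      rw [ENNReal.mul_rpow_of_nonneg _ _ (by positivity), ← ENNReal.rpow_mul, ← ENNReal.rpow_mul,
        mul_assoc, ← ENNReal.rpow_add _ _ h0 hx, mul_one_div_cancel hR0.ne', ENNReal.rpow_one]
      have : -(R - 1) * (1 / R) + (1 - 1 / R) = 0 := by field_simp; ring
      rw [this, ENNReal.rpow_zero, mul_one]
  have hpt : ∀ l x, avg μ (f l) x ((2 : ℝ) ^ (1 - l)) ^ R ≤
      avg μ (a l) x ((2 : ℝ) ^ (1 - l)) * maxFn μ b x ^ (R - 1) := by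
    intro l x
    have h1 : avg μ (f l) x ((2 : ℝ) ^ (1 - l)) ≤
        avg μ (a l) x ((2 : ℝ) ^ (1 - l)) ^ (1 / R) * maxFn μ b x ^ (1 - 1 / R) := by
      refine (avg_mono_ae (hfle l) _ _).trans ?_
      refine (ENNReal.lintegral_mul_norm_pow_le (ham l).aemeasurable hbm.aemeasurable
        (by positivity) hRi (by ring)).trans ?_
      exact mul_le_mul_right (ENNReal.rpow_le_rpow (avg_le_maxFn _ _ _) hRi) _
    refine (ENNReal.rpow_le_rpow h1 hR0.le).trans_eq ?_
    rw [ENNReal.mul_rpow_of_nonneg _ _ hR0.le, ← ENNReal.rpow_mul, ← ENNReal.rpow_mul,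
      one_div_mul_cancel hR0.ne', ENNReal.rpow_one]
    congr 2
    field_simp
  set S : X → ℝ≥0∞ := fun x => ∑' l : ℤ, avg μ (a l) x ((2 : ℝ) ^ (1 - l)) with hS
  have hSm : Measurable S := Measurable.tsum fun l => hμ.measurable_avg (ham l) _
  have hMm := hμ.measurable_maxFn hbm
  calc ∫⁻ x, (∑' l : ℤ, avg μ (f l) x ((2 : ℝ) ^ (1 - l)) ^ R) ^ (P / R) ∂μ
      ≤ ∫⁻ x, (S x ^ P) ^ (1 / R) * (maxFn μ b x ^ P) ^ (1 - 1 / R) ∂μ := by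
        refine lintegral_mono fun x => ?_
        calc (∑' l : ℤ, avg μ (f l) x ((2 : ℝ) ^ (1 - l)) ^ R) ^ (P / R)
            ≤ (S x * maxFn μ b x ^ (R - 1)) ^ (P / R) := by
              refine ENNReal.rpow_le_rpow ?_ (by positivity)
              simp only [hS, ← ENNReal.tsum_mul_right]
              exact ENNReal.tsum_le_tsum fun l => hpt l x
          _ = _ := by
              rw [ENNReal.mul_rpow_of_nonneg _ _ (by positivity), ← ENNReal.rpow_mul,
                ← ENNReal.rpow_mul, ← ENNReal.rpow_mul]
              congr 2 <;> field_simp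
    _ ≤ (∫⁻ x, S x ^ P ∂μ) ^ (1 / R) * (∫⁻ x, maxFn μ b x ^ P ∂μ) ^ (1 - 1 / R) :=
        ENNReal.lintegral_mul_norm_pow_le (hSm.pow_const P).aemeasurable
          (hMm.pow_const P).aemeasurable (by positivity) hRi (by ring)
    _ ≤ ((C₁ + C₂ + 1) * ∫⁻ x, b x ^ P ∂μ) ^ (1 / R) *
          ((C₁ + C₂ + 1) * ∫⁻ x, b x ^ P ∂μ) ^ (1 - 1 / R) := by
        refine mul_le_mul' (ENNReal.rpow_le_rpow ?_ (by positivity))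
          (ENNReal.rpow_le_rpow ?_ hRi)
        · refine (hsum a ham).trans (mul_le_mul' ?_ (lintegral_mono_ae ?_))
          · rw [add_assoc]; exact le_self_add
          · filter_upwards [hsuma] with x hx
            exact ENNReal.rpow_le_rpow hx hP0.le
        · refine (hmax b hbm).trans (mul_le_mul' ?_ le_rfl)
          rw [add_right_comm]; exact le_add_self
    _ = _ := by
        rw [← ENNReal.rpow_add_of_nonneg _ _ (by positivity) hRi]
        simp

end IsRegular

end VectorValued

section Telescoping

lemma le_mul_of_rpow_le {x a b M : ℝ≥0∞} {t : ℝ} (ht : 0 < t)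
    (h : x ^ t ≤ M * (a ^ t + b ^ t)) : x ≤ (2 * M) ^ (1 / t) * (a + b) := by
  have h1 : x ^ t ≤ 2 * M * (a + b) ^ t := by
    refine h.trans ?_
    have ha : a ^ t ≤ (a + b) ^ t := ENNReal.rpow_le_rpow le_self_add ht.le
    have hb : b ^ t ≤ (a + b) ^ t := ENNReal.rpow_le_rpow le_add_self ht.le
    calc M * (a ^ t + b ^ t) ≤ M * ((a + b) ^ t + (a + b) ^ t) := by gcongr
      _ = _ := by ring
  have h2 := ENNReal.rpow_le_rpow h1 (by positivity : 0 ≤ 1 / t)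
  rwa [ENNReal.mul_rpow_of_nonneg _ _ (by positivity), ← ENNReal.rpow_mul, ← ENNReal.rpow_mul,
    mul_one_div_cancel ht.ne', ENNReal.rpow_one, ENNReal.rpow_one] at h2

lemma enorm_sub_rpow_le {t : ℝ} (ht : 0 < t) (ht1 : t ≤ 1) (a b d : ℝ) :
    ‖a - b‖ₑ ^ t ≤ ‖d - a‖ₑ ^ t + ‖d - b‖ₑ ^ t := by
  refine le_trans (ENNReal.rpow_le_rpow ?_ ht.le) (ENNReal.rpow_add_le_add_rpow _ _ ht.le ht1)
  calc ‖a - b‖ₑ = ‖(d - b) - (d - a)‖ₑ := by congr 1; ring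
    _ ≤ ‖d - b‖ₑ + ‖d - a‖ₑ := enorm_sub_le
    _ = _ := add_comm _ _

lemma enorm_sub_le_sum_range (v : ℝ) (d : ℕ → ℝ) (n : ℕ) :
    ‖v - d 0‖ₑ ≤ ∑ i ∈ Finset.range n, ‖d i - d (i + 1)‖ₑ + ‖v - d n‖ₑ := by
  induction n with
  | zero => simp
  | succ n ih =>
    refine ih.trans ?_
    rw [Finset.sum_range_succ, add_assoc]
    gcongr
    calc ‖v - d n‖ₑ = ‖(v - d (n + 1)) - (d n - d (n + 1))‖ₑ := by congr 1; ring
      _ ≤ ‖v - d (n + 1)‖ₑ + ‖d n - d (n + 1)‖ₑ := enorm_sub_le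
      _ = _ := add_comm _ _

lemma aemeasurable_enorm_sub [MeasurableSpace X] {μ : Measure X} {u : X → ℝ} (hu : AEMeasurable u μ) (a : ℝ) :
    AEMeasurable (fun z => ‖u z - a‖ₑ) μ :=
  (hu.sub_const a).enorm

variable [MetricSpace X] [MeasurableSpace X]

/-- `y` is a Lebesgue point of `u`. -/
def IsLebesguePoint (μ : Measure X) (u : X → ℝ) (y : X) : Prop :=
  Filter.Tendsto (fun r => avg μ (fun z => ‖u z - u y‖ₑ) y r) (nhdsWithin 0 (Set.Ioi 0)) (nhds 0)

variable {μ : Measure X} {c Q : ℝ}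

lemma IsRegular.avg_rpow_le (hμ : IsRegular μ c Q) {f : X → ℝ≥0∞} (hf : AEMeasurable f μ)
    {t : ℝ} (ht : 0 < t) (ht1 : t ≤ 1) (x : X) {r : ℝ} (hr : 0 < r) :
    avg μ (fun y => f y ^ t) x r ≤ avg μ f x r ^ t := by
  have h := ENNReal.lintegral_mul_norm_pow_le
    (μ := (μ.restrict (ball x r) Set.univ)⁻¹ • μ.restrict (ball x r)) (f := f) (g := fun _ => 1)
    (hf.restrict.smul_measure _) aemeasurable_const ht.le (sub_nonneg.2 ht1) (by ring)
  have h1 : avg μ (fun _ => 1) x r = 1 := hμ.avg_const 1 x hr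
  rw [avg, laverage] at h1
  rw [h1] at h
  simpa [avg, laverage] using h

lemma IsRegular.ae_isLebesguePoint [BorelSpace X] [SecondCountableTopology X]
    (hμ : IsRegular μ c Q) {u : X → ℝ} (hu : LocallyIntegrable u μ) :
    ∀ᵐ y ∂μ, IsLebesguePoint μ u y := by
  have := hμ.isLocallyFinite
  have := hμ.isUnifLocDoubling
  filter_upwards [(IsUnifLocDoublingMeasure.vitaliFamily μ
    1).ae_tendsto_lintegral_enorm_sub_div hu] with y hy
  have h1 := hy.comp (IsUnifLocDoublingMeasure.tendsto_closedBall_filterAt μ (K := 1) (x := y)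
    (fun _ : ℝ => y) (fun r : ℝ => r) (l := nhdsWithin 0 (Set.Ioi 0)) Filter.tendsto_id (by
      filter_upwards [self_mem_nhdsWithin] with r hr
      simpa using (le_of_lt hr : (0 : ℝ) ≤ r)))
  have h2 := ENNReal.Tendsto.const_mul h1 (Or.inr (ratioConst_ne_top c Q 2))
  rw [mul_zero] at h2
  refine tendsto_of_tendsto_of_tendsto_of_le_of_le' tendsto_const_nhds h2
    (Filter.Eventually.of_forall fun _ => zero_le) ?_
  filter_upwards [self_mem_nhdsWithin] with r hr
  have hr' : (0 : ℝ) < r := hr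
  have hne : μ (closedBall y r) ≠ 0 := fun h =>
    hμ.ball_ne_zero y r hr' (measure_mono_null ball_subset_closedBall h)
  have hnt : μ (closedBall y r) ≠ ⊤ := ne_top_of_le_ne_top (hμ.ball_ne_top y (2 * r))
    (measure_mono (closedBall_subset_ball (by linarith)))
  rw [avg_eq, ENNReal.div_le_iff (hμ.ball_ne_zero _ _ hr') (hμ.ball_ne_top _ _)]
  simp only [Function.comp]
  calc ∫⁻ z in ball y r, ‖u z - u y‖ₑ ∂μ ≤ ∫⁻ z in closedBall y r, ‖u z - u y‖ₑ ∂μ :=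
        lintegral_mono_set ball_subset_closedBall
    _ = (∫⁻ z in closedBall y r, ‖u z - u y‖ₑ ∂μ) / μ (closedBall y r) * μ (closedBall y r) :=
        (ENNReal.div_mul_cancel hne hnt).symm
    _ ≤ (∫⁻ z in closedBall y r, ‖u z - u y‖ₑ ∂μ) / μ (closedBall y r) *
          (ratioConst c Q 2 * μ (ball y r)) := by
        gcongr
        refine (measure_mono (closedBall_subset_ball (by linarith : r < 2 * r))).trans ?_
        exact hμ.measure_ball_le hr' (by linarith) le_rfl (by rw [dist_self]; linarith)
    _ = _ := by ring

/-- The telescoping argument along the balls `B(y, r / 2 ^ n)`. -/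
lemma IsRegular.enorm_sub_le_tsum (hμ : IsRegular μ c Q) {t : ℝ} (ht : 0 < t) (ht1 : t ≤ 1)
    {u : X → ℝ} (hu : AEMeasurable u μ) {y : X} (hy : IsLebesguePoint μ u y) {r : ℝ}
    (hr : 0 < r) (d : ℕ → ℝ) (a : ℕ → ℝ≥0∞)
    (h : ∀ n, avg μ (fun z => ‖u z - d n‖ₑ ^ t) y (r / 2 ^ n) ≤ a n ^ t) :
    ‖u y - d 0‖ₑ ≤ 3 * (2 * (ratioConst c Q 2 + 1)) ^ (1 / t) * ∑' n, a n := by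
  set D : ℝ≥0∞ := (2 * (ratioConst c Q 2 + 1)) ^ (1 / t) with hD
  have hDt : D ≠ ⊤ := ENNReal.rpow_ne_top_of_nonneg (by positivity)
    (ENNReal.mul_ne_top (by simp) (by simp [ratioConst_ne_top]))
  have hm : ∀ v : ℝ, AEMeasurable (fun z => ‖u z - v‖ₑ ^ t) μ := fun v =>
    (aemeasurable_enorm_sub hu v).pow_const _
  have hrn : ∀ n : ℕ, 0 < r / 2 ^ n := fun n => by positivity
  set e : ℕ → ℝ≥0∞ := fun n => avg μ (fun z => ‖u z - u y‖ₑ) y (r / 2 ^ n) with he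
  have hsucc : ∀ n, ‖d n - d (n + 1)‖ₑ ≤ D * (a n + a (n + 1)) := by
    intro n
    refine le_mul_of_rpow_le ht ?_
    have hhalf : r / 2 ^ n = 2 * (r / 2 ^ (n + 1)) := by rw [pow_succ]; field_simp
    have hpos := hrn (n + 1)
    calc ‖d n - d (n + 1)‖ₑ ^ t
        = avg μ (fun _ => ‖d n - d (n + 1)‖ₑ ^ t) y (r / 2 ^ (n + 1)) :=
          (hμ.avg_const _ y (hrn _)).symm
      _ ≤ avg μ (fun z => ‖u z - d n‖ₑ ^ t + ‖u z - d (n + 1)‖ₑ ^ t) y (r / 2 ^ (n + 1)) :=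
          avg_mono (fun z => enorm_sub_rpow_le ht ht1 _ _ _) _ _
      _ = avg μ (fun z => ‖u z - d n‖ₑ ^ t) y (r / 2 ^ (n + 1)) +
            avg μ (fun z => ‖u z - d (n + 1)‖ₑ ^ t) y (r / 2 ^ (n + 1)) := avg_add (hm _) _ _
      _ ≤ ratioConst c Q 2 * avg μ (fun z => ‖u z - d n‖ₑ ^ t) y (r / 2 ^ n) + a (n + 1) ^ t := by
          gcongr
          · exact hμ.avg_le_avg hpos (by linarith) (by linarith) (by rw [dist_self]; linarith) _
          · exact h _
      _ ≤ ratioConst c Q 2 * a n ^ t + a (n + 1) ^ t := by gcongr; exact h _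
      _ ≤ (ratioConst c Q 2 + 1) * a n ^ t + (ratioConst c Q 2 + 1) * a (n + 1) ^ t := by
          gcongr
          · exact le_self_add
          · exact le_mul_of_one_le_left zero_le le_add_self
      _ = _ := by ring
  have hlast : ∀ n, ‖u y - d n‖ₑ ≤ D * (e n + a n) := by
    intro n
    refine le_mul_of_rpow_le ht ?_
    calc ‖u y - d n‖ₑ ^ t
        = avg μ (fun _ => ‖u y - d n‖ₑ ^ t) y (r / 2 ^ n) :=
          (hμ.avg_const _ y (hrn _)).symm
      _ ≤ avg μ (fun z => ‖u z - u y‖ₑ ^ t + ‖u z - d n‖ₑ ^ t) y (r / 2 ^ n) :=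
          avg_mono (fun z => enorm_sub_rpow_le ht ht1 _ _ _) _ _
      _ = avg μ (fun z => ‖u z - u y‖ₑ ^ t) y (r / 2 ^ n) +
            avg μ (fun z => ‖u z - d n‖ₑ ^ t) y (r / 2 ^ n) := avg_add (hm _) _ _
      _ ≤ e n ^ t + a n ^ t := by
          gcongr
          · exact hμ.avg_rpow_le (aemeasurable_enorm_sub hu _) ht ht1 y (hrn n)
          · exact h _
      _ ≤ _ := le_mul_of_one_le_left zero_le le_add_self
  have hbound : ∀ n, ‖u y - d 0‖ₑ ≤ 3 * D * ∑' n, a n + D * e n := by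
    intro n
    calc ‖u y - d 0‖ₑ ≤ ∑ i ∈ Finset.range n, ‖d i - d (i + 1)‖ₑ + ‖u y - d n‖ₑ :=
          enorm_sub_le_sum_range _ _ _
      _ ≤ ∑ i ∈ Finset.range n, D * (a i + a (i + 1)) + D * (e n + a n) := by
          gcongr with i _
          · exact hsucc i
          · exact hlast n
      _ ≤ ∑' i, D * (a i + a (i + 1)) + D * (e n + ∑' i, a i) := by
          gcongr
          · exact ENNReal.sum_le_tsum _
          · exact ENNReal.le_tsum n
      _ = D * (∑' i, a i + ∑' i, a (i + 1)) + D * (e n + ∑' i, a i) := by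
          rw [ENNReal.tsum_mul_left, ENNReal.tsum_add]
      _ ≤ D * (∑' i, a i + ∑' i, a i) + D * (e n + ∑' i, a i) := by
          refine add_le_add (mul_le_mul_right (add_le_add le_rfl ?_) _) le_rfl
          exact ENNReal.tsum_comp_le_tsum_of_injective (add_left_injective 1) a
      _ = _ := by ring
  have hlim : Filter.Tendsto (fun n => 3 * D * ∑' n, a n + D * e n) Filter.atTop
      (nhds (3 * D * ∑' n, a n + D * 0)) := by
    refine tendsto_const_nhds.add (ENNReal.Tendsto.const_mul ?_ (Or.inr hDt))
    refine hy.comp (tendsto_nhdsWithin_iff.2 ⟨?_, Filter.Eventually.of_forall hrn⟩)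
    have := (tendsto_pow_atTop_nhds_zero_of_lt_one (by norm_num : (0 : ℝ) ≤ 1 / 2)
      (by norm_num)).const_mul r
    rw [mul_zero] at this
    refine this.congr fun n => ?_
    rw [one_div, inv_pow]
    rfl
  have := ge_of_tendsto' hlim hbound
  simpa using this

end Telescoping

section Poincare

variable [MetricSpace X] [MeasurableSpace X] [BorelSpace X] {μ : Measure X} {c Q : ℝ}

lemma avg_mono_ball {f g : X → ℝ≥0∞} {x : X} {r : ℝ}
    (h : ∀ᵐ y ∂μ, y ∈ ball x r → f y ≤ g y) : avg μ f x r ≤ avg μ g x r := by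
  rw [avg_eq, avg_eq]
  exact ENNReal.div_le_div_right (setLIntegral_mono_ae' measurableSet_ball h) _

/-- A pointwise Hajłasz-type estimate implies a Poincaré-type inequality on the same ball. -/
lemma IsRegular.exists_avg_rpow_le (hμ : IsRegular μ c Q) {t : ℝ} {u : X → ℝ}
    {F : X → ℝ≥0∞} (hF : Measurable F) {E : Set X} (hE : μ E = 0) {κ : ℝ≥0∞} {y : X} {r : ℝ}
    (hr : 0 < r) (h : ∀ a ∉ E, ∀ b ∉ E, dist a b < 2 * r → ‖u a - u b‖ₑ ^ t ≤ κ * (F a + F b)) :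
    ∃ d : ℝ, avg μ (fun z => ‖u z - d‖ₑ ^ t) y r ≤ 2 * κ * avg μ F y r := by
  have hne : μ.restrict (ball y r) ≠ 0 := by
    rw [Ne, Measure.restrict_eq_zero]
    exact hμ.ball_ne_zero y r hr
  have : IsFiniteMeasure (μ.restrict (ball y r)) := ⟨by simpa using (hμ.ball_ne_top y r).lt_top⟩
  obtain ⟨b, hb, hFb⟩ := exists_notMem_null_le_laverage hne hF.aemeasurable
    (N := E ∪ (ball y r)ᶜ) (by
      refine measure_union_null (Measure.restrict_le_self.absolutelyContinuous hE) ?_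
      rw [Measure.restrict_apply measurableSet_ball.compl]
      simp)
  simp only [Set.mem_union, Set.mem_compl_iff, not_or, not_not] at hb
  refine ⟨u b, ?_⟩
  have hFb' : F b ≤ avg μ F y r := hFb
  calc avg μ (fun z => ‖u z - u b‖ₑ ^ t) y r ≤ avg μ (fun z => κ * (F z + F b)) y r := by
        refine avg_mono_ball ?_
        filter_upwards [measure_eq_zero_iff_ae_notMem.1 hE] with z hz hzb
        refine h z hz b hb.1 ((dist_triangle_right z b y).trans_lt ?_)
        linarith [mem_ball.1 hzb, mem_ball.1 hb.2]
    _ = κ * (avg μ F y r + F b) := by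
        rw [avg_const_mul (hF.add_const _).aemeasurable, avg_add hF.aemeasurable,
          hμ.avg_const _ y hr]
    _ ≤ κ * (avg μ F y r + avg μ F y r) := by gcongr
    _ = _ := by ring

variable [SecondCountableTopology X]

lemma IsRegular.avg_avg_le (hμ : IsRegular μ c Q) {F : X → ℝ≥0∞} (hF : Measurable F) (x : X)
    {r ρ : ℝ} (hρ : 0 < ρ) (hρr : ρ ≤ r) :
    avg μ (fun y => avg μ F y ρ) x r ≤ ratioConst c Q 1 * ratioConst c Q 2 * avg μ F x (2 * r) := by
  have hr : 0 < r := hρ.trans_le hρr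
  rw [avg_eq, ENNReal.div_le_iff (hμ.ball_ne_zero _ _ hr) (hμ.ball_ne_top _ _)]
  set F' : X → ℝ≥0∞ := (ball x (2 * r)).indicator F with hF'
  set w : X → ℝ≥0∞ := (ball x r).indicator fun _ => 1 with hw
  have hwm : Measurable w := measurable_const.indicator measurableSet_ball
  have hF'm : Measurable F' := hF.indicator measurableSet_ball
  calc ∫⁻ y in ball x r, avg μ F y ρ ∂μ = ∫⁻ y, avg μ F' y ρ * w y ∂μ := by
        rw [← lintegral_indicator measurableSet_ball]
        refine lintegral_congr fun y => ?_
        by_cases hy : y ∈ ball x r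
        · simp only [hw, Set.indicator_of_mem hy, mul_one, avg_eq]
          congr 1
          refine setLIntegral_congr_fun measurableSet_ball fun z hz => ?_
          have : z ∈ ball x (2 * r) := by
            rw [mem_ball] at hy hz ⊢
            linarith [dist_triangle z y x]
          simp only [hF', Set.indicator_of_mem this]
        · simp only [hw, Set.indicator_of_notMem hy, mul_zero]
    _ ≤ ratioConst c Q 1 * ∫⁻ y, F' y * avg μ w y ρ ∂μ := hμ.lintegral_avg_mul_le hF'm hwm hρ
    _ ≤ ratioConst c Q 1 * ∫⁻ y, F' y ∂μ := by
        refine mul_le_mul_right (lintegral_mono fun y => ?_) _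
        refine mul_le_of_le_one_right zero_le ?_
        refine (avg_mono (fun z => ?_) _ _).trans_eq (hμ.avg_const 1 y hρ)
        exact Set.indicator_le_self' (fun _ _ => zero_le) z
    _ = ratioConst c Q 1 * (μ (ball x (2 * r)) * avg μ F x (2 * r)) := by
        rw [hF', lintegral_indicator measurableSet_ball, hμ.measure_mul_avg]
    _ ≤ ratioConst c Q 1 * (ratioConst c Q 2 * μ (ball x r) * avg μ F x (2 * r)) := by
        gcongr
        exact hμ.measure_ball_le hr (by linarith) le_rfl (by rw [dist_self]; linarith)
    _ = _ := by ring

lemma IsRegular.avg_avg_rpow_le (hμ : IsRegular μ c Q) {F : X → ℝ≥0∞} (hF : Measurable F) (x : X)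
    {r ρ a θ : ℝ} (hρ : 0 < ρ) (hρr : ρ ≤ r) (ha : 2 * r ≤ a * ρ) (hθ : 1 ≤ θ) :
    avg μ (fun y => avg μ F y ρ ^ θ) x r ≤
      ratioConst c Q a ^ (θ - 1) * (ratioConst c Q 1 * ratioConst c Q 2) *
        avg μ F x (2 * r) ^ θ := by
  set V := avg μ F x (2 * r) with hV
  have hθ' : 0 ≤ θ - 1 := by linarith
  calc avg μ (fun y => avg μ F y ρ ^ θ) x r
      ≤ avg μ (fun y => (ratioConst c Q a * V) ^ (θ - 1) * avg μ F y ρ) x r := by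
        refine avg_mono_ball (Filter.Eventually.of_forall fun y hy => ?_)
        calc avg μ F y ρ ^ θ = avg μ F y ρ ^ (θ - 1) * avg μ F y ρ ^ (1 : ℝ) := by
              rw [← ENNReal.rpow_add_of_nonneg _ _ hθ' zero_le_one]; ring_nf
          _ ≤ _ := by
              rw [ENNReal.rpow_one]
              gcongr
              refine hμ.avg_le_avg hρ (by linarith) ha ?_ F
              linarith [mem_ball.1 hy]
    _ = (ratioConst c Q a * V) ^ (θ - 1) * avg μ (fun y => avg μ F y ρ) x r :=
        avg_const_mul (hμ.measurable_avg hF ρ).aemeasurable _ _ _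
    _ ≤ (ratioConst c Q a * V) ^ (θ - 1) * (ratioConst c Q 1 * ratioConst c Q 2 * V) := by
        gcongr
        exact hμ.avg_avg_le hF x hρ hρr
    _ = ratioConst c Q a ^ (θ - 1) * (ratioConst c Q 1 * ratioConst c Q 2) *
          (V ^ (θ - 1) * V ^ (1 : ℝ)) := by
        rw [ENNReal.mul_rpow_of_nonneg _ _ hθ', ENNReal.rpow_one]; ring
    _ = _ := by
        rw [← ENNReal.rpow_add_of_nonneg _ _ hθ' zero_le_one]; ring_nf

lemma ratioConst_two_pow_rpow (hc : 0 < c) (n : ℕ) {σ : ℝ} (hσ : 0 ≤ σ) :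
    ratioConst c Q (2 ^ (n + 1)) ^ σ = ratioConst c Q 2 ^ σ * ((2 : ℝ≥0∞) ^ (Q * σ)) ^ n := by
  have h : ratioConst c Q (2 ^ (n + 1)) = ratioConst c Q 2 * ((2 : ℝ≥0∞) ^ Q) ^ n := by
    rw [ratioConst, ratioConst]
    have h2 : (2 : ℝ≥0∞) ^ Q = ENNReal.ofReal (2 ^ Q) := by
      rw [← ENNReal.ofReal_rpow_of_pos two_pos]; simp
    rw [h2, ← ENNReal.ofReal_pow (by positivity), ← ENNReal.ofReal_mul (by positivity)]
    congr 1
    rw [pow_succ, Real.mul_rpow (by positivity) (by positivity), ← Real.rpow_natCast,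
      ← Real.rpow_natCast, ← Real.rpow_mul (by positivity), ← Real.rpow_mul (by positivity)]
    ring_nf
  rw [h, ENNReal.mul_rpow_of_nonneg _ _ hσ]
  congr 1
  rw [← ENNReal.rpow_natCast, ← ENNReal.rpow_natCast, ← ENNReal.rpow_mul, ← ENNReal.rpow_mul,
    ← ENNReal.rpow_mul]
  ring_nf

/-- The Sobolev–Poincaré inequality for fractional Hajłasz-type estimates. -/
lemma IsRegular.exists_avg_enorm_sub_le (hμ : IsRegular μ c Q) {t σ : ℝ} (ht : 0 < t)
    (ht1 : t ≤ 1) (hσ : Q * (1 / t - 1) < σ) :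
    ∃ C : ℝ≥0∞, C ≠ ⊤ ∧ ∀ (u : X → ℝ) (F : X → ℝ≥0∞) (E : Set X) (r : ℝ),
      LocallyIntegrable u μ → Measurable F → μ E = 0 → 0 < r →
      (∀ n : ℕ, ∀ y ∉ E, ∀ z ∉ E, dist y z < 4 * (r / 2 ^ n) →
        ‖u y - u z‖ₑ ^ t ≤ ((2 : ℝ≥0∞) ^ (-(σ * t))) ^ n * (F y + F z)) →
      ∀ x, ∃ d : ℝ, avg μ (fun y => ‖u y - d‖ₑ) x r ≤ C * avg μ F x (2 * r) ^ (1 / t) := by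
  have hθ : 1 ≤ 1 / t := (one_le_div ht).2 ht1
  have hθ0 : 0 ≤ 1 / t := by linarith
  have hθ1 : 0 ≤ 1 / t - 1 := by linarith
  set D : ℝ≥0∞ := 3 * (2 * (ratioConst c Q 2 + 1)) ^ (1 / t) with hD
  have hDt : D ≠ ⊤ := ENNReal.mul_ne_top (by simp) (ENNReal.rpow_ne_top_of_nonneg hθ0
    (ENNReal.mul_ne_top (by simp) (by simp [ratioConst_ne_top])))
  set K : ℝ≥0∞ := ratioConst c Q 1 * ratioConst c Q 2 with hK
  have hKt : K ≠ ⊤ := ENNReal.mul_ne_top (ratioConst_ne_top _ _ _) (ratioConst_ne_top _ _ _)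
  set T : ℝ≥0∞ := ∑' n : ℕ, ((2 : ℝ≥0∞) ^ (-(σ - Q * (1 / t - 1)))) ^ n with hT
  have hTt : T ≠ ⊤ := tsum_nat_geometric_ne_top (two_rpow_neg_lt_one (by linarith))
  refine ⟨D * ((2 * ratioConst c Q 2) ^ (1 / t) +
    2 ^ (1 / t) * ratioConst c Q 2 ^ (1 / t - 1) * K * T), ?_, ?_⟩
  · have hR := ratioConst_ne_top c Q 2
    refine ENNReal.mul_ne_top hDt (ENNReal.add_ne_top.2 ⟨?_, ?_⟩)
    · exact ENNReal.rpow_ne_top_of_nonneg hθ0 (ENNReal.mul_ne_top (by simp) hR)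
    · exact ENNReal.mul_ne_top (ENNReal.mul_ne_top (ENNReal.mul_ne_top
        (ENNReal.rpow_ne_top_of_nonneg hθ0 (by simp))
        (ENNReal.rpow_ne_top_of_nonneg hθ1 hR)) hKt) hTt
  intro u F E r hu hF hE hr h x
  have hum : AEMeasurable u μ := hu.aestronglyMeasurable.aemeasurable
  have hrn : ∀ n : ℕ, 0 < r / 2 ^ n := fun n => by positivity
  have hrn' : ∀ n : ℕ, r / 2 ^ n ≤ r := fun n =>
    div_le_self hr.le (one_le_pow₀ one_le_two)
  set V := avg μ F x (2 * r) with hV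
  obtain ⟨d₀, hd₀⟩ := hμ.exists_avg_rpow_le (t := t) (u := u) hF hE (κ := 1) (y := x)
    (r := 2 * r) (by linarith) (fun a ha b hb hab => by
      simpa using h 0 a ha b hb (by simpa using (by linarith : dist a b < 4 * r)))
  have hd : ∀ (n : ℕ) (y : X), ∃ d : ℝ, avg μ (fun z => ‖u z - d‖ₑ ^ t) y (r / 2 ^ n) ≤
      2 * ((2 : ℝ≥0∞) ^ (-(σ * t))) ^ n * avg μ F y (r / 2 ^ n) := fun n y =>
    hμ.exists_avg_rpow_le hF hE (hrn n) fun a ha b hb hab =>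
      h n a ha b hb (by linarith [hrn n])
  choose d hd using hd
  set A : ℕ → X → ℝ≥0∞ := fun n y =>
    2 ^ (1 / t) * ((2 : ℝ≥0∞) ^ (-σ)) ^ n * avg μ F y (r / 2 ^ n) ^ (1 / t) with hA
  have hAt : ∀ n y, A n y ^ t =
      2 * ((2 : ℝ≥0∞) ^ (-(σ * t))) ^ n * avg μ F y (r / 2 ^ n) := by
    intro n y
    simp only [hA]
    rw [ENNReal.mul_rpow_of_nonneg _ _ ht.le, ENNReal.mul_rpow_of_nonneg _ _ ht.le,
      ← ENNReal.rpow_mul, ← ENNReal.rpow_mul, one_div_mul_cancel ht.ne', ENNReal.rpow_one,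
      ENNReal.rpow_one, ← ENNReal.rpow_natCast, ← ENNReal.rpow_natCast, ← ENNReal.rpow_mul,
      ← ENNReal.rpow_mul, ← ENNReal.rpow_mul]
    congr 3
    ring
  have hAm : ∀ n, Measurable (A n) := fun n =>
    ((hμ.measurable_avg hF _).pow_const _).const_mul _
  set a₀ : ℝ≥0∞ := (2 * ratioConst c Q 2) ^ (1 / t) * V ^ (1 / t) with ha₀
  have ha₀t : a₀ ^ t = ratioConst c Q 2 * (2 * 1 * V) := by
    rw [ha₀, ENNReal.mul_rpow_of_nonneg _ _ ht.le, ← ENNReal.rpow_mul, ← ENNReal.rpow_mul,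
      one_div_mul_cancel ht.ne', ENNReal.rpow_one, ENNReal.rpow_one]
    ring
  have hpt : ∀ᵐ y ∂μ, y ∈ ball x r → ‖u y - d₀‖ₑ ≤ D * (a₀ + ∑' n, A n y) := by
    filter_upwards [hμ.ae_isLebesguePoint hu] with y hy hyx
    have := hμ.enorm_sub_le_tsum ht ht1 hum hy hr (fun n => if n = 0 then d₀ else d n y)
      (fun n => if n = 0 then a₀ else A n y) (fun n => by
        rcases eq_or_ne n 0 with rfl | hn
        · simp only [if_true, pow_zero, div_one, ha₀t]
          refine (hμ.avg_le_avg (x := x) hr (by linarith : r ≤ 2 * r) le_rfl ?_ _).trans ?_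
          · linarith [mem_ball.1 hyx]
          · gcongr
        · simp only [hn, if_false, hAt]
          exact hd n y)
    simp only [if_true] at this
    refine this.trans (mul_le_mul_right ?_ _)
    calc ∑' n, (if n = 0 then a₀ else A n y)
        ≤ ∑' n, ((if n = 0 then a₀ else 0) + A n y) := by
          refine ENNReal.tsum_le_tsum fun n => ?_
          split_ifs <;> simp
      _ = _ := by rw [ENNReal.tsum_add, tsum_ite_eq]
  have hm : Measurable fun y => a₀ + ∑' n, A n y := measurable_const.add (Measurable.tsum hAm)
  refine ⟨d₀, ?_⟩
  calc avg μ (fun y => ‖u y - d₀‖ₑ) x r ≤ avg μ (fun y => D * (a₀ + ∑' n, A n y)) x r :=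
        avg_mono_ball hpt
    _ = D * (a₀ + ∑' n, avg μ (A n) x r) := by
        rw [avg_const_mul hm.aemeasurable,
          avg_add aemeasurable_const, avg_tsum fun n => (hAm n).aemeasurable, hμ.avg_const _ x hr]
    _ ≤ D * (a₀ + ∑' n : ℕ, 2 ^ (1 / t) * ratioConst c Q 2 ^ (1 / t - 1) * K * V ^ (1 / t) *
          ((2 : ℝ≥0∞) ^ (-(σ - Q * (1 / t - 1)))) ^ n) := by
        refine mul_le_mul_right (add_le_add le_rfl (ENNReal.tsum_le_tsum fun n => ?_)) _
        simp only [hA]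
        rw [avg_const_mul ((hμ.measurable_avg hF _).pow_const _).aemeasurable]
        calc 2 ^ (1 / t) * ((2 : ℝ≥0∞) ^ (-σ)) ^ n *
              avg μ (fun y => avg μ F y (r / 2 ^ n) ^ (1 / t)) x r
            ≤ 2 ^ (1 / t) * ((2 : ℝ≥0∞) ^ (-σ)) ^ n *
              (ratioConst c Q (2 ^ (n + 1)) ^ (1 / t - 1) * K * V ^ (1 / t)) := by
              gcongr
              refine hμ.avg_avg_rpow_le hF x (hrn n) (hrn' n) (le_of_eq ?_) hθ
              rw [pow_succ]; field_simp
          _ = 2 ^ (1 / t) * ratioConst c Q 2 ^ (1 / t - 1) * K * V ^ (1 / t) *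
                (((2 : ℝ≥0∞) ^ (-σ)) ^ n * ((2 : ℝ≥0∞) ^ (Q * (1 / t - 1))) ^ n) := by
              rw [ratioConst_two_pow_rpow hμ.c_pos n hθ1]; ring
          _ = _ := by
              rw [← mul_pow, ← ENNReal.rpow_add _ _ two_ne_zero ofNat_ne_top]
              congr 3
              ring
    _ = _ := by rw [ENNReal.tsum_mul_left, ha₀]; ring

end Poincare

section Dyadic

/-- The two-sided geometrically weighted sum of the `t`-th powers of a sequence around `l`. -/
noncomputable def dyadicSum (δ t : ℝ) (G : ℤ → X → ℝ≥0∞) (l : ℤ) (x : X) : ℝ≥0∞ :=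
  ∑' i : ℤ, (2 : ℝ≥0∞) ^ (-(δ * |(i : ℝ) - l|)) * G i x ^ t

lemma measurable_dyadicSum [MeasurableSpace X] {δ t : ℝ} {G : ℤ → X → ℝ≥0∞}
    (hG : ∀ i, Measurable (G i)) (l : ℤ) : Measurable (dyadicSum δ t G l) :=
  Measurable.tsum fun i => ((hG i).pow_const _).const_mul _

lemma le_dyadicSum (δ t : ℝ) (G : ℤ → X → ℝ≥0∞) (l i : ℤ) (x : X) :
    (2 : ℝ≥0∞) ^ (-(δ * |(i : ℝ) - l|)) * G i x ^ t ≤ dyadicSum δ t G l x :=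
  ENNReal.le_tsum i

/-- The annular pointwise inequality defining fractional Hajłasz gradients, for
extended nonnegative gradients, outside of the set `E`. -/
def AnnularBound [PseudoMetricSpace X] (s : ℝ) (u : X → ℝ) (G : ℤ → X → ℝ≥0∞) (E : Set X) : Prop :=
  ∀ k : ℤ, ∀ x ∉ E, ∀ y ∉ E, (2 : ℝ) ^ (-k - 1) ≤ dist x y → dist x y < (2 : ℝ) ^ (-k) →
    ‖u x - u y‖ₑ ≤ (2 : ℝ≥0∞) ^ (-(k * s)) * (G k x + G k y)

variable [MetricSpace X]

lemma exists_dyadic_dist {x y : X} (h : x ≠ y) :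
    ∃ i : ℤ, (2 : ℝ) ^ (-i - 1) ≤ dist x y ∧ dist x y < (2 : ℝ) ^ (-i) := by
  obtain ⟨n, hn, hn'⟩ := exists_mem_Ico_zpow (dist_pos.2 h) (one_lt_two (α := ℝ))
  exact ⟨-n - 1, by simpa using hn, by simpa [add_comm] using hn'⟩

lemma AnnularBound.enorm_rpow_le {s σ t : ℝ} (ht : 0 < t) (ht1 : t ≤ 1) (hσ : 0 ≤ σ) (hσs : σ ≤ s)
    {u : X → ℝ} {G : ℤ → X → ℝ≥0∞} {E : Set X} (h : AnnularBound s u G E) (l : ℤ) (n : ℕ)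
    {y z : X} (hy : y ∉ E) (hz : z ∉ E) (hyz : dist y z < 4 * ((2 : ℝ) ^ (-l) / 2 ^ n)) :
    ‖u y - u z‖ₑ ^ t ≤ ((2 : ℝ≥0∞) ^ (-(σ * t))) ^ n *
      ((2 : ℝ≥0∞) ^ (2 * (σ * t) + 4 * ((s - σ) * t) - l * (s * t)) *
          dyadicSum ((s - σ) * t) t G l y +
        (2 : ℝ≥0∞) ^ (2 * (σ * t) + 4 * ((s - σ) * t) - l * (s * t)) *
          dyadicSum ((s - σ) * t) t G l z) := by
  rcases eq_or_ne y z with rfl | hne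
  · simp [ht]
  obtain ⟨i, hi, hi'⟩ := exists_dyadic_dist hne
  have hil : l + n - 2 ≤ i := by
    have h1 : (2 : ℝ) ^ (-i - 1) < 2 ^ (2 - l - n) := by
      refine (hi.trans_lt hyz).trans_eq ?_
      rw [zpow_sub₀ two_ne_zero, zpow_sub₀ two_ne_zero, zpow_neg, zpow_natCast]
      norm_num
      ring
    have := (zpow_lt_zpow_iff_right₀ (one_lt_two (α := ℝ))).1 h1
    omega
  have hil' : (l : ℝ) + n - 2 ≤ i := by exact_mod_cast hil
  have hσt : 0 ≤ σ * t := by positivity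
  have hδ : 0 ≤ (s - σ) * t := mul_nonneg (by linarith) ht.le
  have key : (2 : ℝ≥0∞) ^ (-(i * s) * t) ≤ ((2 : ℝ≥0∞) ^ (-(σ * t))) ^ n *
      (2 : ℝ≥0∞) ^ (2 * (σ * t) + 4 * ((s - σ) * t) - l * (s * t)) *
      (2 : ℝ≥0∞) ^ (-((s - σ) * t * |(i : ℝ) - l|)) := by
    rw [← ENNReal.rpow_natCast, ← ENNReal.rpow_mul, ← ENNReal.rpow_add _ _ two_ne_zero ofNat_ne_top,
      ← ENNReal.rpow_add _ _ two_ne_zero ofNat_ne_top]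
    refine ENNReal.rpow_le_rpow_of_exponent_le one_le_two ?_
    have habs : |(i : ℝ) - l| ≤ (i - l) + 4 := by
      have : (0 : ℝ) ≤ n := n.cast_nonneg
      rw [abs_le]; constructor <;> linarith
    have h1 := mul_le_mul_of_nonneg_left habs hδ
    have h2 := mul_le_mul_of_nonneg_left hil' hσt
    nlinarith
  calc ‖u y - u z‖ₑ ^ t ≤ ((2 : ℝ≥0∞) ^ (-(i * s)) * (G i y + G i z)) ^ t :=
        ENNReal.rpow_le_rpow (h i y hy z hz hi hi') ht.le
    _ ≤ (2 : ℝ≥0∞) ^ (-(i * s) * t) * (G i y ^ t + G i z ^ t) := by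
        rw [ENNReal.mul_rpow_of_nonneg _ _ ht.le, ← ENNReal.rpow_mul]
        gcongr
        exact ENNReal.rpow_add_le_add_rpow _ _ ht.le ht1
    _ ≤ ((2 : ℝ≥0∞) ^ (-(σ * t))) ^ n *
      (2 : ℝ≥0∞) ^ (2 * (σ * t) + 4 * ((s - σ) * t) - l * (s * t)) *
      (2 : ℝ≥0∞) ^ (-((s - σ) * t * |(i : ℝ) - l|)) * (G i y ^ t + G i z ^ t) := by gcongr
    _ = ((2 : ℝ≥0∞) ^ (-(σ * t))) ^ n *
      ((2 : ℝ≥0∞) ^ (2 * (σ * t) + 4 * ((s - σ) * t) - l * (s * t)) *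
        ((2 : ℝ≥0∞) ^ (-((s - σ) * t * |(i : ℝ) - l|)) * G i y ^ t) +
      (2 : ℝ≥0∞) ^ (2 * (σ * t) + 4 * ((s - σ) * t) - l * (s * t)) *
        ((2 : ℝ≥0∞) ^ (-((s - σ) * t * |(i : ℝ) - l|)) * G i z ^ t)) := by ring
    _ ≤ _ := by
        gcongr
        · exact le_dyadicSum _ _ _ _ _ _
        · exact le_dyadicSum _ _ _ _ _ _

variable [MeasurableSpace X] [BorelSpace X] [SecondCountableTopology X] {μ : Measure X} {c Q : ℝ}

/-- Poincaré-type inequality for functions with a fractional Hajłasz gradient. -/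
lemma IsRegular.exists_avg_enorm_sub_le_dyadicSum (hμ : IsRegular μ c Q) {s σ t : ℝ} (ht : 0 < t)
    (ht1 : t ≤ 1) (hσ : Q * (1 / t - 1) < σ) (hσs : σ ≤ s) :
    ∃ C : ℝ≥0∞, C ≠ ⊤ ∧ ∀ (u : X → ℝ) (G : ℤ → X → ℝ≥0∞) (E : Set X),
      LocallyIntegrable u μ → (∀ i, Measurable (G i)) → μ E = 0 → AnnularBound s u G E →
      ∀ (l : ℤ) (x : X), ∃ d : ℝ, avg μ (fun y => ‖u y - d‖ₑ) x (2 ^ (-l)) ≤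
        (2 : ℝ≥0∞) ^ (-(l * s)) *
          (C * avg μ (dyadicSum ((s - σ) * t) t G l) x (2 ^ (1 - l)) ^ (1 / t)) := by
  obtain ⟨C, hC, h⟩ := hμ.exists_avg_enorm_sub_le ht ht1 hσ
  have hθ : 1 ≤ 1 / t := (one_le_div ht).2 ht1
  have hσ0 : 0 ≤ σ := (mul_nonneg hμ.Q_pos.le (by linarith)).trans hσ.le
  set κ : ℝ := 2 * (σ * t) + 4 * ((s - σ) * t) with hκ
  refine ⟨C * 2 ^ (κ * (1 / t)), ENNReal.mul_ne_top hC
    (by simp [ENNReal.rpow_eq_top_iff]), ?_⟩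
  intro u G E hu hG hE hA l x
  have hm := measurable_dyadicSum (δ := (s - σ) * t) (t := t) hG l
  obtain ⟨d, hd⟩ := h u (fun y => 2 ^ (κ - l * (s * t)) * dyadicSum ((s - σ) * t) t G l y) E
    (2 ^ (-l)) hu (hm.const_mul _) hE (by positivity)
    (fun n y hy z hz hyz => hA.enorm_rpow_le ht ht1 hσ0 hσs l n hy hz hyz) x
  refine ⟨d, hd.trans_eq ?_⟩
  have h2 : (2 : ℝ) * 2 ^ (-l) = 2 ^ (1 - l) := by
    rw [sub_eq_add_neg, zpow_add₀ two_ne_zero, zpow_one]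
  rw [avg_const_mul hm.aemeasurable, h2, ENNReal.mul_rpow_of_nonneg _ _ (by linarith),
    ← ENNReal.rpow_mul]
  have h3 : (κ - l * (s * t)) * (1 / t) = κ * (1 / t) + -(l * s) := by field_simp; ring
  rw [h3, ENNReal.rpow_add _ _ two_ne_zero ofNat_ne_top]
  ring

end Dyadic

section Telescoping

/-- The sum of the terms of index at least `l` of a two-sided sequence. -/
noncomputable def tailSum (b : ℤ → ℝ≥0∞) (l : ℤ) : ℝ≥0∞ :=
  ∑' j : ℤ, if l ≤ j then b j else 0

lemma le_tailSum (b : ℤ → ℝ≥0∞) (l : ℤ) : b l ≤ tailSum b l := by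
  refine le_trans ?_ (ENNReal.le_tsum (f := fun j => if l ≤ j then b j else 0) l)
  simp

lemma tsum_add_nat_le_tailSum (b : ℤ → ℝ≥0∞) (l : ℤ) :
    ∑' n : ℕ, b (l + n) ≤ tailSum b l := by
  have hinj : Function.Injective fun n : ℕ => l + n := fun m n h => by simpa using h
  calc ∑' n : ℕ, b (l + n) = ∑' n : ℕ, if l ≤ l + n then b (l + n) else 0 := by simp
    _ ≤ _ := ENNReal.tsum_comp_le_tsum_of_injective hinj fun j => if l ≤ j then b j else 0

variable [MetricSpace X] [MeasurableSpace X] [BorelSpace X] {μ : Measure X} {c Q : ℝ}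

lemma IsRegular.avg_enorm_sub_le_tailSum (hμ : IsRegular μ c Q)
    {u : X → ℝ} (hu : AEMeasurable u μ) {y : X} (hy : IsLebesguePoint μ u y) {b : ℤ → ℝ≥0∞}
    (h : ∀ l : ℤ, ∃ d : ℝ, avg μ (fun z => ‖u z - d‖ₑ) y (2 ^ (-l)) ≤ b l) (l : ℤ) :
    avg μ (fun z => ‖u z - u y‖ₑ) y (2 ^ (-l)) ≤
      (1 + 3 * (2 * (ratioConst c Q 2 + 1))) * tailSum b l := by
  choose d hd using h
  have hr : (0 : ℝ) < 2 ^ (-l) := by positivity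
  have h1 := hμ.enorm_sub_le_tsum one_pos le_rfl hu hy hr (fun n => d (l + n))
    (fun n => b (l + n)) (fun n => by
      have : (2 : ℝ) ^ (-l) / 2 ^ n = 2 ^ (-(l + n)) := by
        rw [neg_add, zpow_add₀ two_ne_zero, zpow_neg _ (n : ℤ), zpow_natCast, div_eq_mul_inv]
      simpa only [this, ENNReal.rpow_one] using hd (l + n))
  simp only [div_one, ENNReal.rpow_one, Nat.cast_zero, add_zero] at h1
  calc avg μ (fun z => ‖u z - u y‖ₑ) y (2 ^ (-l))
      ≤ avg μ (fun z => ‖u z - d l‖ₑ + ‖u y - d l‖ₑ) y (2 ^ (-l)) := by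
        refine avg_mono (fun z => ?_) _ _
        calc ‖u z - u y‖ₑ = ‖(u z - d l) - (u y - d l)‖ₑ := by congr 1; ring
          _ ≤ _ := enorm_sub_le
    _ = avg μ (fun z => ‖u z - d l‖ₑ) y (2 ^ (-l)) + ‖u y - d l‖ₑ := by
        rw [avg_add (aemeasurable_enorm_sub hu _), hμ.avg_const _ y hr]
    _ ≤ tailSum b l + 3 * (2 * (ratioConst c Q 2 + 1)) * tailSum b l :=
        add_le_add ((hd l).trans (le_tailSum b l))
          (h1.trans (mul_le_mul_right (tsum_add_nat_le_tailSum b l) _))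
    _ = _ := by ring

lemma IsRegular.enorm_sub_le_avg_add_avg (hμ : IsRegular μ c Q) {u : X → ℝ}
    (hu : AEMeasurable u μ) {x y : X} {k : ℤ} (hxy : dist x y < 2 ^ (-k)) :
    ‖u x - u y‖ₑ ≤ ratioConst c Q 2 * avg μ (fun z => ‖u z - u x‖ₑ) x (2 ^ (-(k - 1))) +
      avg μ (fun z => ‖u z - u y‖ₑ) y (2 ^ (-k)) := by
  have hr : (0 : ℝ) < 2 ^ (-k) := by positivity
  have h2 : (2 : ℝ) ^ (-(k - 1)) = 2 * 2 ^ (-k) := by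
    rw [neg_sub, sub_eq_add_neg, zpow_add₀ two_ne_zero, zpow_one]
  calc ‖u x - u y‖ₑ = avg μ (fun _ => ‖u x - u y‖ₑ) y (2 ^ (-k)) := (hμ.avg_const _ y hr).symm
    _ ≤ avg μ (fun z => ‖u z - u x‖ₑ + ‖u z - u y‖ₑ) y (2 ^ (-k)) := by
        refine avg_mono (fun z => ?_) _ _
        calc ‖u x - u y‖ₑ = ‖(u z - u y) - (u z - u x)‖ₑ := by congr 1; ring
          _ ≤ ‖u z - u y‖ₑ + ‖u z - u x‖ₑ := enorm_sub_le
          _ = _ := add_comm _ _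
    _ = avg μ (fun z => ‖u z - u x‖ₑ) y (2 ^ (-k)) + avg μ (fun z => ‖u z - u y‖ₑ) y (2 ^ (-k)) :=
        avg_add (aemeasurable_enorm_sub hu _) _ _
    _ ≤ _ := by
        gcongr
        rw [h2]
        refine hμ.avg_le_avg hr (by linarith) le_rfl ?_ _
        rw [dist_comm]; linarith

end Telescoping

section DiscreteConvolution

/-- If two finite convex combinations have weights that differ by at most `η`, then the
combinations of values at distance at most `B` from `e` differ by at most `#I * η * B`. -/
lemma sum_ofReal_mul_le {I : Finset ℕ} {φ ψ : ℕ → ℝ} (hφ : ∀ i, 0 ≤ φ i) (hψ : ∀ i, 0 ≤ ψ i)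
    (hsum : ∑ i ∈ I, φ i = ∑ i ∈ I, ψ i) {η : ℝ} (hη : ∀ i, |φ i - ψ i| ≤ η) {a : ℕ → ℝ≥0∞}
    {e B : ℝ≥0∞} (he : e ≠ ⊤) (hB : B ≠ ⊤) (h1 : ∀ i ∈ I, a i ≤ e + B)
    (h2 : ∀ i ∈ I, e ≤ a i + B) :
    ∑ i ∈ I, ENNReal.ofReal (φ i) * a i ≤
      ∑ i ∈ I, ENNReal.ofReal (ψ i) * a i + I.card * (ENNReal.ofReal η * B) := by
  have hη0 : 0 ≤ η := (abs_nonneg _).trans (hη 0)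
  have ha : ∀ i ∈ I, a i ≠ ⊤ := fun i hi => ne_top_of_le_ne_top (by simp [he, hB]) (h1 i hi)
  have hofReal : ∀ θ : ℕ → ℝ, (∀ i, 0 ≤ θ i) →
      ∑ i ∈ I, ENNReal.ofReal (θ i) * a i = ENNReal.ofReal (∑ i ∈ I, θ i * (a i).toReal) := by
    intro θ hθ
    rw [ENNReal.ofReal_sum_of_nonneg fun i _ => mul_nonneg (hθ i) ENNReal.toReal_nonneg]
    refine Finset.sum_congr rfl fun i hi => ?_
    rw [ENNReal.ofReal_mul (hθ i), ENNReal.ofReal_toReal (ha i hi)]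
  have hcard : (I.card : ℝ≥0∞) * (ENNReal.ofReal η * B) =
      ENNReal.ofReal (I.card * (η * B.toReal)) := by
    rw [ENNReal.ofReal_mul (by positivity), ENNReal.ofReal_mul hη0, ENNReal.ofReal_toReal hB,
      ENNReal.ofReal_natCast]
  rw [hofReal φ hφ, hofReal ψ hψ, hcard, ← ENNReal.ofReal_add
    (Finset.sum_nonneg fun i _ => mul_nonneg (hψ i) ENNReal.toReal_nonneg) (by positivity)]
  refine ENNReal.ofReal_le_ofReal ?_
  have hterm : ∀ i ∈ I, (φ i - ψ i) * ((a i).toReal - e.toReal) ≤ η * B.toReal := by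
    intro i hi
    have h3 : |(a i).toReal - e.toReal| ≤ B.toReal := by
      have h4 := ENNReal.toReal_mono (by simp [he, hB]) (h1 i hi)
      have h5 := ENNReal.toReal_mono (by simp [ha i hi, hB]) (h2 i hi)
      rw [ENNReal.toReal_add he hB] at h4
      rw [ENNReal.toReal_add (ha i hi) hB] at h5
      rw [abs_le]; constructor <;> linarith
    calc (φ i - ψ i) * ((a i).toReal - e.toReal) ≤ |φ i - ψ i| * |(a i).toReal - e.toReal| := by
          rw [← abs_mul]; exact le_abs_self _
      _ ≤ _ := mul_le_mul (hη i) h3 (abs_nonneg _) hη0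
  have hs := Finset.sum_le_card_nsmul I _ _ hterm
  have hexp : ∑ i ∈ I, (φ i - ψ i) * ((a i).toReal - e.toReal) =
      ∑ i ∈ I, φ i * (a i).toReal - ∑ i ∈ I, ψ i * (a i).toReal := by
    have : ∑ i ∈ I, (φ i - ψ i) * e.toReal = 0 := by
      rw [← Finset.sum_mul, Finset.sum_sub_distrib, hsum, sub_self, zero_mul]
    simp_rw [mul_sub]
    rw [Finset.sum_sub_distrib, this, sub_zero]
    simp only [Finset.sum_sub_distrib, sub_mul]
  rw [hexp, nsmul_eq_mul] at hs
  linarith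

variable [MetricSpace X]

lemma DiscreteMaxData.tsum_ofReal_φ (D : DiscreteMaxData X) {r : ℚ} (hr : 0 < r) (x : X) :
    ∑' i, ENNReal.ofReal (D.φ r i x) = 1 := by
  have hsum : Summable fun i => D.φ r i x := by
    by_contra h
    simpa [tsum_eq_zero_of_not_summable h] using D.φ_sum r hr x
  rw [← ENNReal.ofReal_tsum_of_nonneg (fun i => D.φ_nonneg r i x) hsum, D.φ_sum r hr x,
    ENNReal.ofReal_one]

lemma DiscreteMaxData.exists_active (D : DiscreteMaxData X) {r : ℚ} (hr : 0 < r) (x : X) :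
    ∃ I : Finset ℕ, I.card ≤ D.N ∧ ∀ i, i ∈ I ↔ x ∈ ball (D.center r i) (6 * (r : ℝ)) := by
  classical
  obtain ⟨hf, hcard⟩ := ENNReal.finset_card_const_le_le_of_tsum_le
    (ENNReal.natCast_ne_top D.N) (D.overlap r hr x) one_ne_zero
  refine ⟨hf.toFinset, ?_, fun i => ?_⟩
  · rw [div_one] at hcard
    exact_mod_cast hcard
  · by_cases h : x ∈ ball (D.center r i) (6 * (r : ℝ)) <;> simp only [Set.Finite.mem_toFinset, Set.mem_ofPred_eq,
      Set.indicator, h, if_true, if_false] <;> simp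

variable [MeasurableSpace X]

/-- The discrete convolution of `|u|` at scale `3 r`. -/
noncomputable def DiscreteMaxData.conv (D : DiscreteMaxData X) (μ : Measure X) (u : X → ℝ)
    (r : ℚ) (x : X) : ℝ≥0∞ :=
  ∑' i : ℕ, ENNReal.ofReal (D.φ r i x) * avg μ (fun y => ‖u y‖ₑ) (D.center r i) (3 * (r : ℝ))

lemma DiscreteMaxData.dMax_eq (D : DiscreteMaxData X) (μ : Measure X) (α : ℝ) (u : X → ℝ) (x : X) :
    D.dMax μ α u x = ⨆ (r : ℚ) (_ : 0 < r), ENNReal.ofReal ((r : ℝ) ^ α) * D.conv μ u r x := rfl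

lemma DiscreteMaxData.le_dMax (D : DiscreteMaxData X) (μ : Measure X) (α : ℝ) (u : X → ℝ) (x : X)
    {r : ℚ} (hr : 0 < r) : ENNReal.ofReal ((r : ℝ) ^ α) * D.conv μ u r x ≤ D.dMax μ α u x :=
  le_iSup₂_of_le r hr le_rfl

/-- A dyadic radius comparable to `10 r`. -/
lemma exists_dyadic_radius {r : ℝ} (hr : 0 < r) :
    ∃ l : ℤ, 10 * r < (2 : ℝ) ^ (-l) ∧ (2 : ℝ) ^ (-l) ≤ 20 * r := by
  obtain ⟨n, hn, hn'⟩ := exists_mem_Ico_zpow (show 0 < 10 * r by linarith) (one_lt_two (α := ℝ))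
  refine ⟨-(n + 1), by simpa using hn', ?_⟩
  rw [neg_neg, zpow_add₀ two_ne_zero, zpow_one]
  linarith

variable [BorelSpace X] {μ : Measure X} {c Q : ℝ}

lemma IsRegular.avg_enorm_le (hμ : IsRegular μ c Q) (u : X → ℝ) (x : X)
    {r : ℝ} (hr : 0 < r) (d : ℝ) :
    avg μ (fun z => ‖u z‖ₑ) x r ≤ ‖d‖ₑ + avg μ (fun z => ‖u z - d‖ₑ) x r := by
  rw [← hμ.avg_const ‖d‖ₑ x hr, ← avg_add aemeasurable_const]
  refine avg_mono (fun z => ?_) _ _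
  calc ‖u z‖ₑ = ‖d + (u z - d)‖ₑ := by congr 1; ring
    _ ≤ _ := enorm_add_le _ _

lemma IsRegular.enorm_le_avg (hμ : IsRegular μ c Q) {u : X → ℝ} (hu : AEMeasurable u μ) (x : X)
    {r : ℝ} (hr : 0 < r) (d : ℝ) :
    ‖d‖ₑ ≤ avg μ (fun z => ‖u z‖ₑ) x r + avg μ (fun z => ‖u z - d‖ₑ) x r := by
  rw [← hμ.avg_const ‖d‖ₑ x hr, ← avg_add hu.enorm]
  refine avg_mono (fun z => ?_) _ _
  calc ‖d‖ₑ = ‖u z - (u z - d)‖ₑ := by congr 1; ring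
    _ ≤ _ := enorm_sub_le

variable (D : DiscreteMaxData X)

lemma IsRegular.avg_center_le (hμ : IsRegular μ c Q) {r : ℚ} (hr : 0 < r) {l : ℤ}
    (hl : 10 * (r : ℝ) < 2 ^ (-l)) (hl' : (2 : ℝ) ^ (-l) ≤ 20 * r) {x w : X} (hxw : dist x w ≤ r)
    {i : ℕ} (hi : x ∈ ball (D.center r i) (6 * (r : ℝ))) (f : X → ℝ≥0∞) :
    avg μ f (D.center r i) (3 * (r : ℝ)) ≤ ratioConst c Q 7 * avg μ f w (2 ^ (-l)) := by
  have hr' : (0 : ℝ) < r := by exact_mod_cast hr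
  refine hμ.avg_le_avg (by linarith) (by linarith) (by linarith) ?_ f
  have := dist_triangle (D.center r i) x w
  rw [mem_ball, dist_comm] at hi
  linarith

lemma IsRegular.conv_le (hμ : IsRegular μ c Q) (u : X → ℝ) {r : ℚ} (hr : 0 < r) {l : ℤ}
    (hl : 10 * (r : ℝ) < 2 ^ (-l)) (hl' : (2 : ℝ) ^ (-l) ≤ 20 * r) (x : X) (d : ℝ) :
    D.conv μ u r x ≤ ‖d‖ₑ + ratioConst c Q 7 * avg μ (fun z => ‖u z - d‖ₑ) x (2 ^ (-l)) := by
  have hr' : (0 : ℝ) < r := by exact_mod_cast hr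
  calc D.conv μ u r x ≤ ∑' i, ENNReal.ofReal (D.φ r i x) *
        (‖d‖ₑ + ratioConst c Q 7 * avg μ (fun z => ‖u z - d‖ₑ) x (2 ^ (-l))) := by
        refine ENNReal.tsum_le_tsum fun i => ?_
        by_cases hi : x ∈ ball (D.center r i) (6 * (r : ℝ))
        · refine mul_le_mul_right ((hμ.avg_enorm_le u _ (by linarith) d).trans ?_) _
          gcongr
          exact hμ.avg_center_le D hr hl hl' (by simpa using hr'.le) hi _
        · simp [D.φ_supp r hr i x hi]
    _ = _ := by rw [ENNReal.tsum_mul_right, D.tsum_ofReal_φ hr, one_mul]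

lemma IsRegular.enorm_le_conv (hμ : IsRegular μ c Q) {u : X → ℝ} (hu : AEMeasurable u μ)
    {r : ℚ} (hr : 0 < r) {l : ℤ} (hl : 10 * (r : ℝ) < 2 ^ (-l)) (hl' : (2 : ℝ) ^ (-l) ≤ 20 * r)
    (x : X) (d : ℝ) :
    ‖d‖ₑ ≤ D.conv μ u r x + ratioConst c Q 7 * avg μ (fun z => ‖u z - d‖ₑ) x (2 ^ (-l)) := by
  have hr' : (0 : ℝ) < r := by exact_mod_cast hr
  set A := ratioConst c Q 7 * avg μ (fun z => ‖u z - d‖ₑ) x (2 ^ (-l)) with hA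
  calc ‖d‖ₑ = ∑' i, ENNReal.ofReal (D.φ r i x) * ‖d‖ₑ := by
        rw [ENNReal.tsum_mul_right, D.tsum_ofReal_φ hr, one_mul]
    _ ≤ ∑' i, (ENNReal.ofReal (D.φ r i x) *
          avg μ (fun y => ‖u y‖ₑ) (D.center r i) (3 * (r : ℝ)) +
          ENNReal.ofReal (D.φ r i x) * A) := by
        refine ENNReal.tsum_le_tsum fun i => ?_
        by_cases hi : x ∈ ball (D.center r i) (6 * (r : ℝ))
        · rw [← mul_add]
          refine mul_le_mul_right ((hμ.enorm_le_avg hu (D.center r i)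
            (by linarith : 0 < 3 * (r : ℝ)) d).trans ?_) _
          gcongr
          exact hμ.avg_center_le D hr hl hl' (by simpa using hr'.le) hi _
        · simp [D.φ_supp r hr i x hi]
    _ = _ := by rw [ENNReal.tsum_add, ENNReal.tsum_mul_right, D.tsum_ofReal_φ hr, one_mul]; rfl

lemma IsRegular.conv_le_conv_add (hμ : IsRegular μ c Q) {u : X → ℝ} (hu : AEMeasurable u μ)
    {r : ℚ} (hr : 0 < r) {l : ℤ} (hl : 10 * (r : ℝ) < 2 ^ (-l)) (hl' : (2 : ℝ) ^ (-l) ≤ 20 * r)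
    {x y w : X} (hxw : dist x w ≤ r) (hyw : dist y w ≤ r) {ρ : ℝ} (hρ : 0 < ρ)
    (hxy : dist x y ≤ ρ) (d : ℝ) :
    D.conv μ u r x ≤ D.conv μ u r y + (2 * D.N + 1) * (ENNReal.ofReal (D.L / r * ρ) *
      (ratioConst c Q 7 * avg μ (fun z => ‖u z - d‖ₑ) w (2 ^ (-l)))) := by
  classical
  have hr' : (0 : ℝ) < r := by exact_mod_cast hr
  have hLr : 0 < D.L / r * ρ := mul_pos (div_pos D.L_pos hr') hρ
  set B := ratioConst c Q 7 * avg μ (fun z => ‖u z - d‖ₑ) w (2 ^ (-l)) with hB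
  rcases eq_or_ne B ⊤ with hBt | hBt
  · rw [hBt, ENNReal.mul_top (by simpa using hLr), ENNReal.mul_top (by simp)]
    simp
  obtain ⟨Ix, hIx, hIx'⟩ := D.exists_active hr x
  obtain ⟨Iy, hIy, hIy'⟩ := D.exists_active hr y
  set I := Ix ∪ Iy with hI
  have hcard : (I.card : ℝ≥0∞) ≤ 2 * D.N + 1 := by
    have : I.card ≤ 2 * D.N + 1 := (Finset.card_union_le _ _).trans (by omega)
    exact_mod_cast this
  have h0x : ∀ i ∉ I, D.φ r i x = 0 := fun i hi =>
    D.φ_supp r hr i x fun h => hi (Finset.mem_union_left _ ((hIx' i).2 h))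
  have h0y : ∀ i ∉ I, D.φ r i y = 0 := fun i hi =>
    D.φ_supp r hr i y fun h => hi (Finset.mem_union_right _ ((hIy' i).2 h))
  have hmain : ∀ i ∈ I, avg μ (fun z => ‖u z - d‖ₑ) (D.center r i) (3 * (r : ℝ)) ≤ B := by
    intro i hi
    rcases Finset.mem_union.1 hi with hi | hi
    · exact hμ.avg_center_le D hr hl hl' hxw ((hIx' i).1 hi) _
    · exact hμ.avg_center_le D hr hl hl' hyw ((hIy' i).1 hi) _
  have hsum : ∑ i ∈ I, D.φ r i x = ∑ i ∈ I, D.φ r i y :=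
    (tsum_eq_sum h0x).symm.trans (((D.φ_sum r hr x).trans (D.φ_sum r hr y).symm).trans
      (tsum_eq_sum h0y))
  have key := sum_ofReal_mul_le (fun i => D.φ_nonneg r i x) (fun i => D.φ_nonneg r i y) hsum
    (η := D.L / r * ρ) (fun i => by
      have := (D.φ_lip r hr i).dist_le_mul x y
      rw [Real.dist_eq, Real.coe_toNNReal _ (div_pos D.L_pos hr').le] at this
      exact this.trans (by gcongr; exact (div_pos D.L_pos hr').le))
    (a := fun i => avg μ (fun y => ‖u y‖ₑ) (D.center r i) (3 * (r : ℝ))) (e := ‖d‖ₑ) (by simp) hBt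
    (fun i hi => (hμ.avg_enorm_le u _ (by linarith) d).trans (by gcongr; exact hmain i hi))
    (fun i hi => (hμ.enorm_le_avg hu (D.center r i) (by linarith : 0 < 3 * (r : ℝ)) d).trans
      (by gcongr; exact hmain i hi))
  rw [DiscreteMaxData.conv, DiscreteMaxData.conv, tsum_eq_sum (s := I), tsum_eq_sum (s := I)]
  · refine key.trans ?_
    gcongr
  · intro i hi; simp [h0y i hi]
  · intro i hi; simp [h0x i hi]

end DiscreteConvolution

section MaximalEstimate

lemma ofReal_two_rpow (x : ℝ) : ENNReal.ofReal ((2 : ℝ) ^ x) = (2 : ℝ≥0∞) ^ x := by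
  rw [← ENNReal.ofReal_rpow_of_pos two_pos]; simp

lemma two_rpow_mul_two_rpow (x y : ℝ) : (2 : ℝ≥0∞) ^ x * 2 ^ y = 2 ^ (x + y) :=
  (ENNReal.rpow_add _ _ two_ne_zero ofNat_ne_top).symm

lemma two_rpow_ne_top (x : ℝ) : (2 : ℝ≥0∞) ^ x ≠ ⊤ := by simp [ENNReal.rpow_eq_top_iff]

lemma tailSum_le_dyadicSum {δ s : ℝ} (hδ : 0 ≤ δ) (hδs : δ ≤ s) (β : ℤ → X → ℝ≥0∞) {k l : ℤ}
    (hl : k - 4 ≤ l) (x : X) :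
    tailSum (fun j => (2 : ℝ≥0∞) ^ (-(j * s)) * β j x) l ≤
      2 ^ (8 * s) * ((2 : ℝ≥0∞) ^ (-(k * s)) * dyadicSum δ 1 β k x) := by
  rw [dyadicSum, tailSum, ← ENNReal.tsum_mul_left, ← ENNReal.tsum_mul_left]
  refine ENNReal.tsum_le_tsum fun j => ?_
  split_ifs with hj
  · have hj' : (k : ℝ) - 4 ≤ j := by exact_mod_cast hl.trans hj
    rw [ENNReal.rpow_one, ← mul_assoc, ← mul_assoc, two_rpow_mul_two_rpow, two_rpow_mul_two_rpow]
    gcongr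
    · exact one_le_two
    · have habs : |(j : ℝ) - k| ≤ (j - k) + 8 := by
        rw [abs_le]; constructor <;> linarith
      have h1 := mul_le_mul_of_nonneg_right hδs (abs_nonneg ((j : ℝ) - k))
      have h2 := mul_le_mul_of_nonneg_left habs (hδ.trans hδs)
      nlinarith
  · exact zero_le

/-- The scale factor of the large-scale estimate. -/
lemma ofReal_scale_le {α s δ L r : ℝ} (hα : 0 ≤ α) (hδ : δ ≤ 1 - (s + α)) (hsα : s + α < 1)
    (hs : 0 < s) (hL : 0 < L) (hr : 0 < r) {k l : ℤ} (hlk : l ≤ k)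
    (hl' : (2 : ℝ) ^ (-l) ≤ 20 * r) :
    ENNReal.ofReal (r ^ α) * (ENNReal.ofReal (L / r * 2 ^ (-k)) * (2 : ℝ≥0∞) ^ (-(l * s))) ≤
      ENNReal.ofReal (20 * L) *
        ((2 : ℝ≥0∞) ^ (-(k * (s + α))) * (2 : ℝ≥0∞) ^ (-(δ * |(l : ℝ) - k|))) := by
  have hlk' : (l : ℝ) ≤ k := by exact_mod_cast hlk
  rw [← ofReal_two_rpow, ← ofReal_two_rpow, ← ofReal_two_rpow, ← ENNReal.ofReal_mul (by positivity),
    ← ENNReal.ofReal_mul (by positivity), ← ENNReal.ofReal_mul (by positivity),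
    ← ENNReal.ofReal_mul (by positivity)]
  refine ENNReal.ofReal_le_ofReal ?_
  have h1 : r ^ α / r ≤ 20 * (2 : ℝ) ^ (l * (1 - α)) := by
    have hα1 : 0 ≤ 1 - α := by linarith
    have h2 : ((2 : ℝ) ^ (-l)) ^ (1 - α) ≤ (20 * r) ^ (1 - α) :=
      Real.rpow_le_rpow (by positivity) hl' hα1
    rw [← Real.rpow_intCast, ← Real.rpow_mul two_pos.le, Real.mul_rpow (by norm_num) hr.le] at h2
    have h3 : (20 : ℝ) ^ (1 - α) ≤ 20 := by
      calc (20 : ℝ) ^ (1 - α) ≤ 20 ^ (1 : ℝ) :=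
            Real.rpow_le_rpow_of_exponent_le (by norm_num) (by linarith)
        _ = 20 := Real.rpow_one _
    have h4 : r ^ α / r = (r ^ (1 - α))⁻¹ := by
      rw [← Real.rpow_neg hr.le, neg_sub, Real.rpow_sub hr, Real.rpow_one]
    have h5 : (2 : ℝ) ^ (l * (1 - α)) = ((2 : ℝ) ^ (((-l : ℤ) : ℝ) * (1 - α)))⁻¹ := by
      rw [← Real.rpow_neg two_pos.le]; push_cast; ring_nf
    have hpos : 0 < r ^ (1 - α) := by positivity
    rw [h4, h5, ← div_eq_mul_inv, inv_eq_one_div, div_le_div_iff₀ hpos (by positivity), one_mul]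
    exact h2.trans (by gcongr)
  calc r ^ α * (L / r * 2 ^ (-k) * 2 ^ (-(l * s)))
      = L * (r ^ α / r) * 2 ^ (-k) * 2 ^ (-(l * s)) := by ring
    _ ≤ L * (20 * (2 : ℝ) ^ (l * (1 - α))) * 2 ^ (-k) * 2 ^ (-(l * s)) := by gcongr
    _ = 20 * L * 2 ^ (l * (1 - α) + ((-k : ℤ) : ℝ) + -(l * s)) := by
        rw [Real.rpow_add two_pos, Real.rpow_add two_pos, Real.rpow_intCast]; ring
    _ ≤ 20 * L * (2 ^ (-(k * (s + α))) * 2 ^ (-(δ * |(l : ℝ) - k|))) := by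
        rw [← Real.rpow_add two_pos]
        refine mul_le_mul_of_nonneg_left
          (Real.rpow_le_rpow_of_exponent_le one_le_two ?_) (by positivity)
        rw [abs_of_nonpos (by linarith)]
        have := mul_le_mul_of_nonneg_right hδ (sub_nonneg.2 hlk')
        push_cast
        nlinarith

variable [MetricSpace X] [MeasurableSpace X] [BorelSpace X] {μ : Measure X} {c Q : ℝ}
  (D : DiscreteMaxData X)

/-- The estimate of the discrete convolution at scales larger than the distance of the points. -/
lemma IsRegular.conv_le_of_le (hμ : IsRegular μ c Q) {s α δ : ℝ} (hs : 0 < s) (hα : 0 ≤ α)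
    (hsα : s + α < 1) (hδ : δ ≤ 1 - (s + α)) {u : X → ℝ} (hu : AEMeasurable u μ)
    {β : ℤ → X → ℝ≥0∞} {w : X} (h : ∀ l : ℤ, ∃ d : ℝ,
      avg μ (fun z => ‖u z - d‖ₑ) w (2 ^ (-l)) ≤ (2 : ℝ≥0∞) ^ (-(l * s)) * β l w)
    {r : ℚ} (hr : 0 < r) {k : ℤ} (hkr : (2 : ℝ) ^ (-k) ≤ r) {x y : X}
    (hxw : dist x w ≤ r) (hyw : dist y w ≤ r) (hxy : dist x y < 2 ^ (-k)) :
    ENNReal.ofReal ((r : ℝ) ^ α) * D.conv μ u r x ≤ ENNReal.ofReal ((r : ℝ) ^ α) * D.conv μ u r y +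
      (2 * D.N + 1) * ratioConst c Q 7 * ENNReal.ofReal (20 * D.L) *
        ((2 : ℝ≥0∞) ^ (-(k * (s + α))) * dyadicSum δ 1 β k w) := by
  have hr' : (0 : ℝ) < r := by exact_mod_cast hr
  obtain ⟨l, hl, hl'⟩ := exists_dyadic_radius hr'
  obtain ⟨d, hd⟩ := h l
  have hlk : l ≤ k := by
    have h1 : (2 : ℝ) ^ (-k) < 2 ^ (-l) := by linarith
    have := (zpow_lt_zpow_iff_right₀ (one_lt_two (α := ℝ))).1 h1
    omega
  have h1 := hμ.conv_le_conv_add D hu hr hl hl' hxw hyw (ρ := 2 ^ (-k)) (by positivity) hxy.le d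
  have h2 := ofReal_scale_le hα hδ hsα hs D.L_pos hr' hlk hl'
  calc ENNReal.ofReal ((r : ℝ) ^ α) * D.conv μ u r x
      ≤ ENNReal.ofReal ((r : ℝ) ^ α) * (D.conv μ u r y + (2 * D.N + 1) *
          (ENNReal.ofReal (D.L / r * 2 ^ (-k)) *
            (ratioConst c Q 7 * ((2 : ℝ≥0∞) ^ (-(l * s)) * β l w)))) := by
        refine mul_le_mul_right (h1.trans ?_) _
        gcongr
    _ = ENNReal.ofReal ((r : ℝ) ^ α) * D.conv μ u r y + (2 * D.N + 1) * ratioConst c Q 7 *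
          (ENNReal.ofReal ((r : ℝ) ^ α) * (ENNReal.ofReal (D.L / r * 2 ^ (-k)) *
            (2 : ℝ≥0∞) ^ (-(l * s)))) * β l w := by ring
    _ ≤ ENNReal.ofReal ((r : ℝ) ^ α) * D.conv μ u r y + (2 * D.N + 1) * ratioConst c Q 7 *
          (ENNReal.ofReal (20 * D.L) *
            ((2 : ℝ≥0∞) ^ (-(k * (s + α))) * (2 : ℝ≥0∞) ^ (-(δ * |(l : ℝ) - k|)))) * β l w := by
        gcongr
    _ = ENNReal.ofReal ((r : ℝ) ^ α) * D.conv μ u r y + (2 * D.N + 1) * ratioConst c Q 7 *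
          ENNReal.ofReal (20 * D.L) * ((2 : ℝ≥0∞) ^ (-(k * (s + α))) *
            ((2 : ℝ≥0∞) ^ (-(δ * |(l : ℝ) - k|)) * β l w ^ (1 : ℝ))) := by
        rw [ENNReal.rpow_one]; ring
    _ ≤ _ := by
        gcongr
        exact le_dyadicSum _ _ _ _ _ _

lemma dyadic_radius_index {r : ℝ} {k l : ℤ} (hrk : r < 2 ^ (-k)) (hl' : (2 : ℝ) ^ (-l) ≤ 20 * r) :
    k - 4 ≤ l := by
  have h1 : (2 : ℝ) ^ (-l) < 2 ^ (5 - k) := by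
    have : (2 : ℝ) ^ (5 - k) = 32 * 2 ^ (-k) := by
      rw [sub_eq_add_neg, zpow_add₀ two_ne_zero]; norm_num
    have h0 : (0 : ℝ) < 2 ^ (-k) := by positivity
    linarith
  have := (zpow_lt_zpow_iff_right₀ (one_lt_two (α := ℝ))).1 h1
  omega

/-- Average oscillation around a Lebesgue point in terms of the two-sided weighted sums. -/
lemma IsRegular.avg_enorm_sub_le_dyadicSum (hμ : IsRegular μ c Q) {s δ : ℝ} (hδ : 0 ≤ δ)
    (hδs : δ ≤ s) {u : X → ℝ} (hu : AEMeasurable u μ) {β : ℤ → X → ℝ≥0∞} {x : X}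
    (hx : IsLebesguePoint μ u x) (h : ∀ l : ℤ, ∃ d : ℝ,
      avg μ (fun z => ‖u z - d‖ₑ) x (2 ^ (-l)) ≤ (2 : ℝ≥0∞) ^ (-(l * s)) * β l x)
    {k l : ℤ} (hl : k - 4 ≤ l) :
    avg μ (fun z => ‖u z - u x‖ₑ) x (2 ^ (-l)) ≤
      (1 + 3 * (2 * (ratioConst c Q 2 + 1))) * 2 ^ (8 * s) *
        ((2 : ℝ≥0∞) ^ (-(k * s)) * dyadicSum δ 1 β k x) := by
  rw [mul_assoc]
  exact (hμ.avg_enorm_sub_le_tailSum hu hx h l).trans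
    (mul_le_mul_right (tailSum_le_dyadicSum hδ hδs β hl x) _)

/-- The estimate of the discrete convolution at scales smaller than the distance of the points. -/
lemma IsRegular.conv_le_of_lt (hμ : IsRegular μ c Q) {s δ : ℝ} (hδ : 0 ≤ δ)
    (hδs : δ ≤ s) {u : X → ℝ} (hu : AEMeasurable u μ) {β : ℤ → X → ℝ≥0∞} {x y : X}
    (hx : IsLebesguePoint μ u x) (hy : IsLebesguePoint μ u y) (h : ∀ (l : ℤ) (x : X), ∃ d : ℝ,
      avg μ (fun z => ‖u z - d‖ₑ) x (2 ^ (-l)) ≤ (2 : ℝ≥0∞) ^ (-(l * s)) * β l x)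
    {r : ℚ} (hr : 0 < r) {k : ℤ} (hrk : (r : ℝ) < 2 ^ (-k)) (hxy : dist x y < 2 ^ (-k)) :
    D.conv μ u r x ≤ D.conv μ u r y +
      (ratioConst c Q 2 + 1 + ratioConst c Q 7) *
      ((1 + 3 * (2 * (ratioConst c Q 2 + 1))) * 2 ^ (8 * s)) *
      ((2 : ℝ≥0∞) ^ (-(k * s)) * (dyadicSum δ 1 β k x + dyadicSum δ 1 β k y)) := by
  have hr' : (0 : ℝ) < r := by exact_mod_cast hr
  obtain ⟨l, hl, hl'⟩ := exists_dyadic_radius hr'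
  have hkl := dyadic_radius_index hrk hl'
  set K := (1 + 3 * (2 * (ratioConst c Q 2 + 1))) * (2 : ℝ≥0∞) ^ (8 * s) with hK
  set Z := (2 : ℝ≥0∞) ^ (-(k * s)) with hZ
  have hax := fun (m : ℤ) (hm : k - 4 ≤ m) =>
    hμ.avg_enorm_sub_le_dyadicSum hδ hδs hu hx (fun l => h l x) hm
  have hay := fun (m : ℤ) (hm : k - 4 ≤ m) =>
    hμ.avg_enorm_sub_le_dyadicSum hδ hδs hu hy (fun l => h l y) hm
  set Tx := dyadicSum δ 1 β k x with hTx
  set Ty := dyadicSum δ 1 β k y with hTy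
  calc D.conv μ u r x ≤ ‖u x‖ₑ + ratioConst c Q 7 * (K * (Z * Tx)) :=
        (hμ.conv_le D u hr hl hl' x (u x)).trans (by gcongr; exact hax l hkl)
    _ ≤ (‖u y‖ₑ + ‖u x - u y‖ₑ) + ratioConst c Q 7 * (K * (Z * Tx)) := by
        gcongr
        calc ‖u x‖ₑ = ‖u y + (u x - u y)‖ₑ := by congr 1; ring
          _ ≤ _ := enorm_add_le _ _
    _ ≤ ((D.conv μ u r y + ratioConst c Q 7 * (K * (Z * Ty))) +
          (ratioConst c Q 2 * (K * (Z * Tx)) + K * (Z * Ty))) +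
          ratioConst c Q 7 * (K * (Z * Tx)) := by
        gcongr
        · exact (hμ.enorm_le_conv D hu hr hl hl' y (u y)).trans (by gcongr; exact hay l hkl)
        · refine (hμ.enorm_sub_le_avg_add_avg hu hxy).trans ?_
          gcongr
          · exact hax _ (by omega)
          · exact hay _ (by omega)
    _ = D.conv μ u r y + ((ratioConst c Q 2 + ratioConst c Q 7) * (K * (Z * Tx)) +
          (1 + ratioConst c Q 7) * (K * (Z * Ty))) := by ring
    _ ≤ D.conv μ u r y + ((ratioConst c Q 2 + 1 + ratioConst c Q 7) * (K * (Z * Tx)) +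
          (ratioConst c Q 2 + 1 + ratioConst c Q 7) * (K * (Z * Ty))) := by
        gcongr
        · exact le_self_add
        · exact le_add_self
    _ = _ := by ring

lemma ofReal_rpow_le {r α : ℝ} (hr : 0 < r) (hα : 0 ≤ α) {k : ℤ} (hrk : r < 2 ^ (-k)) :
    ENNReal.ofReal (r ^ α) ≤ (2 : ℝ≥0∞) ^ (-(k * α)) := by
  rw [← ofReal_two_rpow]
  refine ENNReal.ofReal_le_ofReal ((Real.rpow_le_rpow hr.le hrk.le hα).trans_eq ?_)
  rw [← Real.rpow_intCast, ← Real.rpow_mul two_pos.le]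
  push_cast
  ring_nf

/-- Pointwise estimate of the discrete fractional maximal function at Lebesgue points. -/
lemma IsRegular.exists_dMax_le (hμ : IsRegular μ c Q) {s α δ : ℝ} (hs : 0 < s) (hα : 0 ≤ α)
    (hsα : s + α < 1) (hδ : 0 ≤ δ) (hδs : δ ≤ s) (hδ' : δ ≤ 1 - (s + α)) :
    ∃ C : ℝ≥0∞, C ≠ ⊤ ∧ ∀ (u : X → ℝ) (β : ℤ → X → ℝ≥0∞), AEMeasurable u μ →
      (∀ (l : ℤ) (x : X), ∃ d : ℝ,
        avg μ (fun z => ‖u z - d‖ₑ) x (2 ^ (-l)) ≤ (2 : ℝ≥0∞) ^ (-(l * s)) * β l x) →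
      ∀ (k : ℤ) (x y : X), IsLebesguePoint μ u x → IsLebesguePoint μ u y → dist x y < 2 ^ (-k) →
        D.dMax μ α u x ≤ D.dMax μ α u y + C * ((2 : ℝ≥0∞) ^ (-(k * (s + α))) *
          (dyadicSum δ 1 β k x + dyadicSum δ 1 β k y)) := by
  set C₁ : ℝ≥0∞ := (2 * D.N + 1) * ratioConst c Q 7 * ENNReal.ofReal (20 * D.L) with hC₁
  set C₂ : ℝ≥0∞ := (ratioConst c Q 2 + 1 + ratioConst c Q 7) *
      ((1 + 3 * (2 * (ratioConst c Q 2 + 1))) * 2 ^ (8 * s)) with hC₂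
  have hC₁t : C₁ ≠ ⊤ := by
    have := ratioConst_ne_top c Q 7
    finiteness
  have hC₂t : C₂ ≠ ⊤ := by
    have h7 := ratioConst_ne_top c Q 7
    have h2 := ratioConst_ne_top c Q 2
    have := two_rpow_ne_top (8 * s)
    finiteness
  refine ⟨C₁ + C₂, by finiteness, ?_⟩
  intro u β hu h k x y hx hy hxy
  rw [D.dMax_eq μ α u x]
  refine iSup₂_le fun r hr => ?_
  have hr' : (0 : ℝ) < r := by exact_mod_cast hr
  rcases lt_or_ge (r : ℝ) (2 ^ (-k)) with hrk | hrk
  · calc ENNReal.ofReal ((r : ℝ) ^ α) * D.conv μ u r x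
        ≤ ENNReal.ofReal ((r : ℝ) ^ α) * (D.conv μ u r y + C₂ * ((2 : ℝ≥0∞) ^ (-(k * s)) *
            (dyadicSum δ 1 β k x + dyadicSum δ 1 β k y))) :=
          mul_le_mul_right (hμ.conv_le_of_lt D hδ hδs hu hx hy h hr hrk hxy) _
      _ = ENNReal.ofReal ((r : ℝ) ^ α) * D.conv μ u r y + C₂ * (ENNReal.ofReal ((r : ℝ) ^ α) *
            (2 : ℝ≥0∞) ^ (-(k * s)) * (dyadicSum δ 1 β k x + dyadicSum δ 1 β k y)) := by ring
      _ ≤ D.dMax μ α u y + (C₁ + C₂) * ((2 : ℝ≥0∞) ^ (-(k * α)) *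
            (2 : ℝ≥0∞) ^ (-(k * s)) * (dyadicSum δ 1 β k x + dyadicSum δ 1 β k y)) := by
          gcongr
          · exact D.le_dMax μ α u y hr
          · exact le_add_self
          · exact ofReal_rpow_le hr' hα hrk
      _ = _ := by rw [two_rpow_mul_two_rpow]; ring_nf
  · refine (hμ.conv_le_of_le D hs hα hsα hδ' hu (fun l => h l x) hr hrk (x := x) (y := y)
      (by simpa using hr'.le) (by rw [dist_comm]; linarith) hxy).trans ?_
    gcongr
    · exact D.le_dMax μ α u y hr
    · exact le_self_add
    · exact le_self_add

/-- Finiteness of the discrete fractional maximal function at good points. -/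
lemma IsRegular.dMax_ne_top (hμ : IsRegular μ c Q) {s α δ : ℝ} (hs : 0 < s) (hα : 0 ≤ α)
    (hsα : s + α < 1) (hδ : 0 ≤ δ) (hδs : δ ≤ s) (hδ' : δ ≤ 1 - (s + α)) {u : X → ℝ}
    {β : ℤ → X → ℝ≥0∞} (hu : AEMeasurable u μ) {x x₀ : X} (h : ∀ l : ℤ, ∃ d : ℝ,
      avg μ (fun z => ‖u z - d‖ₑ) x (2 ^ (-l)) ≤ (2 : ℝ≥0∞) ^ (-(l * s)) * β l x)
    (hx : IsLebesguePoint μ u x) (hβ : ∀ k, dyadicSum δ 1 β k x ≠ ⊤)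
    (hx₀ : D.dMax μ α u x₀ ≠ ⊤) : D.dMax μ α u x ≠ ⊤ := by
  obtain ⟨n, hn⟩ := pow_unbounded_of_one_lt (dist x x₀) (one_lt_two (α := ℝ))
  obtain ⟨k, hk⟩ : ∃ k : ℤ, dist x x₀ < 2 ^ (-k) := ⟨-n, by simpa using hn⟩
  have h2 := ratioConst_ne_top c Q 2
  have h7 := ratioConst_ne_top c Q 7
  have h2p := two_rpow_ne_top
  have hβk := hβ k
  have hD := two_rpow_ne_top (-(k * (s + α)))
  refine ne_top_of_le_ne_top (b := (D.dMax μ α u x₀ + (2 * D.N + 1) * ratioConst c Q 7 *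
      ENNReal.ofReal (20 * D.L) * ((2 : ℝ≥0∞) ^ (-(k * (s + α))) * dyadicSum δ 1 β k x)) +
    (2 : ℝ≥0∞) ^ (-(k * α)) * (‖u x‖ₑ + ratioConst c Q 7 *
      ((1 + 3 * (2 * (ratioConst c Q 2 + 1))) * 2 ^ (8 * s) *
        ((2 : ℝ≥0∞) ^ (-(k * s)) * dyadicSum δ 1 β k x)))) ?_ ?_
  · have e1 := h2p (8 * s)
    have e2 := h2p (-(k * s))
    have e3 := h2p (-(k * α))
    finiteness
  rw [D.dMax_eq μ α u x]
  refine iSup₂_le fun r hr => ?_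
  have hr' : (0 : ℝ) < r := by exact_mod_cast hr
  rcases lt_or_ge (r : ℝ) (2 ^ (-k)) with hrk | hrk
  · refine le_trans (mul_le_mul' (ofReal_rpow_le hr' hα hrk) ?_) le_add_self
    obtain ⟨l, hl, hl'⟩ := exists_dyadic_radius hr'
    refine (hμ.conv_le D u hr hl hl' x (u x)).trans ?_
    gcongr
    exact hμ.avg_enorm_sub_le_dyadicSum hδ hδs hu hx h (dyadic_radius_index hrk hl')
  · refine (hμ.conv_le_of_le D hs hα hsα hδ' hu h hr hrk (x := x) (y := x₀)
      (by simpa using hr'.le) (by rw [dist_comm]; linarith) hk).trans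
      (le_trans ?_ le_self_add)
    gcongr
    exact D.le_dMax μ α u x₀ hr

end MaximalEstimate

section Convolution

lemma tsum_rpow_le_tsum_rpow {ι : Type*} {t : ℝ} (ht : 0 < t) (ht1 : t ≤ 1) (f : ι → ℝ≥0∞) :
    (∑' i, f i) ^ t ≤ ∑' i, f i ^ t := by
  rw [← ENNReal.le_rpow_inv_iff ht, ENNReal.tsum_eq_iSup_sum]
  refine iSup_le fun I => ?_
  rw [ENNReal.le_rpow_inv_iff ht]
  refine le_trans ?_ (ENNReal.sum_le_tsum I)
  classical
  induction I using Finset.induction_on with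
  | empty => simp [ht]
  | insert i I hi ih =>
    rw [Finset.sum_insert hi, Finset.sum_insert hi]
    exact (ENNReal.rpow_add_le_add_rpow _ _ ht.le ht1).trans (add_le_add le_rfl ih)

lemma tsum_mul_rpow_le {ι : Type*} {R : ℝ} (hR : 1 ≤ R) (w f : ι → ℝ≥0∞) :
    (∑' i, w i * f i) ^ R ≤ (∑' i, w i) ^ (R - 1) * ∑' i, w i * f i ^ R := by
  let _ : MeasurableSpace ι := ⊤
  have hR0 : 0 < R := by linarith
  have hR1 : R⁻¹ ≤ 1 := inv_le_one_of_one_le₀ hR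
  have hi0 : 0 ≤ R⁻¹ := by positivity
  have h := ENNReal.lintegral_mul_norm_pow_le (μ := Measure.count) (f := w)
    (g := fun i => w i * f i ^ R) (p := 1 - R⁻¹) (q := R⁻¹) measurable_from_top.aemeasurable
    measurable_from_top.aemeasurable (by linarith) hi0 (by ring)
  simp only [lintegral_count] at h
  have hterm : ∀ i, w i ^ (1 - R⁻¹) * (w i * f i ^ R) ^ R⁻¹ = w i * f i := fun i => by
    rw [ENNReal.mul_rpow_of_nonneg _ _ hi0, ← mul_assoc,
      ← ENNReal.rpow_add_of_nonneg _ _ (by linarith) hi0, ← ENNReal.rpow_mul,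
      mul_inv_cancel₀ hR0.ne']
    simp
  simp only [hterm] at h
  calc (∑' i, w i * f i) ^ R
      ≤ ((∑' i, w i) ^ (1 - R⁻¹) * (∑' i, w i * f i ^ R) ^ R⁻¹) ^ R :=
        ENNReal.rpow_le_rpow h hR0.le
    _ = _ := by
        rw [ENNReal.mul_rpow_of_nonneg _ _ hR0.le, ← ENNReal.rpow_mul, ← ENNReal.rpow_mul,
          inv_mul_cancel₀ hR0.ne', ENNReal.rpow_one, sub_mul, one_mul, inv_mul_cancel₀ hR0.ne']

/-- The total mass of the weights of `dyadicSum`. -/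
noncomputable def dyadicMass (δ : ℝ) : ℝ≥0∞ := ∑' m : ℤ, (2 : ℝ≥0∞) ^ (-(δ * |(m : ℝ)|))

lemma dyadicMass_ne_top {δ : ℝ} (hδ : 0 < δ) : dyadicMass δ ≠ ⊤ := by
  have hg := tsum_nat_geometric_ne_top (two_rpow_neg_lt_one hδ)
  have hpow : ∀ n : ℕ, ((2 : ℝ≥0∞) ^ (-δ)) ^ n = 2 ^ (-(δ * n)) := fun n => by
    rw [← ENNReal.rpow_natCast, ← ENNReal.rpow_mul, neg_mul]
  simp only [hpow] at hg
  rw [dyadicMass, tsum_of_nat_of_neg_add_one ENNReal.summable ENNReal.summable]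
  refine ENNReal.add_ne_top.2 ⟨by simpa using hg, ne_top_of_le_ne_top hg ?_⟩
  refine ENNReal.tsum_le_tsum fun n => ENNReal.rpow_le_rpow_of_exponent_le one_le_two ?_
  have hn : (0 : ℝ) ≤ n := n.cast_nonneg
  have : |(((-((n : ℤ) + 1)) : ℤ) : ℝ)| = n + 1 := by
    push_cast
    rw [abs_neg, abs_of_nonneg (by linarith)]
  rw [this]
  nlinarith

lemma tsum_dyadicSum_rpow_le {δ t R : ℝ} (hR : 1 ≤ R) (G : ℤ → X → ℝ≥0∞) (x : X) :
    ∑' l : ℤ, dyadicSum δ t G l x ^ R ≤ dyadicMass δ ^ R * ∑' i : ℤ, G i x ^ (t * R) := by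
  have hw : ∀ l : ℤ, ∑' i : ℤ, (2 : ℝ≥0∞) ^ (-(δ * |(i : ℝ) - l|)) = dyadicMass δ := fun l => by
    rw [dyadicMass, ← (Equiv.subRight l).tsum_eq (fun m : ℤ => (2 : ℝ≥0∞) ^ (-(δ * |(m : ℝ)|)))]
    simp
  have hw' : ∀ i : ℤ, ∑' l : ℤ, (2 : ℝ≥0∞) ^ (-(δ * |(i : ℝ) - l|)) = dyadicMass δ := fun i => by
    rw [dyadicMass, ← (Equiv.subLeft i).tsum_eq (fun m : ℤ => (2 : ℝ≥0∞) ^ (-(δ * |(m : ℝ)|)))]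
    simp
  calc ∑' l : ℤ, dyadicSum δ t G l x ^ R
      ≤ ∑' l : ℤ, dyadicMass δ ^ (R - 1) *
          ∑' i : ℤ, (2 : ℝ≥0∞) ^ (-(δ * |(i : ℝ) - l|)) * (G i x ^ t) ^ R := by
        refine ENNReal.tsum_le_tsum fun l => ?_
        rw [← hw l]
        exact tsum_mul_rpow_le hR _ _
    _ = dyadicMass δ ^ (R - 1) * (dyadicMass δ ^ (1 : ℝ) * ∑' i : ℤ, G i x ^ (t * R)) := by
        rw [ENNReal.tsum_mul_left, ENNReal.tsum_comm]
        congr 1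
        rw [← ENNReal.tsum_mul_left]
        refine tsum_congr fun i => ?_
        rw [ENNReal.tsum_mul_right, hw' i, ENNReal.rpow_mul, ENNReal.rpow_one]
    _ = _ := by
        rw [← mul_assoc, ← ENNReal.rpow_add_of_nonneg _ _ (by linarith) zero_le_one,
          sub_add_cancel]

lemma dyadicSum_one_rpow_le {δ t : ℝ} (ht : 0 < t) (ht1 : t ≤ 1) (β : ℤ → X → ℝ≥0∞) (k : ℤ)
    (x : X) : dyadicSum δ 1 β k x ^ t ≤ dyadicSum (δ * t) t β k x := by
  refine (tsum_rpow_le_tsum_rpow ht ht1 _).trans_eq (tsum_congr fun i => ?_)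
  rw [ENNReal.mul_rpow_of_nonneg _ _ ht.le, ENNReal.rpow_one, ← ENNReal.rpow_mul]
  congr 2
  ring

lemma tsum_dyadicSum_one_rpow_le {δ t q : ℝ} (ht : 0 < t) (ht1 : t ≤ 1) (htq : t ≤ q)
    (β : ℤ → X → ℝ≥0∞) (x : X) :
    ∑' k : ℤ, dyadicSum δ 1 β k x ^ q ≤ dyadicMass (δ * t) ^ (q / t) * ∑' l : ℤ, β l x ^ q := by
  have hq : t * (q / t) = q := by field_simp
  calc ∑' k : ℤ, dyadicSum δ 1 β k x ^ q
      ≤ ∑' k : ℤ, dyadicSum (δ * t) t β k x ^ (q / t) := by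
        refine ENNReal.tsum_le_tsum fun k => ?_
        rw [← hq, ENNReal.rpow_mul, hq]
        exact ENNReal.rpow_le_rpow (dyadicSum_one_rpow_le ht ht1 β k x)
          (div_nonneg (ht.le.trans htq) ht.le)
    _ ≤ dyadicMass (δ * t) ^ (q / t) * ∑' l : ℤ, β l x ^ (t * (q / t)) :=
        tsum_dyadicSum_rpow_le ((one_le_div ht).2 htq) β x
    _ = _ := by rw [hq]

variable [MetricSpace X] [MeasurableSpace X] [BorelSpace X] [SecondCountableTopology X]
  {μ : Measure X} {c Q : ℝ}

/-- Boundedness in `L^p(ℓ^q)` of the composition of the averaging operators with the two-sided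
weighted sums. -/
lemma IsRegular.exists_lintegral_dyadicSum_avg_le (hμ : IsRegular μ c Q) {t p q δ δ' : ℝ}
    (ht : 0 < t) (ht1 : t ≤ 1) (htp : t < p) (htq : t < q) (hδ : 0 < δ) (hδ' : 0 < δ')
    {K : ℝ≥0∞} (hK : K ≠ ⊤) :
    ∃ C : ℝ≥0∞, C ≠ ⊤ ∧ ∀ G : ℤ → X → ℝ≥0∞, (∀ i, Measurable (G i)) →
      ∫⁻ x, (∑' k : ℤ, dyadicSum δ' 1 (fun l x =>
          K * avg μ (dyadicSum δ t G l) x (2 ^ (1 - l)) ^ (1 / t)) k x ^ q) ^ (p / q) ∂μ ≤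
        C * ∫⁻ x, (∑' i : ℤ, G i x ^ q) ^ (p / q) ∂μ := by
  have hp : 0 < p := ht.trans htp
  have hq : 0 < q := ht.trans htq
  have hpq : 0 ≤ p / q := by positivity
  have hR0 : 0 ≤ q / t := by positivity
  have hPR : p / t / (q / t) = p / q := by field_simp
  obtain ⟨C₀, hC₀, h⟩ := hμ.lintegral_tsum_avg_rpow_rpow_le (P := p / t) (R := q / t)
    ((one_lt_div ht).2 htp) ((one_lt_div ht).2 htq)
  rw [hPR] at h
  have hM := dyadicMass_ne_top hδ
  have hM' := dyadicMass_ne_top (mul_pos hδ' ht)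
  set A₁ : ℝ≥0∞ := (dyadicMass (δ' * t) ^ (q / t) * K ^ q) ^ (p / q) with hA₁
  set A₂ : ℝ≥0∞ := (dyadicMass δ ^ (q / t)) ^ (p / q) with hA₂
  have hA₁t : A₁ ≠ ⊤ := ENNReal.rpow_ne_top_of_nonneg hpq (ENNReal.mul_ne_top
    (ENNReal.rpow_ne_top_of_nonneg hR0 hM') (ENNReal.rpow_ne_top_of_nonneg hq.le hK))
  have hA₂t : A₂ ≠ ⊤ :=
    ENNReal.rpow_ne_top_of_nonneg hpq (ENNReal.rpow_ne_top_of_nonneg hR0 hM)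
  refine ⟨A₁ * (C₀ * A₂), ENNReal.mul_ne_top hA₁t (ENNReal.mul_ne_top hC₀ hA₂t), fun G hG => ?_⟩
  have hF : ∀ l, Measurable (dyadicSum δ t G l) := fun l => measurable_dyadicSum hG l
  calc _ ≤ ∫⁻ x, A₁ * (∑' l : ℤ, avg μ (dyadicSum δ t G l) x (2 ^ (1 - l)) ^ (q / t)) ^ (p / q) ∂μ := by
        refine lintegral_mono fun x => ?_
        rw [hA₁, ← ENNReal.mul_rpow_of_nonneg _ _ hpq, mul_assoc]
        refine ENNReal.rpow_le_rpow
          ((tsum_dyadicSum_one_rpow_le ht ht1 htq.le _ x).trans_eq ?_) hpq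
        congr 1
        rw [← ENNReal.tsum_mul_left]
        refine tsum_congr fun l => ?_
        rw [ENNReal.mul_rpow_of_nonneg _ _ hq.le, ← ENNReal.rpow_mul]
        congr 2
        ring
    _ = A₁ * ∫⁻ x, (∑' l : ℤ, avg μ (dyadicSum δ t G l) x (2 ^ (1 - l)) ^ (q / t)) ^ (p / q) ∂μ :=
        lintegral_const_mul' _ _ hA₁t
    _ ≤ A₁ * (C₀ * ∫⁻ x, (∑' l : ℤ, dyadicSum δ t G l x ^ (q / t)) ^ (p / q) ∂μ) :=
        mul_le_mul_right (h _ hF) _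
    _ ≤ A₁ * (C₀ * ∫⁻ x, A₂ * (∑' i : ℤ, G i x ^ q) ^ (p / q) ∂μ) := by
        refine mul_le_mul_right (mul_le_mul_right (lintegral_mono fun x => ?_) _) _
        rw [hA₂, ← ENNReal.mul_rpow_of_nonneg _ _ hpq]
        refine ENNReal.rpow_le_rpow
          ((tsum_dyadicSum_rpow_le ((one_le_div ht).2 htq.le) G x).trans_eq ?_) hpq
        rw [mul_div_cancel₀ _ ht.ne']
    _ = _ := by rw [lintegral_const_mul' _ _ hA₂t]; ring

end Convolution

section Main

lemma DiscreteMaxData.secondCountableTopology [MetricSpace X] (D : DiscreteMaxData X) :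
    SecondCountableTopology X := by
  refine Metric.secondCountable_of_almost_dense_set fun ε hε => ?_
  obtain ⟨r, hr0, hrε⟩ := exists_rat_btwn hε
  have hr : 0 < r := by exact_mod_cast hr0
  refine ⟨Set.range (D.center r), Set.countable_range _, fun x => ?_⟩
  obtain ⟨i, hi⟩ := D.cover r hr x
  exact ⟨_, ⟨i, rfl⟩, (mem_ball.1 hi).le.trans hrε.le⟩

variable [MetricSpace X] [MeasurableSpace X] {μ : Measure X}

lemma tlNorm_le {s p q : ℝ} {u : X → ℝ} {g : ℤ → X → ℝ} (hg : IsFracHajlaszGradient μ s u g) :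
    tlNorm μ s p q u ≤ (∫⁻ x, (∑' k : ℤ, ENNReal.ofReal (g k x ^ q)) ^ (p / q) ∂μ) ^ (1 / p) :=
  iInf₂_le g hg

lemma annularBound_ofReal {s : ℝ} (hs : 0 ≤ s) {u : X → ℝ}
    {g : ℤ → X → ℝ} {E : Set X} (hg : ∀ k x, 0 ≤ g k x)
    (h : ∀ (k : ℤ), ∀ x ∉ E, ∀ y ∉ E, (2 : ℝ) ^ (-k - 1) ≤ dist x y → dist x y < (2 : ℝ) ^ (-k) →
        |u x - u y| ≤ dist x y ^ s * (g k x + g k y)) :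
    AnnularBound s u (fun k x => ENNReal.ofReal (g k x)) E := by
  intro k x hx y hy h1 h2
  have hd : 0 < dist x y := lt_of_lt_of_le (by positivity) h1
  calc ‖u x - u y‖ₑ = ENNReal.ofReal |u x - u y| := Real.enorm_eq_ofReal_abs _
    _ ≤ ENNReal.ofReal (dist x y ^ s * (g k x + g k y)) :=
        ENNReal.ofReal_le_ofReal (h k x hx y hy h1 h2)
    _ = ENNReal.ofReal (dist x y ^ s) * (ENNReal.ofReal (g k x) + ENNReal.ofReal (g k y)) := by
        rw [ENNReal.ofReal_mul (by positivity), ENNReal.ofReal_add (hg k x) (hg k y)]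
    _ ≤ _ := by
        gcongr
        exact ofReal_rpow_le hd hs h2

/-- A two-sided pointwise bound in extended nonnegative reals gives the gradient inequality. -/
lemma abs_toReal_sub_le {a b A B C : ℝ≥0∞} (ha : a ≠ ⊤) (hb : b ≠ ⊤) (hA : A ≠ ⊤) (hB : B ≠ ⊤)
    (hC : C ≠ ⊤) {d γ : ℝ} (hγ : 0 < γ) {k : ℤ} (hd : (2 : ℝ) ^ (-k - 1) ≤ d)
    (h1 : a ≤ b + C * ((2 : ℝ≥0∞) ^ (-(k * γ)) * (A + B)))
    (h2 : b ≤ a + C * ((2 : ℝ≥0∞) ^ (-(k * γ)) * (A + B))) :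
    |a.toReal - b.toReal| ≤
      d ^ γ * ((C * 2 ^ γ * A).toReal + (C * 2 ^ γ * B).toReal) := by
  have hd0 : 0 < d := lt_of_lt_of_le (by positivity) hd
  have h2γ := two_rpow_ne_top γ
  have hkey : (2 : ℝ≥0∞) ^ (-(k * γ)) ≤ ENNReal.ofReal (d ^ γ) * 2 ^ γ := by
    rw [← ofReal_two_rpow, ← ofReal_two_rpow, ← ENNReal.ofReal_mul (by positivity)]
    refine ENNReal.ofReal_le_ofReal ?_
    calc (2 : ℝ) ^ (-(k * γ)) = ((2 : ℝ) ^ (-k - 1)) ^ γ * 2 ^ γ := by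
          rw [← Real.rpow_intCast, ← Real.rpow_mul two_pos.le, ← Real.rpow_add two_pos]
          push_cast
          ring_nf
      _ ≤ _ := by gcongr
  have hCA : C * 2 ^ γ * A ≠ ⊤ := by finiteness
  have hCB : C * 2 ^ γ * B ≠ ⊤ := by finiteness
  have hle : C * ((2 : ℝ≥0∞) ^ (-(k * γ)) * (A + B)) ≤
      ENNReal.ofReal (d ^ γ * ((C * 2 ^ γ * A).toReal + (C * 2 ^ γ * B).toReal)) := by
    rw [ENNReal.ofReal_mul (by positivity), ENNReal.ofReal_add toReal_nonneg toReal_nonneg,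
      ENNReal.ofReal_toReal hCA, ENNReal.ofReal_toReal hCB]
    calc C * ((2 : ℝ≥0∞) ^ (-(k * γ)) * (A + B))
        ≤ C * ((ENNReal.ofReal (d ^ γ) * 2 ^ γ) * (A + B)) := by gcongr
      _ = _ := by ring
  set M := d ^ γ * ((C * 2 ^ γ * A).toReal + (C * 2 ^ γ * B).toReal) with hM
  have hM0 : 0 ≤ M := by positivity
  have h3 := ENNReal.toReal_mono (by finiteness) (h1.trans (add_le_add le_rfl hle))
  have h4 := ENNReal.toReal_mono (by finiteness) (h2.trans (add_le_add le_rfl hle))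
  rw [ENNReal.toReal_add hb ofReal_ne_top, ENNReal.toReal_ofReal hM0] at h3
  rw [ENNReal.toReal_add ha ofReal_ne_top, ENNReal.toReal_ofReal hM0] at h4
  rw [abs_le]
  constructor <;> linarith

variable [BorelSpace X] {c Q : ℝ}

lemma IsRegular.exists_tlNorm_dMax_le (hμ : IsRegular μ c Q) (D : DiscreteMaxData X)
    {s α p q : ℝ} (hs : 0 < s) (hα : 0 ≤ α) (hsα : s + α < 1) (hp : Q / (Q + s) < p)
    (hq : Q / (Q + s) < q) :
    ∃ C : ℝ≥0∞, C ≠ ⊤ ∧ ∀ u : X → ℝ, LocallyIntegrable u μ → (∃ x, D.dMax μ α u x ≠ ⊤) →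
      tlNorm μ (s + α) p q (fun x => (D.dMax μ α u x).toReal) ≤ C * tlNorm μ s p q u := by
  have := D.secondCountableTopology
  have hQ := hμ.Q_pos
  have hQs1 : Q / (Q + s) < 1 := (div_lt_one (by linarith)).2 (by linarith)
  obtain ⟨t, htQ, htm⟩ := exists_between (lt_min (lt_min hp hq) hQs1)
  have htp : t < p := htm.trans_le ((min_le_left _ _).trans (min_le_left _ _))
  have htq : t < q := htm.trans_le ((min_le_left _ _).trans (min_le_right _ _))
  have ht1 : t ≤ 1 := (htm.trans_le (min_le_right _ _)).le
  have ht : 0 < t := lt_trans (div_pos hQ (by linarith)) htQ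
  have hp0 : 0 < p := ht.trans htp
  have hq0 : 0 < q := ht.trans htq
  have hpq : 0 < p / q := div_pos hp0 hq0
  have hε : Q * (1 / t - 1) < s := by
    rw [div_lt_iff₀ (by linarith)] at htQ
    have : Q * (1 / t - 1) = (Q - Q * t) / t := by field_simp
    rw [this, div_lt_iff₀ ht]
    linarith
  obtain ⟨σ, hσ, hσs⟩ := exists_between hε
  set δ := (s - σ) * t with hδ
  have hδ0 : 0 < δ := mul_pos (by linarith) ht
  set δ' := min s (1 - (s + α)) with hδ'
  have hδ'0 : 0 < δ' := lt_min hs (by linarith)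
  obtain ⟨K, hK, hpoinc⟩ := hμ.exists_avg_enorm_sub_le_dyadicSum ht ht1 hσ hσs.le
  obtain ⟨C₁, hC₁, hmax⟩ := hμ.exists_dMax_le D hs hα hsα hδ'0.le (min_le_left _ _)
    (min_le_right _ _)
  obtain ⟨C₂, hC₂, hint⟩ := hμ.exists_lintegral_dyadicSum_avg_le ht ht1 htp htq hδ0 hδ'0 hK
  set C₃ : ℝ≥0∞ := C₁ * 2 ^ (s + α) with hC₃
  have hC₃t : C₃ ≠ ⊤ := ENNReal.mul_ne_top hC₁ (two_rpow_ne_top _)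
  have hCt : ((C₃ ^ q) ^ (p / q) * C₂) ^ (1 / p) + 1 ≠ ⊤ := by
    refine ENNReal.add_ne_top.2 ⟨ENNReal.rpow_ne_top_of_nonneg (by positivity)
      (ENNReal.mul_ne_top (ENNReal.rpow_ne_top_of_nonneg hpq.le
        (ENNReal.rpow_ne_top_of_nonneg hq0.le hC₃t)) hC₂), one_ne_top⟩
  refine ⟨((C₃ ^ q) ^ (p / q) * C₂) ^ (1 / p) + 1, hCt, ?_⟩
  rintro u hu ⟨x₀, hx₀⟩
  have hum : AEMeasurable u μ := hu.aestronglyMeasurable.aemeasurable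
  have hC0 : ((C₃ ^ q) ^ (p / q) * C₂) ^ (1 / p) + 1 ≠ 0 := by simp
  rw [mul_comm, ← ENNReal.div_le_iff hC0 hCt]
  refine le_iInf₂ fun g hg => ?_
  rw [ENNReal.div_le_iff hC0 hCt, mul_comm]
  obtain ⟨hgm, hg0, E, hE, hgE⟩ := hg
  set G : ℤ → X → ℝ≥0∞ := fun k x => ENNReal.ofReal (g k x) with hG
  have hGm : ∀ k, Measurable (G k) := fun k => (hgm k).ennreal_ofReal
  have hGq : ∀ k x, ENNReal.ofReal (g k x ^ q) = G k x ^ q := fun k x =>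
    (ENNReal.ofReal_rpow_of_nonneg (hg0 k x) hq0.le).symm
  simp only [hGq]
  set N := ∫⁻ x, (∑' k : ℤ, G k x ^ q) ^ (p / q) ∂μ with hN
  rcases eq_or_ne N ⊤ with hNt | hNt
  · rw [hNt, ENNReal.top_rpow_of_pos (by positivity), ENNReal.mul_top hC0]
    exact le_top
  have hpo := hpoinc u G E hu hGm hE (annularBound_ofReal hs.le hg0 hgE)
  set β : ℤ → X → ℝ≥0∞ := fun l x => K * avg μ (dyadicSum δ t G l) x (2 ^ (1 - l)) ^ (1 / t)
    with hβ
  have hβm : ∀ l, Measurable (β l) := fun l =>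
    ((hμ.measurable_avg (measurable_dyadicSum hGm l) _).pow_const _).const_mul _
  set Θ : ℤ → X → ℝ≥0∞ := dyadicSum δ' 1 β with hΘ
  have hΘm : ∀ k, Measurable (Θ k) := fun k => measurable_dyadicSum hβm k
  have hΘint : ∫⁻ x, (∑' k : ℤ, Θ k x ^ q) ^ (p / q) ∂μ ≤ C₂ * N := hint G hGm
  have hSm : Measurable fun x => (∑' k : ℤ, Θ k x ^ q) ^ (p / q) :=
    (Measurable.tsum fun k => (hΘm k).pow_const q).pow_const _
  have hfin : ∀ᵐ x ∂μ, IsLebesguePoint μ u x ∧ ∀ k, Θ k x ≠ ⊤ := by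
    filter_upwards [hμ.ae_isLebesguePoint hu, ae_lt_top hSm
      (ne_top_of_le_ne_top (ENNReal.mul_ne_top hC₂ hNt) hΘint)] with x hx hxS
    refine ⟨hx, fun k hk => hxS.ne ?_⟩
    have h1 : ∑' k : ℤ, Θ k x ^ q = ⊤ := top_le_iff.1 (le_trans
      (by rw [hk, ENNReal.top_rpow_of_pos hq0]) (ENNReal.le_tsum k))
    rw [h1, ENNReal.top_rpow_of_pos hpq]
  have hgrad : IsFracHajlaszGradient μ (s + α) (fun x => (D.dMax μ α u x).toReal)
      (fun k x => (C₃ * Θ k x).toReal) := by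
    refine ⟨fun k => ((hΘm k).const_mul _).ennreal_toReal, fun k x => toReal_nonneg,
      {x | ¬(IsLebesguePoint μ u x ∧ ∀ k, Θ k x ≠ ⊤)}, hfin, ?_⟩
    intro k x hx y hy h1 h2
    simp only [Set.mem_ofPred_eq, not_not] at hx hy
    have hfx := hμ.dMax_ne_top D hs hα hsα hδ'0.le (min_le_left _ _) (min_le_right _ _) hum
      (fun l => hpo l x) hx.1 hx.2 hx₀
    have hfy := hμ.dMax_ne_top D hs hα hsα hδ'0.le (min_le_left _ _) (min_le_right _ _) hum
      (fun l => hpo l y) hy.1 hy.2 hx₀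
    refine abs_toReal_sub_le hfx hfy (hx.2 k) (hy.2 k) hC₁ (by linarith) h1
      (hmax u β hum hpo k x y hx.1 hy.1 h2) ?_
    rw [add_comm (Θ k x)]
    exact hmax u β hum hpo k y x hy.1 hx.1 (by rwa [dist_comm])
  refine (tlNorm_le hgrad).trans ?_
  calc (∫⁻ x, (∑' k : ℤ, ENNReal.ofReal ((C₃ * Θ k x).toReal ^ q)) ^ (p / q) ∂μ) ^ (1 / p)
      ≤ (∫⁻ x, (C₃ ^ q) ^ (p / q) * (∑' k : ℤ, Θ k x ^ q) ^ (p / q) ∂μ) ^ (1 / p) := by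
        refine ENNReal.rpow_le_rpow (lintegral_mono fun x => ?_) (by positivity)
        rw [← ENNReal.mul_rpow_of_nonneg _ _ hpq.le, ← ENNReal.tsum_mul_left]
        refine ENNReal.rpow_le_rpow (ENNReal.tsum_le_tsum fun k => ?_) hpq.le
        rw [← ENNReal.mul_rpow_of_nonneg _ _ hq0.le,
          ← ENNReal.ofReal_rpow_of_nonneg toReal_nonneg hq0.le]
        exact ENNReal.rpow_le_rpow ENNReal.ofReal_toReal_le hq0.le
    _ ≤ ((C₃ ^ q) ^ (p / q) * (C₂ * N)) ^ (1 / p) := by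
        rw [lintegral_const_mul _ hSm]
        exact ENNReal.rpow_le_rpow (mul_le_mul_right hΘint _) (by positivity)
    _ = ((C₃ ^ q) ^ (p / q) * C₂) ^ (1 / p) * N ^ (1 / p) := by
        rw [← mul_assoc, ENNReal.mul_rpow_of_nonneg _ _ (by positivity)]
    _ ≤ _ := mul_le_mul_left le_self_add _

end Main

section Degenerate

variable [MetricSpace X] [MeasurableSpace X] {μ : Measure X} {c Q : ℝ}

lemma tlNorm_zero_measure {s p q : ℝ} (hp : 0 < p) (u : X → ℝ) :
    tlNorm (0 : Measure X) s p q u = 0 := by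
  refine le_antisymm ((tlNorm_le (g := fun _ _ => 0) ⟨fun _ => measurable_const,
    fun _ _ => le_rfl, Set.univ, rfl, fun _ x hx => absurd (Set.mem_univ x) hx⟩).trans ?_) zero_le
  simp [hp]

lemma tlNorm_zero {s p q : ℝ} (hp : 0 < p) (hq : 0 < q) :
    tlNorm μ s p q (fun _ => 0) = 0 := by
  refine le_antisymm ((tlNorm_le (g := fun _ _ => 0) ⟨fun _ => measurable_const,
    fun _ _ => le_rfl, ∅, measure_empty, fun _ x _ y _ _ _ => by simp⟩).trans ?_) zero_le
  have : 0 < p / q := div_pos hp hq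
  simp [hp, Real.zero_rpow hq.ne', this]

lemma measure_eq_zero_of_ball (hc : 0 < c) (hdim : DimLowerBound μ c Q) {x : X} {r : ℝ}
    (hr : 0 < r) (h : μ (ball x r) = 0) : μ = 0 := by
  have hball : ∀ n : ℕ, μ (ball x (r + n)) = 0 := fun n => by
    have hn : (0 : ℝ) ≤ n := n.cast_nonneg
    have h1 := hdim x x r (r + n) hr (by linarith) (mem_ball_self (by linarith))
    rw [h, nonpos_iff_eq_zero, mul_eq_zero] at h1
    refine h1.resolve_left ?_
    rw [ENNReal.ofReal_eq_zero, not_le]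
    positivity
  rw [← Measure.measure_univ_eq_zero]
  have : (Set.univ : Set X) = ⋃ n : ℕ, ball x (r + n) := by
    refine (Set.eq_univ_of_forall fun y => ?_).symm
    obtain ⟨n, hn⟩ := exists_nat_gt (dist y x)
    exact Set.mem_iUnion.2 ⟨n, mem_ball.2 (by linarith)⟩
  rw [this, measure_iUnion_null hball]

lemma measure_ball_eq_top (hc : 0 < c) (hdim : DimLowerBound μ c Q) {x : X} {r : ℝ}
    (h : μ (ball x r) = ⊤) (y : X) {r' : ℝ} (hr' : 0 < r') : μ (ball y r') = ⊤ := by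
  set R := max r' (dist x y + r) with hR
  have hrR : r' ≤ R := le_max_left _ _
  have hR0 : 0 < R := hr'.trans_le hrR
  have htop : μ (ball y R) = ⊤ := top_le_iff.1 (h.symm.le.trans (measure_mono fun z hz => by
    have := dist_triangle z x y
    rw [mem_ball] at hz ⊢
    exact lt_of_lt_of_le (by linarith) (le_max_right _ _)))
  have h1 := hdim y y r' R hr' hrR (mem_ball_self hR0)
  rw [htop, ENNReal.mul_top (by
    rw [Ne, ENNReal.ofReal_eq_zero, not_le]
    positivity)] at h1
  exact top_le_iff.1 h1

lemma DiscreteMaxData.dMax_eq_zero (D : DiscreteMaxData X) {α : ℝ} (u : X → ℝ)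
    (h : ∀ (y : X) (r : ℝ), 0 < r → μ (ball y r) = ⊤) (x : X) : D.dMax μ α u x = 0 := by
  rw [D.dMax_eq]
  refine le_antisymm (iSup₂_le fun r hr => ?_) zero_le
  have hr' : (0 : ℝ) < r := by exact_mod_cast hr
  have h0 : ∀ i, avg μ (fun y => ‖u y‖ₑ) (D.center r i) (3 * (r : ℝ)) = 0 := fun i => by
    rw [avg_eq, h _ _ (by linarith), ENNReal.div_top]
  simp [DiscreteMaxData.conv, h0]

end Degenerate

theorem statement14 [MetricSpace X] [MeasurableSpace X] [BorelSpace X] (μ : Measure X)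
    (c_d : ℝ≥0∞) (hdoub : IsDoubling μ c_d) (Q : ℝ) (hQ : 1 < Q)
    (c_Q : ℝ) (hcQ : 0 < c_Q) (hdim : DimLowerBound μ c_Q Q)
    (D : DiscreteMaxData X)
    (s α p q : ℝ) (hs : 0 < s) (hα : 0 ≤ α) (hsα0 : 0 < s + α) (hsα1 : s + α < 1)
    (hp : Q / (Q + s) < p) (hq : Q / (Q + s) < q) :
    ∃ C : ℝ, 0 < C ∧ ∀ u : X → ℝ, LocallyIntegrable u μ → tlNorm μ s p q u ≠ ⊤ →
      (∃ x, D.dMax μ α u x ≠ ⊤) →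
      tlNorm μ (s + α) p q (fun x => (D.dMax μ α u x).toReal) ≤
        ENNReal.ofReal C * tlNorm μ s p q u := by
  have hQ0 : 0 < Q := by linarith
  have hQs : 0 < Q / (Q + s) := by positivity
  have hp0 : 0 < p := hQs.trans hp
  have hq0 : 0 < q := hQs.trans hq
  by_cases hzero : ∃ (x : X) (r : ℝ), 0 < r ∧ μ (ball x r) = 0
  · obtain ⟨x, r, hr, h⟩ := hzero
    refine ⟨1, one_pos, fun u _ _ _ => ?_⟩
    rw [measure_eq_zero_of_ball hcQ hdim hr h, tlNorm_zero_measure hp0]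
    exact zero_le
  by_cases htop : ∃ (x : X) (r : ℝ), μ (ball x r) = ⊤
  · obtain ⟨x, r, h⟩ := htop
    refine ⟨1, one_pos, fun u _ _ _ => ?_⟩
    simp only [D.dMax_eq_zero u fun y r' hr' => measure_ball_eq_top hcQ hdim h y hr',
      ENNReal.toReal_zero, tlNorm_zero hp0 hq0]
    exact zero_le
  push Not at hzero htop
  have hμ : IsRegular μ c_Q Q := ⟨hcQ, hQ0, hdim, hzero, htop⟩
  obtain ⟨C, hC, h⟩ := hμ.exists_tlNorm_dMax_le D hs hα hsα1 hp hq
  refine ⟨C.toReal + 1, by positivity, fun u hu _ hx => (h u hu hx).trans ?_⟩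
  gcongr
  rw [ENNReal.ofReal_add ENNReal.toReal_nonneg zero_le_one, ENNReal.ofReal_toReal hC]
  exact le_self_add

end FracMaximal
end
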